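/- arXiv:1609.01222 — 2 statements merged into one kernel-verified Lean document; each statement's English description precedes it below -/
import Mathlib

section
/- If the rotation set of f ∈ Homeo₀(T²) is upper-stable in Homeo₀(T²) (i.e. δ-upper-stable for some δ > 0), then for any lift f̃ of f every extremal point of ρ(f̃) has rational coordinates, i.e. lies in ℚ². -/
noncomputable section

open Metric Set Filter Topology MeasureTheory Pointwise

/-- The plane `ℝ²` with the Euclidean metric. -/
abbrev R2 : Type := EuclideanSpace ℝ (Fin 2)

/-- The integer lattice `ℤ² ⊂ ℝ²`. -/
def intLattice : AddSubgroup R2 where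
  carrier := {v : R2 | ∀ i, ∃ n : ℤ, v i = (n : ℝ)}
  add_mem' := by
    intro a b ha hb i
    obtain ⟨m, hm⟩ := ha i
    obtain ⟨n, hn⟩ := hb i
    exact ⟨m + n, by push_cast; rw [← hm, ← hn]; rfl⟩
  zero_mem' := fun i => ⟨0, by simp⟩
  neg_mem' := by
    intro a ha i
    obtain ⟨m, hm⟩ := ha i
    exact ⟨-m, by push_cast; rw [← hm]; rfl⟩

/-- The torus `T² = ℝ²/ℤ²`, with the quotient (Euclidean) metric. -/
abbrev T2 : Type := R2 ⧸ intLattice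

/-- The covering projection `π : ℝ² → T²`. -/
def pr : R2 → T2 := QuotientAddGroup.mk

instance : MeasurableSpace T2 := borel T2
instance : BorelSpace T2 := ⟨rfl⟩

/-- A fundamental domain `[0,1)²` for the lattice action. -/
def fundDomain : Set R2 := {x : R2 | ∀ i, x i ∈ Set.Ico (0 : ℝ) 1}

/-- Lebesgue (Haar) probability measure on the torus `T²`. -/
def lebT2 : Measure T2 := Measure.map pr (volume.restrict fundDomain)

/-- `F : ℝ² → ℝ²` is a lift of `f : T² → T²` if `π ∘ F = f ∘ π` and
`F (x + w) = F x + w` for every lattice vector `w ∈ ℤ²`. -/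
structure IsLift (f : T2 ≃ₜ T2) (F : R2 ≃ₜ R2) : Prop where
  proj : ∀ x : R2, pr (F x) = f (pr x)
  equivariant : ∀ x : R2, ∀ w ∈ intLattice, F (x + w) = F x + w

/-- `Homeo₀(T²)`: homeomorphisms of the torus isotopic to the identity,
characterized as those admitting a lift commuting with integer translations. -/
def Homeo0 : Set (T2 ≃ₜ T2) := {f | ∃ F : R2 ≃ₜ R2, IsLift f F}

/-- `Homeo_{0,λ}(T²)`: elements of `Homeo₀(T²)` preserving Lebesgue measure. -/
def Homeo0Leb : Set (T2 ≃ₜ T2) :=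
  {f | f ∈ Homeo0 ∧ MeasurePreserving f lebT2 lebT2}

/-- The uniform `C⁰` distance `d_{C⁰}(f,g) = sup_x d(f(x), g(x))` on torus maps. -/
def dC0 (f g : T2 ≃ₜ T2) : ℝ := ⨆ x : T2, dist (f x) (g x)

/-- The uniform distance `sup_{x ∈ ℝ²} ‖F(x) − G(x)‖` between maps of the plane. -/
def supDist (F G : R2 → R2) : ℝ := ⨆ x : R2, dist (F x) (G x)

/-- The rotation set `ρ(F̃)` of a lift: all limits `(F̃^{n_k}(z_k) − z_k)/n_k`. -/
def rotSet (F : R2 ≃ₜ R2) : Set R2 :=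
  {v | ∃ (z : ℕ → R2) (n : ℕ → ℕ), Tendsto n atTop atTop ∧
    Tendsto (fun k => (n k : ℝ)⁻¹ • ((⇑F)^[n k] (z k) - z k)) atTop (𝓝 v)}

/-- The rotation set of `f`, with fixed lift `F`, is `δ`-upper-stable in `H`. -/
def UpperStable (H : Set (T2 ≃ₜ T2)) (F : R2 ≃ₜ R2) (δ : ℝ) : Prop :=
  ∀ g ∈ H, ∀ G : R2 ≃ₜ R2, IsLift g G → supDist (⇑F) (⇑G) < δ →
    rotSet G ⊆ rotSet F

/-- The rotation set of `f`, with fixed lift `F`, is `δ`-stable in `H`. -/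
def StableRS (H : Set (T2 ≃ₜ T2)) (F : R2 ≃ₜ R2) (δ : ℝ) : Prop :=
  ∀ g ∈ H, ∀ G : R2 ≃ₜ R2, IsLift g G → supDist (⇑F) (⇑G) < δ →
    rotSet G = rotSet F

/-- `f` has a stable rotation set in `H`. -/
def HasStableRotSet (H : Set (T2 ≃ₜ T2)) (f : T2 ≃ₜ T2) : Prop :=
  ∃ F : R2 ≃ₜ R2, IsLift f F ∧ ∃ δ > 0, StableRS H F δ

/-- `S` is open in `H` for the uniform `C⁰` topology. -/
def OpenIn (H S : Set (T2 ≃ₜ T2)) : Prop :=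
  ∀ f ∈ S ∩ H, ∃ δ > 0, ∀ g ∈ H, dC0 f g < δ → g ∈ S

/-- `S` is dense in `H` for the uniform `C⁰` topology. -/
def DenseIn (H S : Set (T2 ≃ₜ T2)) : Prop :=
  ∀ f ∈ H, ∀ ε > 0, ∃ g ∈ S ∩ H, dC0 f g < ε

/-- `(x_i)_{0 ≤ i ≤ n}` is a finite `ε`-pseudo-orbit of `F`. -/
def IsPseudoOrbitUpTo (F : R2 → R2) (ε : ℝ) (x : ℕ → R2) (n : ℕ) : Prop :=
  ∀ i < n, dist (F (x i)) (x (i + 1)) < ε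

/-- `(x_i)_{i ∈ ℕ}` is an infinite `ε`-pseudo-orbit of `F`. -/
def IsPseudoOrbit (F : R2 → R2) (ε : ℝ) (x : ℕ → R2) : Prop :=
  ∀ i : ℕ, dist (F (x i)) (x (i + 1)) < ε

/-- The `ε`-pseudo-rotation set `ρ_ε(F̃)`. -/
def pseudoRotSet (F : R2 → R2) (ε : ℝ) : Set R2 :=
  {v | ∃ (n : ℕ → ℕ) (x : ℕ → ℕ → R2), Tendsto n atTop atTop ∧
    (∀ k, IsPseudoOrbitUpTo F ε (x k) (n k)) ∧
    Tendsto (fun k => (n k : ℝ)⁻¹ • (x k (n k) - x k 0)) atTop (𝓝 v)}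

/-- The oscillation `osc(f) = sup_{x,y} ‖(F(x) − x) − (F(y) − y)‖` of a lift. -/
def osc (F : R2 → R2) : ℝ := ⨆ p : R2 × R2, ‖(F p.1 - p.1) - (F p.2 - p.2)‖

/-- `f` has the shadowing property. -/
def Shadowing (f : T2 ≃ₜ T2) : Prop :=
  ∀ ε > 0, ∃ δ > 0, ∀ x : ℕ → T2, (∀ i, dist (f (x i)) (x (i + 1)) < δ) →
    ∃ z : T2, ∀ i, dist ((⇑f)^[i] z) (x i) < ε

/-- `v ∈ ℚ² ⊂ ℝ²`. -/
def IsRationalPoint (v : R2) : Prop := ∀ i, ∃ q : ℚ, v i = (q : ℝ)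


lemma exists_log_plane (Ψ : ℝ × ℝ → ℂ) (hc : Continuous Ψ) (h0 : ∀ x, Ψ x ≠ 0) :
    ∃ L : ℝ × ℝ → ℂ, Continuous L ∧ ∀ x, Complex.exp (L x) = Ψ x := by
  obtain ⟨L, ⟨-, hL⟩, -⟩ := Complex.isCoveringMapOn_exp.existsUnique_continuousMap_lifts
    (⟨Ψ, hc⟩ : C(ℝ × ℝ, ℂ)) (a₀ := (0, 0)) (Complex.exp_log (h0 (0, 0))) (fun x => h0 x)
  exact ⟨L, L.continuous, fun x => congrFun hL x⟩

/-- Approximate universal chord theorem (half chord). -/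
lemma half_chord (γ : ℝ → ℂ) (hγ : Continuous γ) (w : ℂ)
    (hne : ∀ s t, γ t - γ s ≠ w)
    (hfar : ∀ s ∈ Icc (0 : ℝ) 1, ‖γ 1 - γ 0 - 2 * w‖ < ‖γ s - γ 0 - w‖) : False := by
  obtain ⟨L, hLc, hL⟩ := exists_log_plane (fun x => γ x.2 - γ x.1 - w) (by fun_prop)
    (fun x => sub_ne_zero.2 (hne x.1 x.2))
  -- the diagonal is constant
  have hdiag : L (0, 0) = L (1, 1) := by
    have hD : Continuous (fun s : ℝ => L (s, s)) := by fun_prop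
    have hE : ∀ s : ℝ, Complex.exp (L (s, s) - L (0, 0)) = 1 := by
      intro s
      have hw : Complex.exp (L (s, s)) = Complex.exp (L (0, 0)) := by
        rw [hL, hL]; simp
      rw [Complex.exp_sub, hw, div_self (Complex.exp_ne_zero _)]
    have hn : ∀ s : ℝ, ∃ n : ℤ, L (s, s) - L (0, 0) = n * (2 * Real.pi * Complex.I) := fun s =>
      Complex.exp_eq_one_iff.1 (hE s)
    choose n hn using hn
    have hnc : Continuous (fun s => (n s : ℝ)) := by
      have : (fun s => (n s : ℝ)) = fun s => (L (s, s) - L (0, 0)).im / (2 * Real.pi) := by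
        funext s
        rw [hn s]
        have := Real.pi_pos
        simp
      rw [this]
      fun_prop
    have hnc' : Continuous n := Int.isClosedEmbedding_coe_real.isInducing.continuous_iff.2 hnc
    have h01 : n 0 = n 1 := PreconnectedSpace.constant inferInstance hnc'
    have h0 := hn 0
    have h1 := hn 1
    rw [← h01, ← h0] at h1
    exact (sub_left_injective h1).symm
  have hIVT : ∃ s ∈ Icc (0 : ℝ) 1, (L (s, 1) - L (0, s)).im = 0 := by
    have hc : ContinuousOn (fun s : ℝ => (L (s, 1) - L (0, s)).im) (uIcc 0 1) := by fun_prop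
    have := intermediate_value_uIcc hc
    have h0 : (0 : ℝ) ∈ uIcc ((L (0, 1) - L (0, 0)).im) ((L (1, 1) - L (0, 1)).im) := by
      rw [← hdiag]
      simp only [Complex.sub_im]
      rw [mem_uIcc]
      rcases le_total (L (0, 1)).im (L (0, 0)).im with h | h
      · left; constructor <;> linarith
      · right; constructor <;> linarith
    obtain ⟨s, hs, hs'⟩ := this h0
    exact ⟨s, by simpa using hs, hs'⟩
  obtain ⟨s, hs, him⟩ := hIVT
  set r := (L (s, 1) - L (0, s)).re
  have hreal : L (s, 1) - L (0, s) = (r : ℂ) := Complex.ext (by simp [r]) (by simpa using him)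
  have hq : γ 1 - γ s - w = (Real.exp r : ℂ) * (γ s - γ 0 - w) := by
    have h1 := hL (s, 1)
    have h2 := hL (0, s)
    simp only at h1 h2
    rw [← h1, ← h2, Complex.ofReal_exp, ← Complex.exp_add, ← hreal]
    congr 1; ring
  have hs' := hfar s hs
  have : γ 1 - γ 0 - 2 * w = ((1 + Real.exp r : ℝ) : ℂ) * (γ s - γ 0 - w) := by
    rw [Complex.ofReal_add, Complex.ofReal_one]
    linear_combination hq
  rw [this, norm_mul, Complex.norm_real, Real.norm_of_nonneg (by positivity)] at hs'
  have := Real.exp_pos r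
  nlinarith [norm_nonneg (γ s - γ 0 - w)]

def toC (x : R2) : ℂ := ⟨x 0, x 1⟩

lemma toC_cont : Continuous toC := by
  have : toC = fun x : R2 => ((x 0 : ℝ) : ℂ) + (x 1 : ℝ) * Complex.I := by
    funext x; exact Complex.ext (by simp [toC]) (by simp [toC])
  rw [this]; fun_prop

lemma norm_toC (x : R2) : ‖toC x‖ = ‖x‖ := by
  rw [EuclideanSpace.norm_eq, Complex.norm_def, Complex.normSq_apply]
  simp [toC, Fin.sum_univ_two, sq]

lemma toC_sub (x y : R2) : toC (x - y) = toC x - toC y := Complex.ext (by simp [toC]) (by simp [toC])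
lemma toC_add (x y : R2) : toC (x + y) = toC x + toC y := Complex.ext (by simp [toC]) (by simp [toC])
lemma toC_inj {x y : R2} (h : toC x = toC y) : x = y := by
  have : ‖x - y‖ = 0 := by rw [← norm_toC, toC_sub, h, sub_self, norm_zero]
  exact sub_eq_zero.1 (norm_eq_zero.1 this)

lemma norm_le_two_of_coord {x : R2} {c : ℝ} (h : ∀ i, |x i| ≤ c) : ‖x‖ ≤ 2 * c := by
  have hc : 0 ≤ c := (abs_nonneg _).trans (h 0)
  rw [EuclideanSpace.norm_eq]
  apply Real.sqrt_le_iff.2 ⟨by positivity, ?_⟩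
  simp only [Fin.sum_univ_two, Real.norm_eq_abs]
  nlinarith [h 0, h 1, abs_nonneg (x 0), abs_nonneg (x 1)]

lemma coord_le_norm (x : R2) (i : Fin 2) : |x i| ≤ ‖x‖ := by
  simpa using PiLp.norm_apply_le x i

lemma fundDomain_lattice {a b w : R2} (ha : a ∈ fundDomain) (hb : b ∈ fundDomain)
    (hw : w ∈ intLattice) (h : a = b + w) : w = 0 := by
  ext i
  obtain ⟨n, hn⟩ := hw i
  have h1 := ha i
  have h2 := hb i
  have h3 : a i = b i + n := by rw [h, ← hn]; simp
  rw [mem_Ico] at h1 h2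
  have h4 : (n : ℝ) < 1 := by linarith
  have h5 : (-1 : ℝ) < n := by linarith
  have h6 : n < 1 := by exact_mod_cast h4
  have h7 : -1 < n := by exact_mod_cast h5
  have : n = 0 := by omega
  rw [hn, this]; simp

lemma exists_lattice_near (x : R2) : ∃ w ∈ intLattice, ‖x - w‖ ≤ 1 := by
  refine ⟨!₂[(round (x 0) : ℝ), (round (x 1) : ℝ)], ?_, ?_⟩
  · intro i
    fin_cases i
    · exact ⟨round (x 0), by simp⟩
    · exact ⟨round (x 1), by simp⟩
  · have := norm_le_two_of_coord (x := x - !₂[(round (x 0) : ℝ), (round (x 1) : ℝ)]) (c := 1/2) ?_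
    · linarith
    · intro i
      fin_cases i
      · simpa using abs_sub_round (x 0)
      · simpa using abs_sub_round (x 1)

lemma fundDomain_convex : Convex ℝ fundDomain := by
  intro a ha b hb s t hs ht hst i
  have h1 := convex_Ico (𝕜 := ℝ) (0 : ℝ) 1 (ha i) (hb i) hs ht hst
  simpa using h1

/-- Midpoint quasi-convexity of images of the fundamental domain. -/
lemma midpoint_quasi (Φ : R2 → R2) (hc : Continuous Φ) (hinj : Function.Injective Φ)
    (heq : ∀ x, ∀ w ∈ intLattice, Φ (x + w) = Φ x + w) {a b : R2}
    (ha : a ∈ fundDomain) (hb : b ∈ fundDomain) :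
    ∃ y ∈ fundDomain, ‖Φ y - (1/2 : ℝ) • (Φ a + Φ b)‖ ≤ 3 := by
  obtain ⟨w, hw, hwn⟩ := exists_lattice_near ((1/2 : ℝ) • (Φ b - Φ a))
  by_cases hw0 : w = 0
  · refine ⟨a, ha, ?_⟩
    subst hw0
    have : Φ a - (1/2 : ℝ) • (Φ a + Φ b) = - ((1/2 : ℝ) • (Φ b - Φ a) - 0) := by module
    rw [this, norm_neg]; linarith
  by_contra hcon
  push Not at hcon
  set y : ℝ → R2 := fun t => AffineMap.lineMap a b ((projIcc (0 : ℝ) 1 zero_le_one t : ℝ)) with hy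
  have hyc : Continuous y := by
    have : Continuous (AffineMap.lineMap a b : ℝ →ᵃ[ℝ] R2) := AffineMap.lineMap_continuous
    exact this.comp (continuous_subtype_val.comp continuous_projIcc)
  have hyD : ∀ t, y t ∈ fundDomain := fun t =>
    fundDomain_convex.lineMap_mem ha hb (projIcc (0 : ℝ) 1 zero_le_one t).2
  have hy0 : y 0 = a := by simp [hy]
  have hy1 : y 1 = b := by simp [hy]
  refine half_chord (fun t => toC (Φ (y t))) (toC_cont.comp (hc.comp hyc)) (toC w) ?_ ?_
  · intro s t h
    rw [← toC_sub] at h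
    have h1 := toC_inj h
    have h2 : Φ (y t) = Φ (y s + w) := by rw [heq _ _ hw, ← h1]; abel
    exact hw0 (fundDomain_lattice (hyD t) (hyD s) hw (hinj h2))
  · intro s _
    simp only [hy0, hy1]
    have e1 : toC (Φ b) - toC (Φ a) - 2 * toC w = toC (Φ b - Φ a - w - w) := by
      simp only [toC_sub]; ring
    rw [e1, ← toC_sub, ← toC_sub, norm_toC, norm_toC]
    have h1 : ‖Φ b - Φ a - w - w‖ ≤ 2 := by
      have : Φ b - Φ a - w - w = (2 : ℝ) • ((1/2 : ℝ) • (Φ b - Φ a) - w) := by module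
      rw [this, norm_smul]; norm_num; linarith
    have h2 := hcon (y s) (hyD s)
    have h3 : Φ (y s) - (1/2 : ℝ) • (Φ a + Φ b) =
        (Φ (y s) - Φ a - w) - ((1/2 : ℝ) • (Φ b - Φ a) - w) := by module
    rw [h3] at h2
    have := norm_sub_le (Φ (y s) - Φ a - w) ((1/2 : ℝ) • (Φ b - Φ a) - w)
    linarith

lemma hull_quasi_segment (f : R2 → ℝ) (hf : Continuous f) (c B : ℝ)
    (hmid : ∀ x y, f ((1/2 : ℝ) • (x + y)) ≤ (f x + f y) / 2 + c) {x y z : R2}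
    (hx : f x ≤ B) (hy : f y ≤ B) (hz : z ∈ segment ℝ x y) : f z ≤ B + 2 * c := by
  set g : ℝ → ℝ := fun t => f (AffineMap.lineMap x y t) with hg
  have hgc : Continuous g := hf.comp AffineMap.lineMap_continuous
  obtain ⟨t, ht, hmax⟩ := isCompact_Icc.exists_isMaxOn (nonempty_Icc.2 (zero_le_one (α := ℝ)))
    hgc.continuousOn
  have hM : g t ≤ B + 2 * c := by
    rcases le_total t (1/2) with h | h
    · have h2 : g (2 * t) ≤ g t := hmax ⟨by linarith [ht.1], by linarith⟩
      have h1 := hmid x (AffineMap.lineMap x y (2 * t))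
      have e : (1/2 : ℝ) • (x + AffineMap.lineMap x y (2 * t)) = AffineMap.lineMap x y t := by
        simp only [AffineMap.lineMap_apply_module]; module
      rw [e] at h1
      simp only [hg] at h2 ⊢
      linarith
    · have h2 : g (2 * t - 1) ≤ g t := hmax ⟨by linarith, by linarith [ht.2]⟩
      have h1 := hmid y (AffineMap.lineMap x y (2 * t - 1))
      have e : (1/2 : ℝ) • (y + AffineMap.lineMap x y (2 * t - 1)) = AffineMap.lineMap x y t := by
        simp only [AffineMap.lineMap_apply_module]; module
      rw [e] at h1
      simp only [hg] at h2 ⊢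
      linarith
  rw [segment_eq_image_lineMap] at hz
  obtain ⟨s, hs, rfl⟩ := hz
  exact (hmax hs).trans hM

lemma hull_quasi (A : Set R2) (c : ℝ) (hc : 0 ≤ c)
    (hA : ∀ a ∈ A, ∀ b ∈ A, ∃ y ∈ A, ‖y - (1/2 : ℝ) • (a + b)‖ ≤ c) :
    ∀ x ∈ convexHull ℝ A, infDist x A ≤ 6 * c := by
  intro x hx
  have hne : A.Nonempty := (convexHull_nonempty_iff (𝕜 := ℝ)).1 ⟨x, hx⟩
  have hmid : ∀ x y, infDist ((1/2 : ℝ) • (x + y)) A ≤ (infDist x A + infDist y A) / 2 + c := by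
    intro x y
    apply le_of_forall_pos_le_add
    intro ε hε
    obtain ⟨a, ha, hxa⟩ := (infDist_lt_iff hne).1 (lt_add_of_pos_right (infDist x A) hε)
    obtain ⟨b, hb, hyb⟩ := (infDist_lt_iff hne).1 (lt_add_of_pos_right (infDist y A) hε)
    obtain ⟨z, hz, hzn⟩ := hA a ha b hb
    refine (infDist_le_dist_of_mem hz).trans ?_
    rw [dist_eq_norm] at hxa hyb ⊢
    have e : (1/2 : ℝ) • (x + y) - z =
      (1/2 : ℝ) • (x - a) + (1/2 : ℝ) • (y - b) - (z - (1/2 : ℝ) • (a + b)) := by module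
    rw [e]
    have h1 := norm_sub_le ((1/2 : ℝ) • (x - a) + (1/2 : ℝ) • (y - b)) (z - (1/2 : ℝ) • (a + b))
    have h2 := norm_add_le ((1/2 : ℝ) • (x - a)) ((1/2 : ℝ) • (y - b))
    rw [norm_smul, norm_smul, Real.norm_of_nonneg (by norm_num : (0:ℝ) ≤ 1/2)] at h2
    linarith
  have key : ∀ t : Finset R2, (t : Set R2) ⊆ A → ∀ x ∈ convexHull ℝ (t : Set R2),
      infDist x A ≤ 2 * c * t.card := by
    intro t
    induction t using Finset.induction_on with
    | empty => intro _ x hx; simp at hx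
    | insert a t ha ih =>
      intro hsub x hx
      rw [Finset.coe_insert] at hsub hx
      have haA : a ∈ A := hsub (mem_insert _ _)
      have ha0 : infDist a A = 0 := infDist_zero_of_mem haA
      rcases t.eq_empty_or_nonempty with rfl | ht
      · simp at hx; subst hx; rw [ha0]; positivity
      · rw [convexHull_insert (by exact_mod_cast ht)] at hx
        rw [mem_convexJoin] at hx
        obtain ⟨a', ha', y, hy, hxy⟩ := hx
        rw [mem_singleton_iff] at ha'
        subst ha'
        have h1 := ih ((subset_insert _ _).trans hsub) y hy
        have h2 := hull_quasi_segment (fun x => infDist x A) (continuous_infDist_pt A) c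
          (2 * c * t.card) hmid (by simp only [ha0]; positivity) h1 hxy
        rw [Finset.card_insert_of_notMem ha]
        push_cast
        linarith
  rw [convexHull_eq_union] at hx
  simp only [mem_iUnion] at hx
  obtain ⟨t, ht, hind, hxt⟩ := hx
  have h1 := key t ht x hxt
  have h2 : t.card ≤ 3 := by
    have := hind.card_le_finrank_succ
    have h3 := Submodule.finrank_le (vectorSpan ℝ (range (Subtype.val : t → R2)))
    rw [finrank_euclideanSpace_fin] at h3
    simp only [Fintype.card_coe] at this
    omega
  have h3 : (t.card : ℝ) ≤ 3 := by exact_mod_cast h2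
  nlinarith

lemma disp_bdd (F : R2 → R2) (hc : Continuous F)
    (heq : ∀ x, ∀ w ∈ intLattice, F (x + w) = F x + w) : ∃ B, 0 ≤ B ∧ ∀ x, ‖F x - x‖ ≤ B := by
  obtain ⟨B, hB⟩ := (isCompact_closedBall (0 : R2) 1).exists_bound_of_continuousOn
    (f := fun x => F x - x) (by fun_prop)
  refine ⟨B, (norm_nonneg _).trans (hB 0 (by simp)), fun x => ?_⟩
  obtain ⟨w, hw, hn⟩ := exists_lattice_near x
  have := hB (x - w) (by simpa using hn)
  have h2 := heq (x - w) w hw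
  rw [sub_add_cancel] at h2
  have e : F x - x = F (x - w) - (x - w) := by rw [h2]; abel
  rw [e]; exact this

lemma iter_eqv (F : R2 → R2) (heq : ∀ x, ∀ w ∈ intLattice, F (x + w) = F x + w) (n : ℕ) :
    ∀ x, ∀ w ∈ intLattice, F^[n] (x + w) = F^[n] x + w := by
  induction n with
  | zero => intro x w _; rfl
  | succ n ih =>
    intro x w hw
    rw [Function.iterate_succ_apply', Function.iterate_succ_apply', ih x w hw, heq _ _ hw]

lemma iter_disp (F : R2 → R2) (B : ℝ) (hB : ∀ x, ‖F x - x‖ ≤ B) (n : ℕ) (x : R2) :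
    ‖F^[n] x - x‖ ≤ n * B := by
  induction n with
  | zero => simp
  | succ n ih =>
    rw [Function.iterate_succ_apply']
    have := norm_add_le (F (F^[n] x) - F^[n] x) (F^[n] x - x)
    rw [sub_add_sub_cancel] at this
    push_cast
    linarith [hB (F^[n] x)]

lemma exists_fund (x : R2) : ∃ w ∈ intLattice, x + w ∈ fundDomain := by
  refine ⟨!₂[-(⌊x 0⌋ : ℝ), -(⌊x 1⌋ : ℝ)], ?_, ?_⟩
  · intro i
    fin_cases i
    · exact ⟨-⌊x 0⌋, by simp⟩
    · exact ⟨-⌊x 1⌋, by simp⟩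
  · intro i
    fin_cases i
    · simp [← sub_eq_add_neg, Int.fract_lt_one]
    · simp [← sub_eq_add_neg, Int.fract_lt_one]

def dispSet (F : R2 → R2) (n : ℕ) : Set R2 := range (fun z => F^[n] z - z)

lemma dispSet_mid (F : R2 → R2) (hc : Continuous F) (hinj : Function.Injective F)
    (heq : ∀ x, ∀ w ∈ intLattice, F (x + w) = F x + w) (n : ℕ) :
    ∀ a ∈ dispSet F n, ∀ b ∈ dispSet F n, ∃ y ∈ dispSet F n, ‖y - (1/2 : ℝ) • (a + b)‖ ≤ 5 := by
  have red : ∀ a ∈ dispSet F n, ∃ z ∈ fundDomain, a = F^[n] z - z := by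
    rintro _ ⟨z, rfl⟩
    obtain ⟨w, hw, hf⟩ := exists_fund z
    refine ⟨z + w, hf, ?_⟩
    rw [iter_eqv F heq n z w hw]; simp
  intro a ha b hb
  obtain ⟨z, hz, rfl⟩ := red a ha
  obtain ⟨z', hz', rfl⟩ := red b hb
  obtain ⟨y, hy, hn⟩ := midpoint_quasi F^[n] (hc.iterate n) (hinj.iterate n)
    (iter_eqv F heq n) hz hz'
  refine ⟨_, ⟨y, rfl⟩, ?_⟩
  have e : F^[n] y - y - (1/2 : ℝ) • (F^[n] z - z + (F^[n] z' - z')) =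
    (F^[n] y - (1/2 : ℝ) • (F^[n] z + F^[n] z')) - (y - (1/2 : ℝ) • (z + z')) := by module
  simp only [e]
  have h1 : ‖y - (1/2 : ℝ) • (z + z')‖ ≤ 2 * 1 := by
    apply norm_le_two_of_coord
    intro i
    have a1 := hy i
    have a2 := hz i
    have a3 := hz' i
    rw [mem_Ico] at a1 a2 a3
    simp only [PiLp.sub_apply, PiLp.smul_apply, PiLp.add_apply, smul_eq_mul]
    rw [abs_le]
    constructor <;> linarith
  have := norm_sub_le (F^[n] y - (1/2 : ℝ) • (F^[n] z + F^[n] z')) (y - (1/2 : ℝ) • (z + z'))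
  linarith

lemma iter_mul_mem (F : R2 → R2) (n : ℕ) (q : ℕ) (z : R2) :
    F^[n * (q + 1)] z - z ∈ ((q + 1 : ℕ) : ℝ) • convexHull ℝ (dispSet F n) := by
  induction q with
  | zero =>
    have h : F^[n] z - z ∈ dispSet F n := ⟨z, rfl⟩
    simpa using subset_convexHull ℝ _ h
  | succ q ih =>
    have e : F^[n * (q + 1 + 1)] z - z =
        (F^[n * (q + 1)] z - z) + (F^[n] (F^[n * (q + 1)] z) - F^[n * (q + 1)] z) := by
      rw [← Function.iterate_add_apply, show n * (q + 1 + 1) = n + n * (q + 1) by ring]; abel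
    rw [e]
    have h := (convex_convexHull ℝ (dispSet F n)).add_smul (p := ((q + 1 : ℕ) : ℝ)) (q := 1)
      (by positivity) zero_le_one
    rw [show ((q + 1 + 1 : ℕ) : ℝ) = ((q + 1 : ℕ) : ℝ) + 1 by push_cast; ring, h, one_smul]
    exact add_mem_add ih (subset_convexHull ℝ _ ⟨_, rfl⟩)

lemma rotSet_sub_closure (F : R2 ≃ₜ R2)
    (heq : ∀ x, ∀ w ∈ intLattice, F (x + w) = F x + w) (n : ℕ) (hn : 0 < n) {v : R2}
    (hv : v ∈ rotSet F) : (n : ℝ) • v ∈ closure (convexHull ℝ (dispSet F n)) := by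
  obtain ⟨B, hB0, hB⟩ := disp_bdd F F.continuous heq
  obtain ⟨z, k, hk, hlim⟩ := hv
  set c : ℕ → R2 := fun j => ((k j / n : ℕ) : ℝ)⁻¹ • ((⇑F)^[n * (k j / n)] (z j) - z j) with hcdef
  have hmem : ∀ᶠ j in atTop, c j ∈ convexHull ℝ (dispSet F n) := by
    filter_upwards [hk.eventually_ge_atTop n] with j hj
    have hq : 0 < k j / n := Nat.div_pos hj hn
    obtain ⟨q, hq'⟩ := Nat.exists_eq_succ_of_ne_zero hq.ne'
    have := iter_mul_mem F n q (z j)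
    rw [mem_smul_set_iff_inv_smul_mem₀ (by positivity)] at this
    simp only [hcdef, hq']
    exact this
  have hkr : Tendsto (fun j => (k j : ℝ)) atTop atTop := tendsto_natCast_atTop_atTop.comp hk
  have hdiff : Tendsto (fun j => (n : ℝ) • ((k j : ℝ)⁻¹ • ((⇑F)^[k j] (z j) - z j)) - c j)
      atTop (𝓝 0) := by
    have hb : Tendsto (fun j => (2 * n * n * B) * (k j : ℝ)⁻¹) atTop (𝓝 0) := by
      have := (tendsto_inv_atTop_zero.comp hkr).const_mul (2 * n * n * B)
      simpa using this
    refine squeeze_zero_norm' ?_ hb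
    filter_upwards [hk.eventually_ge_atTop n] with j hj
    have hq : 0 < k j / n := Nat.div_pos hj hn
    have hkj : 0 < k j := lt_of_lt_of_le hn hj
    set q := k j / n with hqdef
    have hdm : n * q + k j % n = k j := Nat.div_add_mod _ _
    have hr : k j % n < n := Nat.mod_lt _ hn
    set r := k j % n
    have e1 : (⇑F)^[k j] (z j) = (⇑F)^[r] ((⇑F)^[n * q] (z j)) := by
      rw [← Function.iterate_add_apply]; congr 2; omega
    have hr1 := iter_disp F B hB r ((⇑F)^[n * q] (z j))
    have hr2 := iter_disp F B hB (n * q) (z j)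
    have hqR : (0 : ℝ) < q := by exact_mod_cast hq
    have hkR : (0 : ℝ) < k j := by exact_mod_cast hkj
    have hdmR : (n : ℝ) * q + r = k j := by exact_mod_cast hdm
    have hrR : (r : ℝ) ≤ n := by exact_mod_cast hr.le
    have e2 : (n : ℝ) • ((k j : ℝ)⁻¹ • ((⇑F)^[k j] (z j) - z j)) - c j =
        ((n : ℝ) * (k j : ℝ)⁻¹) • ((⇑F)^[r] ((⇑F)^[n * q] (z j)) - (⇑F)^[n * q] (z j)) -
        ((r : ℝ) * (k j : ℝ)⁻¹ * (q : ℝ)⁻¹) • ((⇑F)^[n * q] (z j) - z j) := by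
      simp only [hcdef, ← hqdef, e1]
      have : (r : ℝ) * (k j : ℝ)⁻¹ * (q : ℝ)⁻¹ = (q : ℝ)⁻¹ - n * (k j : ℝ)⁻¹ := by
        field_simp; linarith
      rw [this]; module
    rw [e2]
    refine (norm_sub_le _ _).trans ?_
    rw [norm_smul, norm_smul, Real.norm_of_nonneg (by positivity), Real.norm_of_nonneg (by positivity)]
    have a1 : (n : ℝ) * (k j : ℝ)⁻¹ * ‖(⇑F)^[r] ((⇑F)^[n * q] (z j)) - (⇑F)^[n * q] (z j)‖ ≤
        n * (k j : ℝ)⁻¹ * (n * B) := by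
      gcongr
      exact hr1.trans (by gcongr)
    have a2 : (r : ℝ) * (k j : ℝ)⁻¹ * (q : ℝ)⁻¹ * ‖(⇑F)^[n * q] (z j) - z j‖ ≤
        n * (k j : ℝ)⁻¹ * (q : ℝ)⁻¹ * ((n * q : ℕ) * B) := by
      gcongr
    have a3 : n * (k j : ℝ)⁻¹ * (q : ℝ)⁻¹ * ((n * q : ℕ) * B) = n * (k j : ℝ)⁻¹ * (n * B) := by
      push_cast; field_simp
    rw [a3] at a2
    calc _ ≤ _ := add_le_add a1 a2
      _ = _ := by ring
  have hlim2 : Tendsto c atTop (𝓝 ((n : ℝ) • v)) := by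
    have := (hlim.const_smul (n : ℝ)).sub hdiff
    simpa using this
  exact mem_closure_of_tendsto hlim2 hmem

lemma rotSet_convex (F : R2 ≃ₜ R2)
    (heq : ∀ x, ∀ w ∈ intLattice, F (x + w) = F x + w) : convexHull ℝ (rotSet F) ⊆ rotSet F := by
  intro u hu
  have h1 : ∀ n : ℕ, 0 < n → ∃ z, ‖(n : ℝ) • u - ((⇑F)^[n] z - z)‖ < 31 := by
    intro n hn
    have h2 : (n : ℝ) • u ∈ closure (convexHull ℝ (dispSet F n)) := by
      have hconv : Convex ℝ {x : R2 | (n : ℝ) • x ∈ closure (convexHull ℝ (dispSet F n))} :=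
        (convex_convexHull ℝ (dispSet F n)).closure.smul_preimage (n : ℝ)
      exact convexHull_min (fun v hv => rotSet_sub_closure F heq n hn hv) hconv hu
    have h3 : closure (convexHull ℝ (dispSet F n)) ⊆ {x | infDist x (dispSet F n) ≤ 6 * 5} :=
      closure_minimal (hull_quasi _ 5 (by norm_num) (dispSet_mid F F.continuous F.injective heq n))
        (isClosed_le (continuous_infDist_pt _) continuous_const)
    have h4 : infDist ((n : ℝ) • u) (dispSet F n) < 31 := lt_of_le_of_lt (h3 h2) (by norm_num)
    obtain ⟨_, ⟨z, rfl⟩, hz⟩ := (infDist_lt_iff (range_nonempty _)).1 h4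
    exact ⟨z, by rwa [← dist_eq_norm]⟩
  choose z hz using fun n : ℕ => h1 (n + 1) n.succ_pos
  refine ⟨z, fun n => n + 1, tendsto_add_atTop_nat 1, ?_⟩
  rw [tendsto_iff_norm_sub_tendsto_zero]
  have hb : Tendsto (fun n : ℕ => 31 * (((n + 1 : ℕ) : ℝ))⁻¹) atTop (𝓝 0) := by
    have := ((tendsto_inv_atTop_zero (𝕜 := ℝ)).comp
      (tendsto_natCast_atTop_atTop.comp (tendsto_add_atTop_nat 1))).const_mul 31
    simpa using this
  refine squeeze_zero (fun _ => norm_nonneg _) (fun n => ?_) hb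
  have hp : (0 : ℝ) < ((n + 1 : ℕ) : ℝ) := by positivity
  have e : ((n + 1 : ℕ) : ℝ)⁻¹ • ((⇑F)^[n + 1] (z n) - z n) - u =
      - (((n + 1 : ℕ) : ℝ)⁻¹ • (((n + 1 : ℕ) : ℝ) • u - ((⇑F)^[n + 1] (z n) - z n))) := by
    rw [smul_sub _ (((n + 1 : ℕ) : ℝ) • u), smul_smul, inv_mul_cancel₀ hp.ne', one_smul]; abel
  rw [e, norm_neg, norm_smul, Real.norm_of_nonneg (by positivity), mul_comm]
  gcongr
  exact (hz n).le

def ctr (k : Fin 2 → ℤ) : Fin 2 → ℝ := fun i => (k i : ℝ) + 1 / 2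
def cel (x : Fin 2 → ℝ) : Fin 2 → ℤ := fun i => ⌊x i⌋

lemma cel_ctr (k : Fin 2 → ℤ) : cel (ctr k) = k := by
  funext i
  simp only [cel, ctr]
  rw [Int.floor_eq_iff]
  constructor <;> linarith

lemma norm_sub_ctr (x : Fin 2 → ℝ) : ‖x - ctr (cel x)‖ ≤ 1 / 2 := by
  rw [pi_norm_le_iff_of_nonneg (by norm_num)]
  intro i
  simp only [Pi.sub_apply, ctr, cel, Real.norm_eq_abs]
  rw [abs_le]
  have h1 := Int.floor_le (x i)
  have h2 := Int.lt_floor_add_one (x i)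
  constructor <;> linarith

lemma ctr_sep {k l : Fin 2 → ℤ} (h : k ≠ l) : 1 ≤ ‖ctr k - ctr l‖ := by
  obtain ⟨i, hi⟩ := Function.ne_iff.1 h
  refine le_trans ?_ (norm_le_pi_norm _ i)
  simp only [Pi.sub_apply, ctr, Real.norm_eq_abs]
  have : (1 : ℤ) ≤ |k i - l i| := Int.one_le_abs (sub_ne_zero.2 hi)
  have h2 : (1 : ℝ) ≤ |(k i : ℝ) - l i| := by exact_mod_cast this
  have e : (k i : ℝ) + 1 / 2 - ((l i : ℝ) + 1 / 2) = k i - l i := by ring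
  rw [e]; exact h2

def cellMap (c : (Fin 2 → ℤ) → (Fin 2 → ℝ)) (x : Fin 2 → ℝ) : Fin 2 → ℝ :=
  x + (1 - 2 * ‖x - ctr (cel x)‖) • c (cel x)

lemma cellMap_lip (c : (Fin 2 → ℤ) → (Fin 2 → ℝ)) (ρ : ℝ) (hc : ∀ k, ‖c k‖ ≤ ρ)
    (x y : Fin 2 → ℝ) : ‖cellMap c x - cellMap c y - (x - y)‖ ≤ 2 * ρ * ‖x - y‖ := by
  have hρ : 0 ≤ ρ := (norm_nonneg _).trans (hc 0)
  have e : cellMap c x - cellMap c y - (x - y) = (1 - 2 * ‖x - ctr (cel x)‖) • c (cel x) -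
      (1 - 2 * ‖y - ctr (cel y)‖) • c (cel y) := by
    simp only [cellMap]; abel
  rw [e]
  by_cases h : cel x = cel y
  · rw [← h, ← sub_smul, norm_smul]
    have h1 : ‖(1 - 2 * ‖x - ctr (cel x)‖) - (1 - 2 * ‖y - ctr (cel x)‖)‖ ≤ 2 * ‖x - y‖ := by
      have := abs_norm_sub_norm_le (x - ctr (cel x)) (y - ctr (cel x))
      rw [sub_sub_sub_cancel_right] at this
      rw [abs_le] at this
      rw [Real.norm_eq_abs, abs_le]
      constructor <;> linarith [this.1, this.2]
    calc _ ≤ (2 * ‖x - y‖) * ρ := by gcongr; exact hc _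
      _ = _ := by ring
  · have hx := norm_sub_ctr x
    have hy := norm_sub_ctr y
    have h1 := ctr_sep h
    have h2 : ‖ctr (cel x) - ctr (cel y)‖ ≤ ‖x - ctr (cel x)‖ + ‖x - y‖ + ‖y - ctr (cel y)‖ := by
      have e2 : ctr (cel x) - ctr (cel y) = -(x - ctr (cel x)) + (x - y) + (y - ctr (cel y)) := by
        abel
      rw [e2]
      refine (norm_add_le _ _).trans ?_
      gcongr
      refine (norm_add_le _ _).trans ?_
      rw [norm_neg]
    refine (norm_sub_le _ _).trans ?_
    rw [norm_smul, norm_smul, Real.norm_of_nonneg (by linarith), Real.norm_of_nonneg (by linarith)]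
    have a1 : (1 - 2 * ‖x - ctr (cel x)‖) * ‖c (cel x)‖ ≤ (1 - 2 * ‖x - ctr (cel x)‖) * ρ :=
      mul_le_mul_of_nonneg_left (hc _) (by linarith)
    have a2 : (1 - 2 * ‖y - ctr (cel y)‖) * ‖c (cel y)‖ ≤ (1 - 2 * ‖y - ctr (cel y)‖) * ρ :=
      mul_le_mul_of_nonneg_left (hc _) (by linarith)
    nlinarith

lemma cellMap_homeo (c : (Fin 2 → ℤ) → (Fin 2 → ℝ)) (ρ : ℝ) (hρ : ρ < 1 / 2)
    (hc : ∀ k, ‖c k‖ ≤ ρ) : ∃ T : (Fin 2 → ℝ) ≃ₜ (Fin 2 → ℝ), ∀ x, T x = cellMap c x := by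
  have hρ0 : 0 ≤ ρ := (norm_nonneg _).trans (hc 0)
  obtain ⟨r, hr⟩ : ∃ r : NNReal, (r : ℝ) = 2 * ρ := ⟨⟨2 * ρ, by positivity⟩, rfl⟩
  have happ : ApproximatesLinearOn (cellMap c)
      ((ContinuousLinearEquiv.refl ℝ (Fin 2 → ℝ) : (Fin 2 → ℝ) ≃L[ℝ] (Fin 2 → ℝ)) :
        (Fin 2 → ℝ) →L[ℝ] (Fin 2 → ℝ)) univ r := by
    intro x _ y _
    rw [hr]; exact cellMap_lip c ρ hc x y
  refine ⟨happ.toHomeomorph _ (Or.inr ?_), fun x => rfl⟩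
  have : ‖((ContinuousLinearEquiv.refl ℝ (Fin 2 → ℝ)).symm : (Fin 2 → ℝ) →L[ℝ] (Fin 2 → ℝ))‖₊ = 1 := by
    have : ((ContinuousLinearEquiv.refl ℝ (Fin 2 → ℝ)).symm : (Fin 2 → ℝ) →L[ℝ] (Fin 2 → ℝ)) =
      ContinuousLinearMap.id ℝ _ := rfl
    rw [this]
    exact ContinuousLinearMap.nnnorm_id
  rw [this, inv_one, ← NNReal.coe_lt_coe]
  rw [hr, NNReal.coe_one]; linarith

lemma cellMap_ctr (c : (Fin 2 → ℤ) → (Fin 2 → ℝ)) (k) : cellMap c (ctr k) = ctr k + c k := by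
  simp [cellMap, cel_ctr]

lemma cellMap_near (c : (Fin 2 → ℤ) → (Fin 2 → ℝ)) (ρ : ℝ) (hρ : ρ < 1 / 2)
    (hc : ∀ k, ‖c k‖ ≤ ρ) (x) : ‖cellMap c x - x‖ ≤ 1 / 2 := by
  have hx := norm_sub_ctr x
  have := norm_nonneg (x - ctr (cel x))
  simp only [cellMap, add_sub_cancel_left]
  rw [norm_smul, Real.norm_of_nonneg (by linarith)]
  have := hc (cel x)
  have := norm_nonneg (c (cel x))
  nlinarith

def mulI (N : ℕ) (l : Fin 2 → ℤ) : Fin 2 → ℤ := fun i => N * l i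
def castR (l : Fin 2 → ℤ) : Fin 2 → ℝ := fun i => (l i : ℝ)

lemma cellMap_per (N : ℕ) (c : (Fin 2 → ℤ) → (Fin 2 → ℝ)) (hper : ∀ k l, c (k + mulI N l) = c k)
    (x) (l) : cellMap c (x + castR (mulI N l)) = cellMap c x + castR (mulI N l) := by
  have h1 : cel (x + castR (mulI N l)) = cel x + mulI N l := by
    funext i; simp only [cel, castR, Pi.add_apply, Int.floor_add_intCast]
  have h2 : ∀ k, ctr (k + mulI N l) = ctr k + castR (mulI N l) := by
    intro k; funext i; simp only [ctr, castR, Pi.add_apply]; push_cast; ring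
  simp only [cellMap, h1, h2, hper, add_sub_add_right_eq_sub]
  abel

lemma cell_move (N : ℕ) (a b : (Fin 2 → ℤ) → (Fin 2 → ℝ)) (ρ : ℝ) (hρ : ρ < 1 / 2)
    (ha : ∀ k, ‖a k‖ ≤ ρ) (hb : ∀ k, ‖b k‖ ≤ ρ)
    (hpa : ∀ k l, a (k + mulI N l) = a k) (hpb : ∀ k l, b (k + mulI N l) = b k) :
    ∃ H : (Fin 2 → ℝ) ≃ₜ (Fin 2 → ℝ), (∀ k, H (ctr k + a k) = ctr k + b k) ∧
      (∀ x, ‖H x - x‖ ≤ 1) ∧ ∀ x l, H (x + castR (mulI N l)) = H x + castR (mulI N l) := by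
  obtain ⟨A, hA⟩ := cellMap_homeo a ρ hρ ha
  obtain ⟨B, hB⟩ := cellMap_homeo b ρ hρ hb
  refine ⟨A.symm.trans B, ?_, ?_, ?_⟩
  · intro k
    have : A.symm (ctr k + a k) = ctr k := by rw [← cellMap_ctr, ← hA, A.symm_apply_apply]
    simp [this, hB, cellMap_ctr]
  · intro x
    have h1 := cellMap_near a ρ hρ ha (A.symm x)
    have h2 := cellMap_near b ρ hρ hb (A.symm x)
    rw [← hA, A.apply_symm_apply] at h1
    rw [← hB] at h2
    have : (A.symm.trans B) x - x = (B (A.symm x) - A.symm x) - (x - A.symm x) := by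
      simp
    rw [this]
    refine (norm_sub_le _ _).trans ?_
    linarith
  · intro x l
    have : A.symm (x + castR (mulI N l)) = A.symm x + castR (mulI N l) := by
      apply A.injective
      rw [A.apply_symm_apply, hA, cellMap_per N a hpa, ← hA, A.apply_symm_apply]
    simp only [Homeomorph.trans_apply, this]
    rw [hB, cellMap_per N b hpb, ← hB]

def lat (W : Fin 2 → ℤ) : R2 := WithLp.toLp 2 (fun i => (W i : ℝ))

lemma mem_lattice_iff {w : R2} : w ∈ intLattice ↔ ∃ W, w = lat W := by
  constructor
  · intro h
    choose n hn using h
    exact ⟨n, by ext i; simp [lat, hn]⟩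
  · rintro ⟨W, rfl⟩ i
    exact ⟨W i, rfl⟩

def sc (N : ℕ) (y : R2) : Fin 2 → ℝ := fun i => N * y i

lemma exists_plane_move (N : ℕ) (hN : 0 < N) (H : (Fin 2 → ℝ) ≃ₜ (Fin 2 → ℝ))
    (h1 : ∀ x, ‖H x - x‖ ≤ 1) (h2 : ∀ x l, H (x + castR (mulI N l)) = H x + castR (mulI N l)) :
    ∃ J : R2 ≃ₜ R2, (∀ x, sc N (J x) = H (sc N x)) ∧ (∀ x, ‖J x - x‖ ≤ 2 / N) ∧
      ∀ x, ∀ w ∈ intLattice, J (x + w) = J x + w := by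
  have hNR : (0 : ℝ) < N := by exact_mod_cast hN
  set e : R2 ≃ₜ (Fin 2 → ℝ) := (EuclideanSpace.equiv (Fin 2) ℝ).toHomeomorph.trans
    (Homeomorph.smulOfNeZero (N : ℝ) hNR.ne') with he
  have hes : ∀ x, e x = sc N x := fun x => by funext i; rfl
  refine ⟨(e.trans H).trans e.symm, ?_, ?_, ?_⟩
  · intro x
    rw [← hes, ← hes]; simp
  · intro x
    have hk : sc N (((e.trans H).trans e.symm) x) = H (sc N x) := by
      rw [← hes, ← hes]; simp
    have := norm_le_two_of_coord (x := ((e.trans H).trans e.symm) x - x) (c := 1 / N) ?_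
    · calc _ ≤ _ := this
        _ = _ := by ring
    · intro i
      have h3 := (norm_le_pi_norm (H (sc N x) - sc N x) i).trans (h1 (sc N x))
      rw [← hk] at h3
      simp only [Pi.sub_apply, sc, ← mul_sub, Real.norm_eq_abs, abs_mul, abs_of_pos hNR] at h3
      rw [le_div_iff₀ hNR, mul_comm]
      exact h3
  · intro x w hw
    obtain ⟨W, rfl⟩ := mem_lattice_iff.1 hw
    have h3 : ∀ x, e (x + lat W) = e x + castR (mulI N W) := by
      intro x; rw [hes, hes]; funext i; simp [sc, castR, mulI, lat]; ring
    apply e.injective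
    rw [h3]
    simp only [Homeomorph.trans_apply, Homeomorph.apply_symm_apply]
    rw [h3, h2]

lemma exists_torus (G : R2 ≃ₜ R2) (heq : ∀ x, ∀ w ∈ intLattice, G (x + w) = G x + w) :
    ∃ g : T2 ≃ₜ T2, IsLift g G := by
  have heq' : ∀ x, ∀ w ∈ intLattice, G.symm (x + w) = G.symm x + w := by
    intro x w hw
    apply G.injective
    rw [heq _ _ hw]; simp
  have rel : ∀ K : R2 ≃ₜ R2, (∀ x, ∀ w ∈ intLattice, K (x + w) = K x + w) →
      ∀ a b : R2, QuotientAddGroup.leftRel intLattice a b →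
        QuotientAddGroup.leftRel intLattice (K a) (K b) := by
    intro K hK a b hab
    rw [QuotientAddGroup.leftRel_apply] at hab ⊢
    have : K b = K a + (-a + b) := by rw [← hK _ _ hab]; congr 1; abel
    rw [this]; simpa using hab
  let g : T2 ≃ₜ T2 :=
    { toFun := Quotient.map' G (rel G heq)
      invFun := Quotient.map' G.symm (rel G.symm heq')
      left_inv := by
        intro x
        induction x using Quotient.inductionOn' with
        | h x => simp [Quotient.map'_mk'']
      right_inv := by
        intro x
        induction x using Quotient.inductionOn' with
        | h x => simp [Quotient.map'_mk'']
      continuous_toFun := G.continuous.quotient_map' _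
      continuous_invFun := G.symm.continuous.quotient_map' _ }
  exact ⟨g, fun x => rfl, heq⟩

lemma sc_inj {N : ℕ} (hN : 0 < N) {x y : R2} (h : sc N x = sc N y) : x = y := by
  have hNR : (N : ℝ) ≠ 0 := by exact_mod_cast hN.ne'
  ext i
  exact mul_left_cancel₀ hNR (congrFun h i)

lemma sc_lat (N : ℕ) (x : R2) (W : Fin 2 → ℤ) : sc N (x + lat W) = sc N x + castR (mulI N W) := by
  funext i; simp [sc, castR, mulI, lat]; ring

lemma ctr_mulI (N : ℕ) (k l : Fin 2 → ℤ) : ctr (k + mulI N l) = ctr k + castR (mulI N l) := by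
  funext i; simp only [ctr, castR, Pi.add_apply]; push_cast; ring

lemma mulI_add (N : ℕ) (a b : Fin 2 → ℤ) : mulI N (a + b) = mulI N a + mulI N b := by
  funext i; simp only [mulI, Pi.add_apply]; ring

lemma mulI_neg (N : ℕ) (a : Fin 2 → ℤ) : mulI N (-a) = -mulI N a := by
  funext i; simp only [mulI, Pi.neg_apply]; ring

lemma mulI_zero (N : ℕ) : mulI N 0 = 0 := by
  funext i; simp [mulI]

def Edge (F : R2 ≃ₜ R2) (N : ℕ) (a b : Fin 2 → ℤ) : Prop :=
  ∃ y : R2, ‖sc N y - ctr a‖ < 1 / 2 ∧ ‖sc N (F y) - ctr b‖ < 1 / 2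

lemma Edge.shift {F : R2 ≃ₜ R2} (heq : ∀ x, ∀ w ∈ intLattice, F (x + w) = F x + w) {N : ℕ}
    {a b : Fin 2 → ℤ} (h : Edge F N a b) (l : Fin 2 → ℤ) :
    Edge F N (a + mulI N l) (b + mulI N l) := by
  obtain ⟨y, h1, h2⟩ := h
  refine ⟨y + lat l, ?_, ?_⟩
  · rw [sc_lat, ctr_mulI, add_sub_add_right_eq_sub]; exact h1
  · rw [heq _ _ (mem_lattice_iff.2 ⟨l, rfl⟩), sc_lat, ctr_mulI, add_sub_add_right_eq_sub]; exact h2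

lemma finite_bound (f : ℕ → ℝ) (m : ℕ) (h : ∀ i < m, f i < 1 / 2) :
    ∃ ρ : ℝ, 0 ≤ ρ ∧ ρ < 1 / 2 ∧ ∀ i < m, f i ≤ ρ := by
  induction m with
  | zero => exact ⟨0, le_rfl, by norm_num, by simp⟩
  | succ m ih =>
    obtain ⟨ρ, h0, h1, h2⟩ := ih (fun i hi => h i (by omega))
    refine ⟨max ρ (f m), le_max_of_le_left h0, max_lt h1 (h m (by omega)), ?_⟩
    intro i hi
    rcases Nat.lt_succ_iff_lt_or_eq.1 hi with h3 | rfl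
    · exact le_max_of_le_left (h2 i h3)
    · exact le_max_right _ _

lemma periodic_ext (N m : ℕ) (d : ℕ → Fin 2 → ℤ)
    (hd : ∀ i < m, ∀ j < m, ∀ l, d i = d j + mulI N l → i = j)
    (u : ℕ → Fin 2 → ℝ) (ρ : ℝ) (h0 : 0 ≤ ρ) (hu : ∀ i < m, ‖u i‖ ≤ ρ) :
    ∃ a : (Fin 2 → ℤ) → (Fin 2 → ℝ), (∀ k, ‖a k‖ ≤ ρ) ∧ (∀ k l, a (k + mulI N l) = a k) ∧
      ∀ i < m, a (d i) = u i := by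
  classical
  let P : (Fin 2 → ℤ) → ℕ → Prop := fun k i => i < m ∧ ∃ l, k = d i + mulI N l
  have hP : ∀ k l, P (k + mulI N l) = P k := by
    intro k l
    funext i
    refine propext ⟨?_, ?_⟩
    · rintro ⟨h, l', hl⟩
      refine ⟨h, l' - l, ?_⟩
      rw [sub_eq_add_neg, mulI_add, mulI_neg, ← add_assoc, ← hl]; abel
    · rintro ⟨h, l', hl⟩
      refine ⟨h, l' + l, ?_⟩
      rw [mulI_add, hl]; abel
  refine ⟨fun k => if ∃ i, P k i then u (Classical.epsilon (P k)) else 0, ?_, ?_, ?_⟩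
  · intro k
    dsimp only
    split_ifs with h
    · exact hu _ (Classical.epsilon_spec h).1
    · simpa using h0
  · intro k l
    simp only [hP]
  · intro i hi
    have h1 : P (d i) i := ⟨hi, 0, by rw [mulI_zero, add_zero]⟩
    have h2 : ∃ i', P (d i) i' := ⟨i, h1⟩
    dsimp only
    rw [if_pos h2]
    obtain ⟨h3, l, hl⟩ := Classical.epsilon_spec h2
    rw [← hd _ hi _ h3 l hl]

lemma lat_nsmul (k : ℕ) (W : Fin 2 → ℤ) : (k : ℝ) • lat W = lat (k • W) := by
  ext i; simp [lat]

lemma periodic_rot (G : R2 ≃ₜ R2) (heq : ∀ x, ∀ w ∈ intLattice, G (x + w) = G x + w)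
    (m : ℕ) (hm : 0 < m) (W : Fin 2 → ℤ) (y : R2) (h : (⇑G)^[m] y = y + lat W) :
    (m : ℝ)⁻¹ • lat W ∈ rotSet G := by
  have hk : ∀ k : ℕ, (⇑G)^[k * m] y = y + (k : ℝ) • lat W := by
    intro k
    induction k with
    | zero => simp
    | succ k ih =>
      rw [Nat.succ_mul, add_comm, Function.iterate_add_apply, ih,
        iter_eqv (⇑G) heq m _ _ (by rw [lat_nsmul]; exact mem_lattice_iff.2 ⟨_, rfl⟩), h]
      push_cast
      rw [add_smul, one_smul]; abel
  refine ⟨fun _ => y, fun k => (k + 1) * m, ?_, ?_⟩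
  · refine tendsto_atTop_mono (f := fun k => k) (fun k => ?_) tendsto_id
    nlinarith
  · refine tendsto_const_nhds.congr (fun k => ?_)
    rw [hk, add_sub_cancel_left, smul_smul]
    congr 1
    have : (m : ℝ) ≠ 0 := by exact_mod_cast hm.ne'
    push_cast
    have : (k : ℝ) + 1 ≠ 0 := by positivity
    field_simp

lemma loop_mem (F : R2 ≃ₜ R2) (heq : ∀ x, ∀ w ∈ intLattice, F (x + w) = F x + w)
    (δ : ℝ) (hst : UpperStable Homeo0 F δ) (N : ℕ) (hN : 0 < N) (hNδ : 2 / (N : ℝ) < δ)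
    (m : ℕ) (hm : 0 < m) (c : ℕ → Fin 2 → ℤ) (hc : ∀ i < m, Edge F N (c i) (c (i + 1)))
    (W : Fin 2 → ℤ) (hW : c m = c 0 + mulI N W)
    (hd : ∀ i < m, ∀ j < m, ∀ l, c (i + 1) = c (j + 1) + mulI N l → i = j) :
    (m : ℝ)⁻¹ • lat W ∈ rotSet F := by
  have : ∀ i, ∃ y : R2, i < m → ‖sc N y - ctr (c i)‖ < 1 / 2 ∧
      ‖sc N (F y) - ctr (c (i + 1))‖ < 1 / 2 := by
    intro i
    by_cases hi : i < m
    · obtain ⟨y, h⟩ := hc i hi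
      exact ⟨y, fun _ => h⟩
    · exact ⟨0, fun h => absurd h hi⟩
  choose y hy using this
  set Y : ℕ → R2 := fun i => if i < m then y i else y 0 + lat W with hY
  have hYi : ∀ i < m, Y i = y i := fun i hi => by simp [hY, hi]
  have hYm : Y m = y 0 + lat W := by simp [hY]
  have hY1 : ∀ i < m, ‖sc N (Y (i + 1)) - ctr (c (i + 1))‖ < 1 / 2 := by
    intro i hi
    by_cases h : i + 1 < m
    · rw [hYi _ h]; exact (hy _ h).1
    · have : i + 1 = m := by omega
      rw [this, hYm, hW, sc_lat, ctr_mulI, add_sub_add_right_eq_sub]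
      exact (hy 0 hm).1
  obtain ⟨ρ, hρ0, hρ, hb⟩ := finite_bound (fun i => max (‖sc N (F (y i)) - ctr (c (i + 1))‖)
    (‖sc N (Y (i + 1)) - ctr (c (i + 1))‖)) m (fun i hi => max_lt (hy i hi).2 (hY1 i hi))
  obtain ⟨a, ha1, ha2, ha3⟩ := periodic_ext N m (fun i => c (i + 1)) hd
    (fun i => sc N (F (y i)) - ctr (c (i + 1))) ρ hρ0 (fun i hi => (le_max_left _ _).trans (hb i hi))
  obtain ⟨b, hb1, hb2, hb3⟩ := periodic_ext N m (fun i => c (i + 1)) hd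
    (fun i => sc N (Y (i + 1)) - ctr (c (i + 1))) ρ hρ0
    (fun i hi => (le_max_right _ _).trans (hb i hi))
  obtain ⟨H, hH1, hH2, hH3⟩ := cell_move N a b ρ hρ ha1 hb1 ha2 hb2
  obtain ⟨J, hJ1, hJ2, hJ3⟩ := exists_plane_move N hN H hH2 hH3
  have hGeq : ∀ x, ∀ w ∈ intLattice, (F.trans J) (x + w) = (F.trans J) x + w := by
    intro x w hw
    simp only [Homeomorph.trans_apply]
    rw [heq x w hw, hJ3 _ w hw]
  obtain ⟨g, hg⟩ := exists_torus (F.trans J) hGeq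
  have hsub := hst g ⟨_, hg⟩ (F.trans J) hg ?_
  · apply hsub
    have hstep : ∀ i < m, (F.trans J) (Y i) = Y (i + 1) := by
      intro i hi
      apply sc_inj hN
      rw [hYi i hi, Homeomorph.trans_apply, hJ1]
      have e := hH1 (c (i + 1))
      have e1 := ha3 i hi
      have e2 := hb3 i hi
      rw [e1, e2] at e
      simpa using e
    have hit : ∀ i ≤ m, (⇑(F.trans J))^[i] (Y 0) = Y i := by
      intro i hi
      induction i with
      | zero => rfl
      | succ i ih => rw [Function.iterate_succ_apply', ih (by omega), hstep i (by omega)]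
    apply periodic_rot _ hGeq m hm W (y 0)
    have := hit m le_rfl
    rwa [hYm, hYi 0 hm] at this
  · refine lt_of_le_of_lt (ciSup_le fun x => ?_) hNδ
    rw [dist_comm, dist_eq_norm]
    exact hJ2 (F x)

lemma exists_loop (N : ℕ) (hN : 0 < N) (c : ℕ → Fin 2 → ℤ) :
    ∃ i m, 0 < m ∧ i + m ≤ N ^ 2 ∧ ∃ W, c (i + m) = c i + mulI N W ∧
      ∀ p < m, ∀ q < m, ∀ l, c (i + (p + 1)) = c (i + (q + 1)) + mulI N l → p = q := by
  classical
  have : NeZero N := ⟨hN.ne'⟩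
  have hex : ∃ m, 0 < m ∧ ∃ i, i + m ≤ N ^ 2 ∧ ∃ W, c (i + m) = c i + mulI N W := by
    obtain ⟨x, y, hxy, h⟩ := Fintype.exists_ne_map_eq_of_card_lt
      (fun (k : Fin (N ^ 2 + 1)) (j : Fin 2) => ((c k j : ℤ) : ZMod N))
      (by simp [ZMod.card])
    have key : ∀ x y : ℕ, x < y → y ≤ N ^ 2 →
        (∀ j, ((c x j : ℤ) : ZMod N) = ((c y j : ℤ) : ZMod N)) →
        ∃ m, 0 < m ∧ ∃ i, i + m ≤ N ^ 2 ∧ ∃ W, c (i + m) = c i + mulI N W := by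
      intro x y hxy hy h
      have h2 : ∀ j, ∃ w : ℤ, c y j - c x j = N * w := fun j =>
        (ZMod.intCast_eq_intCast_iff_dvd_sub _ _ _).1 (h j)
      choose W hW using h2
      refine ⟨y - x, by omega, x, by omega, W, ?_⟩
      rw [Nat.add_sub_cancel' hxy.le]
      funext j
      simp only [Pi.add_apply, mulI]
      linarith [hW j]
    have h3 : ∀ j, ((c x j : ℤ) : ZMod N) = ((c y j : ℤ) : ZMod N) := fun j => congrFun h j
    rcases lt_or_gt_of_ne (fun e => hxy (Fin.ext e) : (x : ℕ) ≠ y) with h4 | h4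
    · exact key x y h4 (by omega) h3
    · exact key y x h4 (by omega) (fun j => (h3 j).symm)
  obtain ⟨hm, i, hi, W, hW⟩ := Nat.find_spec hex
  set m := Nat.find hex with hmdef
  refine ⟨i, m, hm, hi, W, hW, ?_⟩
  have key : ∀ p < m, ∀ q < m, p < q → ∀ l, c (i + (q + 1)) = c (i + (p + 1)) + mulI N l → False := by
    intro p hp q hq hpq l h
    have := Nat.find_min hex (m := q - p) (by omega)
    apply this
    refine ⟨by omega, i + (p + 1), by omega, l, ?_⟩
    rw [← h]; congr 1; omega
  intro p hp q hq l h
  rcases lt_trichotomy p q with h1 | h1 | h1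
  · refine (key p hp q hq h1 (-l) ?_).elim
    rw [h, mulI_neg]; abel
  · exact h1
  · exact (key q hq p hp h1 l h).elim

lemma lat_add (a b : Fin 2 → ℤ) : lat (a + b) = lat a + lat b := by
  ext i; simp [lat]

lemma lat_sub (a b : Fin 2 → ℤ) : lat (a - b) = lat a - lat b := by
  ext i; simp [lat]

lemma lat_mulI (N : ℕ) (a : Fin 2 → ℤ) : lat (mulI N a) = (N : ℝ) • lat a := by
  ext i; simp [lat, mulI]

lemma decomp (F : R2 ≃ₜ R2) (heq : ∀ x, ∀ w ∈ intLattice, F (x + w) = F x + w)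
    (δ : ℝ) (hst : UpperStable Homeo0 F δ) (N : ℕ) (hN : 0 < N) (hNδ : 2 / (N : ℝ) < δ)
    (C : Set R2) (hC : Convex ℝ C)
    (hS : ∀ m W, 0 < m → m ≤ N ^ 2 → (m : ℝ)⁻¹ • lat W ∈ rotSet F → (m : ℝ)⁻¹ • lat W ∈ C)
    (n : ℕ) : ∀ c : ℕ → Fin 2 → ℤ, (∀ i < n, Edge F N (c i) (c (i + 1))) →
      ∃ r ≤ n, r ≤ N ^ 2 ∧ ∃ b : ℕ → Fin 2 → ℤ, (∀ i < r, Edge F N (b i) (b (i + 1))) ∧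
      ∃ p : R2, (r < n → p ∈ C) ∧
        lat (c n - c 0) = ((N : ℝ) * ((n : ℝ) - r)) • p + lat (b r - b 0) := by
  induction n using Nat.strong_induction_on with
  | _ n ih =>
  intro c hc
  by_cases hn : n ≤ N ^ 2
  · exact ⟨n, le_rfl, hn, c, hc, 0, fun h => absurd h (lt_irrefl _), by simp⟩
  push Not at hn
  obtain ⟨i, m, hm, him, W, hW, hd⟩ := exists_loop N hN c
  have hq : (m : ℝ)⁻¹ • lat W ∈ C := by
    apply hS m W hm (by omega)
    exact loop_mem F heq δ hst N hN hNδ m hm (fun k => c (i + k))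
      (fun k hk => hc (i + k) (by omega)) W hW hd
  set q := (m : ℝ)⁻¹ • lat W with hqd
  have hmR : (0 : ℝ) < m := by exact_mod_cast hm
  have hWq : lat W = (m : ℝ) • q := by rw [hqd, smul_inv_smul₀ hmR.ne']
  clear_value q
  set c' : ℕ → Fin 2 → ℤ := fun k => if k ≤ i then c k else c (k + m) - mulI N W with hc'
  have hle : ∀ k ≤ i, c' k = c k := fun k hk => by simp [hc', hk]
  have hge : ∀ k, i ≤ k → c' k = c (k + m) + mulI N (-W) := by
    intro k hk
    rcases hk.eq_or_lt with rfl | h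
    · rw [hle _ le_rfl, hW, mulI_neg]; abel
    · simp [hc', not_le.2 h, mulI_neg, sub_eq_add_neg]
  obtain ⟨r, hrn, hrM, b, hb, p, hp, he⟩ := ih (n - m) (by omega) c' (by
    intro k hk
    by_cases h : k < i
    · rw [hle k h.le, hle (k + 1) h]; exact hc k (by omega)
    · rw [hge k (by omega), hge (k + 1) (by omega)]
      have := (hc (k + m) (by omega)).shift heq (-W)
      rwa [add_right_comm] at this)
  have hcast : ((n - m : ℕ) : ℝ) = (n : ℝ) - m := by rw [Nat.cast_sub (by omega)]
  have hend : lat (c n - c 0) = lat (c' (n - m) - c' 0) + (N : ℝ) • lat W := by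
    rw [hge (n - m) (by omega), hle 0 (by omega), Nat.sub_add_cancel (by omega), ← lat_mulI,
      ← lat_add, mulI_neg]
    congr 1; abel
  rw [hend, he, hWq, hcast]
  rcases hrn.eq_or_lt with h | h
  · refine ⟨r, by omega, hrM, b, hb, q, fun _ => hq, ?_⟩
    have : (r : ℝ) = n - m := by rw [h, hcast]
    rw [this]
    simp only [sub_self, mul_zero, zero_smul, zero_add, smul_smul, sub_sub_cancel]
    abel
  · have hrR : (r : ℝ) < n - m := by rw [← hcast]; exact_mod_cast h
    have hpos : (0 : ℝ) < n - r := by linarith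
    refine ⟨r, by omega, hrM, b, hb, (((n : ℝ) - m - r) / (n - r)) • p + ((m : ℝ) / (n - r)) • q,
      fun _ => hC (hp h) hq (div_nonneg (by linarith) hpos.le) (by positivity) (by field_simp; ring), ?_⟩
    rw [smul_add, smul_smul, smul_smul, smul_smul]
    have e1 : (N : ℝ) * (n - r) * ((n - m - r) / (n - r)) = N * (n - m - r) := by field_simp
    have e2 : (N : ℝ) * (n - r) * (m / (n - r)) = N * m := by field_simp
    rw [e1, e2]
    abel

lemma edge_bound (F : R2 ≃ₜ R2) (B : ℝ) (hB : ∀ x, ‖F x - x‖ ≤ B) (N : ℕ)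
    (a b : Fin 2 → ℤ) (h : Edge F N a b) : ‖lat b - lat a‖ ≤ 2 * (N * B + 1) := by
  obtain ⟨y, h1, h2⟩ := h
  apply norm_le_two_of_coord
  intro i
  have h3 := ((norm_le_pi_norm _ i).trans_lt h1)
  have h4 := ((norm_le_pi_norm _ i).trans_lt h2)
  have h5 := (coord_le_norm (F y - y) i).trans (hB y)
  simp only [Pi.sub_apply, sc, ctr, Real.norm_eq_abs, PiLp.sub_apply, lat] at h3 h4 h5 ⊢
  have h6 : |(N : ℝ) * F y i - N * y i| ≤ N * B := by
    rw [← mul_sub, abs_mul, Nat.abs_cast]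
    exact mul_le_mul_of_nonneg_left h5 (by positivity)
  rw [abs_lt] at h3 h4
  rw [abs_le] at h6 ⊢
  constructor <;> linarith [h3.1, h3.2, h4.1, h4.2, h6.1, h6.2]

lemma walk_bound (F : R2 ≃ₜ R2) (B : ℝ) (hB : ∀ x, ‖F x - x‖ ≤ B) (N : ℕ)
    (b : ℕ → Fin 2 → ℤ) (r : ℕ) (h : ∀ i < r, Edge F N (b i) (b (i + 1))) :
    ‖lat (b r - b 0)‖ ≤ r * (2 * (N * B + 1)) := by
  rw [lat_sub]
  induction r with
  | zero => simp
  | succ r ih =>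
    have h1 := ih (fun i hi => h i (by omega))
    have h2 := edge_bound F B hB N _ _ (h r (by omega))
    have : lat (b (r + 1)) - lat (b 0) = (lat (b (r + 1)) - lat (b r)) + (lat (b r) - lat (b 0)) := by
      abel
    rw [this]
    refine (norm_add_le _ _).trans ?_
    push_cast
    linarith

lemma dense_close (D : Set R2) (hD : Dense D) (Φ : R2 → R2) (hΦ : Continuous Φ) (z : R2) :
    ∃ z' ∈ D, ‖z' - z‖ ≤ 1 ∧ ‖Φ z' - Φ z‖ ≤ 1 := by
  have hU : IsOpen {x : R2 | ‖x - z‖ < 1 ∧ ‖Φ x - Φ z‖ < 1} := by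
    apply IsOpen.and
    · exact isOpen_lt (by fun_prop) continuous_const
    · exact isOpen_lt (by fun_prop) continuous_const
  obtain ⟨z', h1, h3⟩ := hD.inter_open_nonempty _ hU ⟨z, by simp⟩
  exact ⟨z', h3, h1.1.le, h1.2.le⟩

lemma generic (F : R2 ≃ₜ R2) (N : ℕ) (hN : 0 < N) (n : ℕ) (z : R2) :
    ∃ z', ‖z' - z‖ ≤ 1 ∧ ‖(⇑F)^[n] z' - (⇑F)^[n] z‖ ≤ 1 ∧
      ∀ i j, ∀ k : ℤ, (N : ℝ) * ((⇑F)^[i] z') j ≠ k := by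
  have hNR : (N : ℝ) ≠ 0 := by exact_mod_cast hN.ne'
  have hop : ∀ (i : ℕ) (j : Fin 2), IsOpenMap (fun x : R2 => (N : ℝ) * ((⇑F)^[i] x) j) := by
    intro i j
    have h1 : IsOpenMap ((⇑F)^[i]) := by
      induction i with
      | zero => exact IsOpenMap.id
      | succ i ih => exact ih.comp F.isOpenMap
    have h2 : IsOpenMap (fun x : R2 => x j) :=
      (isOpenMap_eval j).comp (EuclideanSpace.equiv (Fin 2) ℝ).toHomeomorph.isOpenMap
    have h3 : IsOpenMap (fun t : ℝ => (N : ℝ) * t) := (Homeomorph.mulLeft₀ (N : ℝ) hNR).isOpenMap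
    exact h3.comp (h2.comp h1)
  have hco : ∀ (i : ℕ) (j : Fin 2), Continuous (fun x : R2 => (N : ℝ) * ((⇑F)^[i] x) j) := by
    intro i j
    have h1 : Continuous ((⇑F)^[i]) := F.continuous.iterate i
    fun_prop
  have hD : Dense (⋂ s : ℕ × Fin 2 × ℤ,
      (fun x : R2 => (N : ℝ) * ((⇑F)^[s.1] x) s.2.1) ⁻¹' {((s.2.2 : ℤ) : ℝ)}ᶜ) := by
    apply dense_iInter_of_isOpen
    · intro s
      exact isOpen_compl_singleton.preimage (hco _ _)
    · intro s
      exact (dense_compl_singleton _).preimage (hop _ _)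
  obtain ⟨z', h3, h1, h2⟩ := dense_close _ hD _ (F.continuous.iterate n) z
  refine ⟨z', h1, h2, ?_⟩
  intro i j k
  have := mem_iInter.1 h3 (i, j, k)
  exact this

lemma norm_sub_ctr_lt (x : Fin 2 → ℝ) (h : ∀ j, ∀ k : ℤ, x j ≠ k) :
    ‖x - ctr (cel x)‖ < 1 / 2 := by
  rw [pi_norm_lt_iff (by norm_num)]
  intro i
  simp only [Pi.sub_apply, ctr, cel, Real.norm_eq_abs]
  rw [abs_lt]
  have h1 := lt_of_le_of_ne (Int.floor_le (x i)) (h i _).symm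
  have h2 := Int.lt_floor_add_one (x i)
  constructor <;> linarith

lemma lat_cel (N : ℕ) (x : R2) : ‖lat (cel (sc N x)) - (N : ℝ) • x‖ ≤ 2 * 1 := by
  apply norm_le_two_of_coord
  intro i
  simp only [lat, cel, sc, PiLp.sub_apply, PiLp.smul_apply, smul_eq_mul]
  have h1 := Int.floor_le ((N : ℝ) * x i)
  have h2 := Int.lt_floor_add_one ((N : ℝ) * x i)
  rw [abs_le]
  constructor <;> linarith

lemma approx (F : R2 ≃ₜ R2) (heq : ∀ x, ∀ w ∈ intLattice, F (x + w) = F x + w)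
    (δ : ℝ) (hst : UpperStable Homeo0 F δ) (N : ℕ) (hN : 0 < N) (hNδ : 2 / (N : ℝ) < δ)
    (C : Set R2) (hC : Convex ℝ C) (R : ℝ) (hR : ∀ p ∈ C, ‖p‖ ≤ R)
    (hS : ∀ m W, 0 < m → m ≤ N ^ 2 → (m : ℝ)⁻¹ • lat W ∈ rotSet F → (m : ℝ)⁻¹ • lat W ∈ C) :
    ∃ E : ℝ, ∀ n, N ^ 2 < n → ∀ z, ∃ p ∈ C, ‖((⇑F)^[n] z - z) - (n : ℝ) • p‖ ≤ E := by
  obtain ⟨B, hB0, hB⟩ := disp_bdd (⇑F) F.continuous heq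
  have hNR : (1 : ℝ) ≤ N := by exact_mod_cast hN
  refine ⟨2 + 4 + (N : ℝ) ^ 2 * R + (N : ℝ) ^ 2 * (2 * (N * B + 1)), ?_⟩
  intro n hn z
  obtain ⟨z', h1, h2, h3⟩ := generic F N hN n z
  obtain ⟨r, hrn, hrM, b, hb, p, hp, he⟩ := decomp F heq δ hst N hN hNδ C hC hS n
    (fun i => cel (sc N ((⇑F)^[i] z'))) (by
      intro i _
      refine ⟨(⇑F)^[i] z', norm_sub_ctr_lt _ (h3 i), ?_⟩
      rw [← Function.iterate_succ_apply' (⇑F)]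
      exact norm_sub_ctr_lt _ (h3 (i + 1)))
  have hpC := hp (by omega)
  refine ⟨p, hpC, ?_⟩
  have hw := walk_bound F B hB N b r hb
  have hrR : (r : ℝ) ≤ (N : ℝ) ^ 2 := by exact_mod_cast hrM
  have g1 := lat_cel N ((⇑F)^[n] z')
  have g2 := lat_cel N z'
  rw [lat_sub] at he
  simp only [Function.iterate_zero, id] at he
  have hsum : (N : ℝ) • (((⇑F)^[n] z' - z') - (n : ℝ) • p) =
      -(lat (cel (sc N ((⇑F)^[n] z'))) - (N : ℝ) • (⇑F)^[n] z') +
      (lat (cel (sc N z')) - (N : ℝ) • z') + (-((N * r : ℝ) • p)) + lat (b r - b 0) := by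
    have he' : lat (b r - b 0) = lat (cel (sc N ((⇑F)^[n] z'))) - lat (cel (sc N z'))
        - ((N : ℝ) * ((n : ℝ) - r)) • p := by rw [he]; abel
    rw [he']
    module
  have hR0 : 0 ≤ R := (norm_nonneg p).trans (hR p hpC)
  have hn1 : ‖((⇑F)^[n] z' - z') - (n : ℝ) • p‖ ≤
      4 + (N : ℝ) ^ 2 * R + (N : ℝ) ^ 2 * (2 * (N * B + 1)) := by
    have h4 : ‖(N : ℝ) • (((⇑F)^[n] z' - z') - (n : ℝ) • p)‖ ≤
        2 + 2 + (N : ℝ) * ((N : ℝ) ^ 2 * R) + (N : ℝ) ^ 2 * (2 * (N * B + 1)) := by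
      rw [hsum]
      refine (norm_add_le _ _).trans (add_le_add ((norm_add_le _ _).trans (add_le_add
        ((norm_add_le _ _).trans (add_le_add ?_ ?_)) ?_)) ?_)
      · rw [norm_neg]; linarith
      · linarith
      · rw [norm_neg, norm_smul, Real.norm_of_nonneg (by positivity), mul_assoc]
        gcongr
        exact hR p hpC
      · exact hw.trans (by gcongr)
    rw [norm_smul, Real.norm_of_nonneg (by positivity)] at h4
    have hX : 0 ≤ (N : ℝ) ^ 2 * (2 * (N * B + 1)) := by positivity
    by_contra hcon
    push Not at hcon
    have := mul_lt_mul_of_pos_left hcon (show (0 : ℝ) < N by linarith)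
    nlinarith
  have : ((⇑F)^[n] z - z) - (n : ℝ) • p = -((⇑F)^[n] z' - (⇑F)^[n] z) + (z' - z) +
      (((⇑F)^[n] z' - z') - (n : ℝ) • p) := by abel
  rw [this]
  refine (norm_add_le _ _).trans ?_
  have : ‖-((⇑F)^[n] z' - (⇑F)^[n] z) + (z' - z)‖ ≤ 2 := by
    refine (norm_add_le _ _).trans ?_
    rw [norm_neg]; linarith
  linarith

lemma rotSet_sub (F : R2 ≃ₜ R2) (heq : ∀ x, ∀ w ∈ intLattice, F (x + w) = F x + w)
    (δ : ℝ) (hst : UpperStable Homeo0 F δ) (N : ℕ) (hN : 0 < N) (hNδ : 2 / (N : ℝ) < δ)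
    (C : Set R2) (hC : Convex ℝ C) (hCc : IsCompact C)
    (hS : ∀ m W, 0 < m → m ≤ N ^ 2 → (m : ℝ)⁻¹ • lat W ∈ rotSet F → (m : ℝ)⁻¹ • lat W ∈ C) :
    rotSet F ⊆ C := by
  obtain ⟨R, hR⟩ := hCc.isBounded.exists_norm_le
  obtain ⟨E, hE⟩ := approx F heq δ hst N hN hNδ C hC R hR hS
  rintro v ⟨z, n, hn, hv⟩
  have : ∀ k, ∃ p, N ^ 2 < n k → p ∈ C ∧ ‖((⇑F)^[n k] (z k) - z k) - (n k : ℝ) • p‖ ≤ E := by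
    intro k
    by_cases h : N ^ 2 < n k
    · obtain ⟨p, h1, h2⟩ := hE (n k) h (z k)
      exact ⟨p, fun _ => ⟨h1, h2⟩⟩
    · exact ⟨0, fun h' => absurd h' h⟩
  choose p hp using this
  have hev : ∀ᶠ k in atTop, N ^ 2 < n k := hn.eventually_gt_atTop _
  have hnR : Tendsto (fun k => (n k : ℝ)) atTop atTop := tendsto_natCast_atTop_atTop.comp hn
  have hz : Tendsto (fun k => (n k : ℝ)⁻¹ • ((⇑F)^[n k] (z k) - z k) - p k) atTop (𝓝 0) := by
    apply squeeze_zero_norm' (a := fun k => E / (n k : ℝ))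
    · filter_upwards [hev] with k hk
      have hpos : (0 : ℝ) < n k := by exact_mod_cast (by omega : 0 < n k)
      have e : (n k : ℝ)⁻¹ • ((⇑F)^[n k] (z k) - z k) - p k =
          (n k : ℝ)⁻¹ • (((⇑F)^[n k] (z k) - z k) - (n k : ℝ) • p k) := by
        rw [smul_sub (n k : ℝ)⁻¹ _ ((n k : ℝ) • p k), inv_smul_smul₀ hpos.ne']
      rw [e, norm_smul, norm_inv, Real.norm_of_nonneg hpos.le, div_eq_inv_mul]
      exact mul_le_mul_of_nonneg_left (hp k hk).2 (by positivity)
    · exact hnR.const_div_atTop E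
  have hlim : Tendsto p atTop (𝓝 v) := by
    have := hv.sub hz
    simpa using this
  exact hCc.isClosed.mem_of_tendsto hlim (hev.mono fun k hk => (hp k hk).1)

lemma rotSet_norm (F : R2 ≃ₜ R2) (B : ℝ) (hB0 : 0 ≤ B) (hB : ∀ x, ‖F x - x‖ ≤ B) (v : R2)
    (hv : v ∈ rotSet F) : ‖v‖ ≤ B := by
  obtain ⟨z, n, hn, hv⟩ := hv
  refine le_of_tendsto hv.norm (Eventually.of_forall fun k => ?_)
  rw [norm_smul, norm_inv, Real.norm_of_nonneg (by positivity)]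
  have h := iter_disp (⇑F) B hB (n k) (z k)
  rcases Nat.eq_zero_or_pos (n k) with h0 | h0
  · rw [h0]; simpa using hB0
  · have : (0 : ℝ) < n k := by exact_mod_cast h0
    rw [inv_mul_le_iff₀ this]; exact h

def loopSet (F : R2 ≃ₜ R2) (N : ℕ) : Set R2 :=
  {s | ∃ (m : ℕ) (W : Fin 2 → ℤ), 0 < m ∧ m ≤ N ^ 2 ∧ s = (m : ℝ)⁻¹ • lat W ∧ s ∈ rotSet F}

lemma loopSet_finite (F : R2 ≃ₜ R2) (heq : ∀ x, ∀ w ∈ intLattice, F (x + w) = F x + w) (N : ℕ) :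
    (loopSet F N).Finite := by
  obtain ⟨B, hB0, hB⟩ := disp_bdd (⇑F) F.continuous heq
  obtain ⟨L, hL⟩ := exists_nat_ge ((N : ℝ) ^ 2 * B)
  refine (((Set.finite_Icc 1 (N ^ 2)).prod (Set.finite_Icc (fun _ : Fin 2 => (-(L : ℤ)))
    (fun _ : Fin 2 => (L : ℤ)))).image
    (fun q : ℕ × (Fin 2 → ℤ) => (q.1 : ℝ)⁻¹ • lat q.2)).subset ?_
  rintro s ⟨m, W, hm, hmN, hs, hr⟩
  have hmR : (0 : ℝ) < m := by exact_mod_cast hm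
  have hmNR : (m : ℝ) ≤ (N : ℝ) ^ 2 := by exact_mod_cast hmN
  have hbd : ∀ i, |W i| ≤ (L : ℤ) := by
    intro i
    have h1 := rotSet_norm F B hB0 hB s hr
    rw [hs, norm_smul, norm_inv, Real.norm_of_nonneg hmR.le, inv_mul_le_iff₀ hmR] at h1
    have h2 : |(W i : ℝ)| ≤ L := by
      calc |(W i : ℝ)| = |lat W i| := rfl
        _ ≤ ‖lat W‖ := coord_le_norm _ _
        _ ≤ m * B := h1
        _ ≤ (N : ℝ) ^ 2 * B := by gcongr
        _ ≤ L := hL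
    exact_mod_cast h2
  exact ⟨(m, W), ⟨⟨hm, hmN⟩, fun i => (abs_le.1 (hbd i)).1, fun i => (abs_le.1 (hbd i)).2⟩, hs.symm⟩

lemma extreme_rational (F : R2 ≃ₜ R2) (heq : ∀ x, ∀ w ∈ intLattice, F (x + w) = F x + w)
    (δ : ℝ) (hδ : 0 < δ) (hst : UpperStable Homeo0 F δ) (v : R2)
    (hv : v ∈ Set.extremePoints ℝ (rotSet F)) : IsRationalPoint v := by
  obtain ⟨N, hN1⟩ := exists_nat_gt (2 / δ)
  have hNR : (0 : ℝ) < N := lt_trans (by positivity) hN1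
  have hN : 0 < N := by exact_mod_cast hNR
  have hNδ : 2 / (N : ℝ) < δ := by
    rw [div_lt_iff₀ hδ] at hN1
    rw [div_lt_iff₀ hNR]; linarith
  have hfin := loopSet_finite F heq N
  have h1 : rotSet F ⊆ convexHull ℝ (loopSet F N) :=
    rotSet_sub F heq δ hst N hN hNδ _ (convex_convexHull ℝ _) (hfin.isCompact_convexHull (𝕜 := ℝ))
      (fun m W hm hmN hr => subset_convexHull ℝ _ ⟨m, W, hm, hmN, rfl, hr⟩)
  have h2 : convexHull ℝ (loopSet F N) ⊆ rotSet F :=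
    (convexHull_mono (fun s hs => hs.choose_spec.choose_spec.2.2.2)).trans (rotSet_convex F heq)
  have h3 : rotSet F = convexHull ℝ (loopSet F N) := h1.antisymm h2
  rw [h3] at hv
  obtain ⟨m, W, -, -, rfl, -⟩ := extremePoints_convexHull_subset hv
  intro i
  refine ⟨(m : ℚ)⁻¹ * W i, ?_⟩
  simp [lat]

lemma lifts_differ (f : T2 ≃ₜ T2) (F G : R2 ≃ₜ R2) (hF : IsLift f F) (hG : IsLift f G) :
    ∃ w ∈ intLattice, ∀ x, F x = G x + w := by
  have hmem : ∀ x, F x - G x ∈ intLattice := by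
    intro x
    have h : pr (G x) = pr (F x) := by rw [hF.proj, hG.proj]
    have h2 := QuotientAddGroup.eq.1 h
    rwa [neg_add_eq_sub] at h2
  have hconst : ∀ x, F x - G x = F 0 - G 0 := by
    intro x
    have hch : ∀ i, ∃ n : R2 → ℤ, ∀ x, (F x - G x) i = (n x : ℝ) := by
      intro i
      choose n hn using fun x => hmem x i
      exact ⟨n, hn⟩
    ext i
    obtain ⟨n, hn⟩ := hch i
    have hcn : Continuous n := by
      rw [Int.isClosedEmbedding_coe_real.isInducing.continuous_iff]
      have e : (fun x => ((n x : ℤ) : ℝ)) = fun x => (F x - G x) i := funext fun x => (hn x).symm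
      have hc : Continuous fun x => (F x - G x) i := by
        have := F.continuous
        have := G.continuous
        fun_prop
      rw [← e] at hc
      exact hc
    rw [hn, hn, PreconnectedSpace.constant inferInstance hcn (x := x) (y := 0)]
  exact ⟨F 0 - G 0, hmem 0, fun x => by rw [← hconst x]; abel⟩

lemma rotSet_shift (F G : R2 ≃ₜ R2) (hG : ∀ x, ∀ w ∈ intLattice, G (x + w) = G x + w)
    (w : R2) (hw : w ∈ intLattice) (h : ∀ x, F x = G x + w) (v : R2) (hv : v ∈ rotSet F) :
    v - w ∈ rotSet G := by
  have hit : ∀ (n : ℕ) x, (⇑F)^[n] x = (⇑G)^[n] x + (n : ℝ) • w := by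
    intro n x
    induction n with
    | zero => simp
    | succ n ih =>
      have hnw : (n : ℝ) • w ∈ intLattice := by
        obtain ⟨W, rfl⟩ := mem_lattice_iff.1 hw
        rw [lat_nsmul]; exact mem_lattice_iff.2 ⟨_, rfl⟩
      rw [Function.iterate_succ_apply', ih, h, hG _ _ hnw, Function.iterate_succ_apply']
      push_cast
      rw [add_smul, one_smul]; abel
  obtain ⟨z, n, hn, hv⟩ := hv
  refine ⟨z, n, hn, (hv.sub_const w).congr' ?_⟩
  filter_upwards [hn.eventually_gt_atTop 0] with k hk
  have hpos : (n k : ℝ) ≠ 0 := by exact_mod_cast hk.ne'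
  rw [hit, add_sub_right_comm, smul_add, inv_smul_smul₀ hpos, add_sub_cancel_right]

lemma main_aux (f : T2 ≃ₜ T2)
    (hstab : ∃ δ > 0, ∃ F₀ : R2 ≃ₜ R2, IsLift f F₀ ∧ UpperStable Homeo0 F₀ δ) :
    ∀ F : R2 ≃ₜ R2, IsLift f F →
      ∀ v ∈ Set.extremePoints ℝ (rotSet F), IsRationalPoint v := by
  obtain ⟨δ, hδ, F₀, hF₀, hst⟩ := hstab
  intro F hF v hv
  obtain ⟨w, hw, h⟩ := lifts_differ f F F₀ hF hF₀
  have hback : ∀ u ∈ rotSet F₀, u + w ∈ rotSet F := by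
    intro u hu
    have := rotSet_shift F₀ F hF.equivariant (-w) (neg_mem hw) (fun x => by rw [h]; abel) u hu
    rwa [sub_neg_eq_add] at this
  have hext : v - w ∈ Set.extremePoints ℝ (rotSet F₀) := by
    refine ⟨rotSet_shift F F₀ hF₀.equivariant w hw h v hv.1, ?_⟩
    intro a ha b hb hab
    obtain ⟨s, t, hs, ht, hst', e⟩ := hab
    have := hv.2 (hback a ha) (hback b hb) ⟨s, t, hs, ht, hst', by
      rw [smul_add, smul_add]
      have : s • a + s • w + (t • b + t • w) = (s • a + t • b) + (s + t) • w := by module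
      rw [this, e, hst', one_smul]; abel⟩
    rw [← this]; abel
  have hr := extreme_rational F₀ hF₀.equivariant δ hδ hst _ hext
  intro i
  obtain ⟨q, hq⟩ := hr i
  obtain ⟨k, hk⟩ := hw i
  refine ⟨q + k, ?_⟩
  rw [PiLp.sub_apply] at hq
  push_cast
  rw [← hq, ← hk]; ring


/-- If the rotation set of `f ∈ Homeo₀(T²)` is upper-stable in
`Homeo₀(T²)` (`δ`-upper-stable for some `δ > 0`), then for any lift `F` of `f` every
extremal point of `ρ(F)` has rational coordinates. -/
theorem extreme_points_rational_of_upper_stable (f : T2 ≃ₜ T2) (hf : f ∈ Homeo0)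
    (hstab : ∃ δ > 0, ∃ F₀ : R2 ≃ₜ R2, IsLift f F₀ ∧ UpperStable Homeo0 F₀ δ) :
    ∀ F : R2 ≃ₜ R2, IsLift f F →
      ∀ v ∈ Set.extremePoints ℝ (rotSet F), IsRationalPoint v := by
  exact main_aux f hstab
end
end

section
/- There is a residual (comeager) subset of Homeo_{0,λ}(T²), with the uniform C⁰ topology, every element of which has the shadowing property. -/
noncomputable section

open Metric Set Filter Topology MeasureTheory Pointwise

namespace GS

abbrev V : Type := ℝ × ℝ

instance : Fact ((0:ℝ) < 8) := ⟨by norm_num⟩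

abbrev Circ : Type := AddCircle (8:ℝ)

/-- the clamp wave -/
def cw (θ : Circ) : ℝ := max (-1) (min 1 (2 - ‖θ‖))

/-- parametrization of the unit square boundary -/
def sg (θ : Circ) : V := (cw θ, cw (θ - ((2:ℝ) : Circ)))

lemma cw_cont : Continuous cw := by unfold cw; fun_prop

lemma sg_cont : Continuous sg := by
  unfold sg
  exact cw_cont.prodMk (cw_cont.comp (by fun_prop))

lemma norm_circ {s : ℝ} (h : |s| ≤ 4) : ‖(s : Circ)‖ = |s| := by
  rw [AddCircle.norm_coe_eq_abs_iff _ (by norm_num)]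
  rw [abs_of_pos (by norm_num : (0:ℝ) < 8)]; linarith

lemma circ_sub8 (s : ℝ) : ((s - 8 : ℝ) : Circ) = (s : Circ) := by
  rw [AddCircle.coe_sub, AddCircle.coe_period, sub_zero]

lemma cw_near {s : ℝ} (h : |s| ≤ 4) : cw (s : Circ) = max (-1) (min 1 (2 - |s|)) := by
  rw [cw, norm_circ h]

lemma cw_far {s : ℝ} (h : 4 ≤ s) (h' : s ≤ 12) :
    cw (s : Circ) = max (-1) (min 1 (2 - |s - 8|)) := by
  rw [← circ_sub8, cw_near]
  rw [abs_le]; constructor <;> linarith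

lemma sg_coe (s : ℝ) : sg (s : Circ) = (cw (s : Circ), cw ((s - 2 : ℝ) : Circ)) := by
  rw [sg, AddCircle.coe_sub]

lemma sg1 {s : ℝ} (h : -1 ≤ s) (h' : s ≤ 1) : sg (s : Circ) = (1, s) := by
  rw [sg_coe, cw_near (abs_le.2 ⟨by linarith, by linarith⟩),
    cw_near (abs_le.2 ⟨by linarith, by linarith⟩)]
  rw [abs_of_nonpos (by linarith : s - 2 ≤ 0)]
  have : |s| ≤ 1 := abs_le.2 ⟨h, h'⟩
  congr 1
  · rw [min_eq_left (by linarith), max_eq_right (by linarith)]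
  · rw [min_eq_right (by linarith), max_eq_right (by linarith)]; ring

lemma sg2 {s : ℝ} (h : 1 ≤ s) (h' : s ≤ 3) : sg (s : Circ) = (2 - s, 1) := by
  rw [sg_coe, cw_near (abs_le.2 ⟨by linarith, by linarith⟩),
    cw_near (abs_le.2 ⟨by linarith, by linarith⟩)]
  have : |s - 2| ≤ 1 := abs_le.2 ⟨by linarith, by linarith⟩
  rw [abs_of_nonneg (by linarith : 0 ≤ s)]
  congr 1
  · rw [min_eq_right (by linarith), max_eq_right (by linarith)]
  · rw [min_eq_left (by linarith), max_eq_right (by linarith)]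

lemma cw_far' {s : ℝ} (h : 3 ≤ s) (h' : s ≤ 5) : cw (s : Circ) = -1 := by
  rcases le_total s 4 with h4 | h4
  · rw [cw_near (abs_le.2 ⟨by linarith, by linarith⟩), abs_of_nonneg (by linarith)]
    rw [min_eq_right (by linarith), max_eq_left (by linarith)]
  · rw [cw_far h4 (by linarith), abs_of_nonpos (by linarith)]
    rw [min_eq_right (by linarith), max_eq_left (by linarith)]

lemma sg3 {s : ℝ} (h : 3 ≤ s) (h' : s ≤ 5) : sg (s : Circ) = (-1, 4 - s) := by
  rw [sg_coe, cw_far' h h', cw_near (abs_le.2 ⟨by linarith, by linarith⟩)]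
  rw [abs_of_nonneg (by linarith : 0 ≤ s - 2)]
  congr 1
  rw [min_eq_right (by linarith), max_eq_right (by linarith)]; ring

lemma sg4 {s : ℝ} (h : 5 ≤ s) (h' : s ≤ 7) : sg (s : Circ) = (s - 6, -1) := by
  rw [sg_coe, cw_far' (s := s - 2) (by linarith) (by linarith), cw_far (by linarith) (by linarith)]
  rw [abs_of_nonpos (by linarith : s - 8 ≤ 0)]
  congr 1
  rw [min_eq_right (by linarith), max_eq_right (by linarith)]; ring

lemma circ_rep (θ : Circ) : ∃ s : ℝ, -1 ≤ s ∧ s < 7 ∧ (s : Circ) = θ := by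
  have := AddCircle.coe_image_Ico_eq (8:ℝ) (-1)
  have h : θ ∈ ((↑) : ℝ → Circ) '' Ico (-1) (-1 + 8) := by rw [this]; trivial
  obtain ⟨s, hs, rfl⟩ := h
  exact ⟨s, hs.1, by linarith [hs.2], rfl⟩

lemma sg_norm (θ : Circ) : ‖sg θ‖ = 1 := by
  obtain ⟨s, h1, h2, rfl⟩ := circ_rep θ
  rw [Prod.norm_def]
  rcases le_total s 1 with h | h
  · rw [sg1 h1 h]; simp; exact abs_le.2 ⟨h1, h⟩
  rcases le_total s 3 with h' | h'
  · rw [sg2 h h']; simp; exact abs_le.2 ⟨by linarith, by linarith⟩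
  rcases le_total s 5 with h'' | h''
  · rw [sg3 h' h'']; simp; exact abs_le.2 ⟨by linarith, by linarith⟩
  · rw [sg4 h'' h2.le]; simp; exact abs_le.2 ⟨by linarith, by linarith⟩

lemma sg_inj : Function.Injective sg := by
  intro θ θ' hh
  obtain ⟨s, h1, h2, rfl⟩ := circ_rep θ
  obtain ⟨t, g1, g2, rfl⟩ := circ_rep θ'
  suffices s = t by rw [this]
  have key : ∀ r : ℝ, -1 ≤ r → r < 7 →
      ((r ≤ 1 ∧ sg (r : Circ) = (1, r)) ∨ (1 ≤ r ∧ r ≤ 3 ∧ sg (r : Circ) = (2 - r, 1)) ∨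
      (3 ≤ r ∧ r ≤ 5 ∧ sg (r : Circ) = (-1, 4 - r)) ∨ (5 ≤ r ∧ sg (r : Circ) = (r - 6, -1))) := by
    intro r a b
    rcases le_total r 1 with h | h
    · exact Or.inl ⟨h, sg1 a h⟩
    rcases le_total r 3 with h' | h'
    · exact Or.inr (Or.inl ⟨h, h', sg2 h h'⟩)
    rcases le_total r 5 with h'' | h''
    · exact Or.inr (Or.inr (Or.inl ⟨h', h'', sg3 h' h''⟩))
    · exact Or.inr (Or.inr (Or.inr ⟨h'', sg4 h'' b.le⟩))
  rcases key s h1 h2 with ⟨a, e⟩ | ⟨a, a', e⟩ | ⟨a, a', e⟩ | ⟨a, e⟩ <;>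
  rcases key t g1 g2 with ⟨b, e'⟩ | ⟨b, b', e'⟩ | ⟨b, b', e'⟩ | ⟨b, e'⟩ <;>
  · rw [e, e', Prod.mk.injEq] at hh
    obtain ⟨p, q⟩ := hh
    linarith

lemma sg_surj {x : V} (hx : ‖x‖ = 1) : ∃ θ, sg θ = x := by
  obtain ⟨a, b⟩ := x
  rw [Prod.norm_def] at hx
  simp only [Real.norm_eq_abs] at hx
  have ha : |a| ≤ 1 := hx ▸ le_max_left _ _
  have hb : |b| ≤ 1 := hx ▸ le_max_right _ _
  obtain ⟨a1, a2⟩ := abs_le.1 ha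
  obtain ⟨b1, b2⟩ := abs_le.1 hb
  rcases max_choice |a| |b| with h | h
  · rw [h] at hx
    rcases (abs_eq (by norm_num)).1 hx with rfl | rfl
    · exact ⟨(b : ℝ), sg1 b1 b2⟩
    · exact ⟨((4 - b : ℝ) : Circ), by rw [sg3 (by linarith) (by linarith)]; simp⟩
  · rw [h] at hx
    rcases (abs_eq (by norm_num)).1 hx with rfl | rfl
    · exact ⟨((2 - a : ℝ) : Circ), by rw [sg2 (by linarith) (by linarith)]; simp⟩
    · exact ⟨((a + 6 : ℝ) : Circ), by rw [sg4 (by linarith) (by linarith)]; simp⟩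

lemma sg_emb : IsClosedEmbedding sg :=
  sg_cont.isClosedEmbedding sg_inj

/-- angle map -/
def ang (x : V) : Circ := Function.invFun sg (‖x‖⁻¹ • x)

lemma sg_ang {x : V} (hx : x ≠ 0) : sg (ang x) = ‖x‖⁻¹ • x := by
  apply Function.invFun_eq
  apply sg_surj
  rw [norm_smul, norm_inv, norm_norm, inv_mul_cancel₀ (norm_ne_zero_iff.2 hx)]

lemma smul_sg_ang (x : V) : ‖x‖ • sg (ang x) = x := by
  by_cases hx : x = 0
  · simp [hx]
  rw [sg_ang hx, smul_smul, mul_inv_cancel₀ (norm_ne_zero_iff.2 hx), one_smul]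

lemma norm_smul_sg {u : ℝ} (hu : 0 ≤ u) (θ : Circ) : ‖u • sg θ‖ = u := by
  rw [norm_smul, sg_norm, mul_one, Real.norm_of_nonneg hu]

lemma ang_smul_sg {u : ℝ} (hu : 0 < u) (θ : Circ) : ang (u • sg θ) = θ := by
  apply sg_inj
  have h0 : u • sg θ ≠ 0 := by
    intro h; have := norm_smul_sg hu.le θ; rw [h, norm_zero] at this; linarith
  rw [sg_ang h0, norm_smul_sg hu.le, smul_smul, inv_mul_cancel₀ hu.ne', one_smul]

lemma ang_contOn : ContinuousOn ang {x : V | x ≠ 0} := by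
  rw [sg_emb.isInducing.continuousOn_iff]
  have : ContinuousOn (fun x : V => ‖x‖⁻¹ • x) {x : V | x ≠ 0} := by
    have h1 : ContinuousOn (fun x : V => ‖x‖⁻¹) {x : V | x ≠ 0} :=
      ContinuousOn.inv₀ continuous_norm.continuousOn (fun x hx => norm_ne_zero_iff.2 hx)
    exact h1.smul continuousOn_id
  exact this.congr (fun x hx => sg_ang hx)

/-- nearby points have nearby angles -/
lemma ang_close {κ : ℝ} (hκ : 0 < κ) : ∃ η > 0, ∀ x y : V, κ ≤ ‖x‖ → y ≠ 0 → dist x y < η →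
    ‖ang x - ang y‖ < 1 := by
  have hc : IsCompact {p : Circ × Circ | 1 ≤ ‖p.1 - p.2‖} := by
    apply IsClosed.isCompact
    exact isClosed_le continuous_const (by fun_prop)
  obtain ⟨δ, hδ, hd⟩ : ∃ δ > 0, ∀ a b : Circ, dist (sg a) (sg b) < δ → ‖a - b‖ < 1 := by
    rcases ({p : Circ × Circ | 1 ≤ ‖p.1 - p.2‖}).eq_empty_or_nonempty with he | hne
    · refine ⟨1, one_pos, fun a b _ => ?_⟩
      by_contra h
      have : (a, b) ∈ {p : Circ × Circ | 1 ≤ ‖p.1 - p.2‖} := not_lt.1 h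
      rw [he] at this; exact this
    · obtain ⟨p, hp, hmin⟩ := hc.exists_isMinOn hne
        (f := fun p : Circ × Circ => dist (sg p.1) (sg p.2))
        ((sg_cont.comp continuous_fst).dist (sg_cont.comp continuous_snd)).continuousOn
      refine ⟨dist (sg p.1) (sg p.2), ?_, fun a b hab => ?_⟩
      · rw [gt_iff_lt, dist_pos]
        intro h
        have h2 := sg_inj h
        have h3 : (1:ℝ) ≤ ‖p.1 - p.2‖ := hp
        rw [h2, sub_self, norm_zero] at h3; linarith
      · by_contra h
        have := hmin (show (a, b) ∈ {p : Circ × Circ | 1 ≤ ‖p.1 - p.2‖} from not_lt.1 h)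
        simp only [mem_ofPred_eq] at this
        linarith
  refine ⟨κ * δ / 2, by positivity, fun x y hx hy hxy => hd _ _ ?_⟩
  have hx0 : 0 < ‖x‖ := by linarith
  have hy0 : 0 < ‖y‖ := norm_pos_iff.2 hy
  rw [sg_ang (norm_pos_iff.1 hx0), sg_ang hy, dist_eq_norm]
  have e : ‖x‖⁻¹ • x - ‖y‖⁻¹ • y = ‖x‖⁻¹ • ((x - y) + (‖y‖ - ‖x‖) • (‖y‖⁻¹ • y)) := by
    rw [smul_add, smul_sub, smul_smul, smul_smul]
    have : ‖x‖⁻¹ * (‖y‖ - ‖x‖) * ‖y‖⁻¹ = ‖x‖⁻¹ - ‖y‖⁻¹ := by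
      field_simp
    rw [this, sub_smul]; abel
  have h1 : ‖‖y‖⁻¹ • y‖ = 1 := by
    rw [norm_smul, norm_inv, norm_norm, inv_mul_cancel₀ hy0.ne']
  have h2 : ‖(x - y) + (‖y‖ - ‖x‖) • (‖y‖⁻¹ • y)‖ ≤ 2 * ‖x - y‖ := by
    refine (norm_add_le _ _).trans ?_
    rw [norm_smul, h1, mul_one, Real.norm_eq_abs]
    have := abs_norm_sub_norm_le y x
    rw [norm_sub_rev] at this
    linarith
  rw [e, norm_smul, norm_inv, norm_norm]
  rw [dist_eq_norm] at hxy
  rw [inv_mul_lt_iff₀ hx0]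
  calc _ ≤ 2 * ‖x - y‖ := h2
    _ < κ * δ := by linarith
    _ ≤ ‖x‖ * δ := by gcongr

end GS

namespace GS

/-- twist map along concentric squares -/
def tw (α : ℝ → ℝ) (x : V) : V := ‖x‖ • sg (ang x + ((α ‖x‖ : ℝ) : Circ))

lemma tw_norm (α : ℝ → ℝ) (x : V) : ‖tw α x‖ = ‖x‖ := norm_smul_sg (norm_nonneg _) _

lemma tw_smul_sg (α : ℝ → ℝ) {u : ℝ} (hu : 0 ≤ u) (θ : Circ) :
    tw α (u • sg θ) = u • sg (θ + ((α u : ℝ) : Circ)) := by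
  rcases hu.eq_or_lt with rfl | h
  · simp [tw]
  · rw [tw, norm_smul_sg hu, ang_smul_sg h]

lemma tw_inv (α : ℝ → ℝ) (x : V) : tw (fun u => - α u) (tw α x) = x := by
  conv_lhs => rw [← smul_sg_ang x]
  rw [tw_smul_sg α (norm_nonneg _), tw_smul_sg _ (norm_nonneg _)]
  conv_rhs => rw [← smul_sg_ang x]
  congr 2
  rw [AddCircle.coe_neg]; abel

lemma tw_eq_self (α : ℝ → ℝ) {x : V} (h : ((α ‖x‖ : ℝ) : Circ) = 0) : tw α x = x := by
  rw [tw, h, add_zero, smul_sg_ang]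

lemma tw_cont {α : ℝ → ℝ} (hα : Continuous α) : Continuous (tw α) := by
  rw [continuous_iff_continuousAt]
  intro x
  by_cases hx : x = 0
  · subst hx
    have h0 : tw α 0 = 0 := by simp [tw]
    rw [ContinuousAt, h0, tendsto_zero_iff_norm_tendsto_zero]
    simp_rw [tw_norm]
    have := (continuous_norm (E := V)).tendsto 0
    simpa using this
  · have h1 : ContinuousAt ang x := ang_contOn.continuousAt (isOpen_ne.mem_nhds hx)
    have h2 : Continuous (fun x : V => ((α ‖x‖ : ℝ) : Circ)) :=
      (AddCircle.continuous_mk' 8).comp (hα.comp continuous_norm)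
    exact continuous_norm.continuousAt.smul (sg_cont.continuousAt.comp (h1.add h2.continuousAt))

/-! measure -/
open ENNReal

lemma lint_scale {u : ℝ} (hu : 0 < u) (g : ℝ → ℝ≥0∞) (a b : ℝ) :
    ENNReal.ofReal u * ∫⁻ s in Ioc a b, g (u * s) = ∫⁻ y in Ioc (u * a) (u * b), g y := by
  have h := lintegral_image_eq_lintegral_abs_deriv_mul (f := fun s : ℝ => u * s) (f' := fun _ => u)
    (measurableSet_Ioc (a := a) (b := b))
    (fun x _ => by simpa using ((hasDerivAt_id x).const_mul u).hasDerivWithinAt)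
    (fun x _ y _ hxy => mul_left_cancel₀ hu.ne' hxy) g
  have himg : (fun s : ℝ => u * s) '' Ioc a b = Ioc (u * a) (u * b) := by
    rw [Set.image_mul_left_Ioc hu]
  rw [himg] at h
  rw [h, lintegral_const_mul' _ _ ENNReal.ofReal_ne_top.elim, abs_of_pos hu]

def cone : Set V := {p | 0 < p.1 ∧ -p.1 < p.2 ∧ p.2 ≤ p.1}

lemma cone_meas : MeasurableSet cone := by
  unfold cone
  exact (measurableSet_lt measurable_const measurable_fst).inter
    ((measurableSet_lt measurable_fst.neg measurable_snd).inter
      (measurableSet_le measurable_snd measurable_fst))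

lemma lint_cone {f : V → ℝ≥0∞} (hf : Measurable f) :
    ∫⁻ u in Ioi (0:ℝ), ENNReal.ofReal u * ∫⁻ s in Ioc (-1:ℝ) 1, f (u • ((1:ℝ), s)) =
    ∫⁻ p in cone, f p := by
  have h1 : ∫⁻ p in cone, f p = ∫⁻ x : ℝ, ∫⁻ y : ℝ, cone.indicator f (x, y) := by
    rw [← lintegral_indicator cone_meas, Measure.volume_eq_prod, lintegral_prod]
    exact (hf.indicator cone_meas).aemeasurable
  rw [h1, ← lintegral_indicator measurableSet_Ioi]
  congr 1
  ext u
  by_cases hu : 0 < u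
  · rw [indicator_of_mem (show u ∈ Ioi 0 from hu)]
    have := lint_scale hu (fun y => f (u, y)) (-1) 1
    simp only [Prod.smul_mk, smul_eq_mul, mul_one]
    rw [this, ← lintegral_indicator measurableSet_Ioc]
    congr 1
    ext y
    by_cases hy : y ∈ Ioc (u * -1) (u * 1)
    · rw [indicator_of_mem hy, indicator_of_mem]
      exact ⟨hu, by simpa using hy.1, by simpa using hy.2⟩
    · rw [indicator_of_notMem hy, indicator_of_notMem]
      rintro ⟨_, h2, h3⟩
      exact hy ⟨by simpa using h2, by simpa using h3⟩
  · rw [indicator_of_notMem (show u ∉ Ioi 0 from hu)]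
    symm
    rw [lintegral_eq_zero_iff']
    · refine Eventually.of_forall fun y => ?_
      simp only [Pi.zero_apply]
      apply indicator_of_notMem
      rintro ⟨h, _⟩; exact hu h
    · exact ((hf.indicator cone_meas).comp (measurable_const.prodMk measurable_id)).aemeasurable

/-- quarter turn -/
def qt : V ≃ᵐ V where
  toFun p := (-p.2, p.1)
  invFun p := (p.2, -p.1)
  left_inv p := by simp
  right_inv p := by simp
  measurable_toFun := by simp only [Equiv.coe_fn_mk]; fun_prop
  measurable_invFun := by simp only [Equiv.coe_fn_symm_mk]; fun_prop

lemma qt_mp : MeasurePreserving qt (volume : Measure V) volume := by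
  have h1 : MeasurePreserving (Prod.swap : V → V) volume volume := Measure.measurePreserving_swap
  have h2 : MeasurePreserving (fun p : V => (-p.1, p.2)) volume volume :=
    (Measure.measurePreserving_neg (volume : Measure ℝ)).prod (MeasurePreserving.id (volume : Measure ℝ))
  exact h2.comp h1

lemma qt_apply (p : V) : qt p = (-p.2, p.1) := rfl

lemma lint_V {f : V → ℝ≥0∞} (hf : Measurable f) :
    ∫⁻ u in Ioi (0:ℝ), ENNReal.ofReal u * ∫⁻ θ : Circ, f (u • sg θ) = ∫⁻ p, f p := by
  have hsg : ∀ u : ℝ, Measurable (fun s : ℝ => f (u • sg (s : Circ))) := fun u =>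
    hf.comp ((sg_cont.comp (AddCircle.continuous_mk' 8)).const_smul u).measurable
  have split : ∀ u : ℝ, ∫⁻ θ : Circ, f (u • sg θ) =
      (∫⁻ s in Ioc (-1:ℝ) 1, f (u • ((1:ℝ), s))) +
      (∫⁻ s in Ioc (-1:ℝ) 1, f (qt (u • ((1:ℝ), s)))) +
      (∫⁻ s in Ioc (-1:ℝ) 1, f (qt (qt (u • ((1:ℝ), s))))) +
      (∫⁻ s in Ioc (-1:ℝ) 1, f (qt (qt (qt (u • ((1:ℝ), s)))))) := by
    intro u
    have shift : ∀ (g : ℝ → ℝ≥0∞) (c : ℝ), ∫⁻ s in Ioc (c-1) (c+1), g s =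
        ∫⁻ s in Ioc (-1:ℝ) 1, g (s + c) := by
      intro g c
      rw [← lintegral_indicator measurableSet_Ioc, ← lintegral_indicator measurableSet_Ioc,
        ← lintegral_add_right_eq_self _ c]
      congr 1; ext s
      by_cases hs : s ∈ Ioc (-1:ℝ) 1
      · rw [indicator_of_mem hs, indicator_of_mem]
        exact ⟨by linarith [hs.1], by linarith [hs.2]⟩
      · rw [indicator_of_notMem hs, indicator_of_notMem]
        rintro ⟨h, h'⟩; exact hs ⟨by linarith, by linarith⟩
    rw [← AddCircle.lintegral_preimage 8 (-1) (fun θ => f (u • sg θ))]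
    have e1 : Ioc (-1:ℝ) (-1 + 8) = ((Ioc (-1) 1 ∪ Ioc 1 3) ∪ Ioc 3 5) ∪ Ioc 5 7 := by
      rw [Ioc_union_Ioc_eq_Ioc (by norm_num) (by norm_num),
        Ioc_union_Ioc_eq_Ioc (by norm_num) (by norm_num),
        Ioc_union_Ioc_eq_Ioc (by norm_num) (by norm_num)]
      norm_num
    rw [e1, lintegral_union measurableSet_Ioc, lintegral_union measurableSet_Ioc,
      lintegral_union measurableSet_Ioc]
    · congr 1
      · congr 1
        · congr 1
          · apply setLIntegral_congr_fun measurableSet_Ioc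
            intro s hs
            simp only [sg1 hs.1.le hs.2]
          · have := shift (fun s => f (u • sg (s : Circ))) 2
            norm_num at this
            rw [this]
            apply setLIntegral_congr_fun measurableSet_Ioc
            intro s hs
            have h3 := @sg2 (s + 2) (by linarith [hs.1]) (by linarith [hs.2])
            simp only [AddCircle.coe_add] at h3
            simp only [h3, qt_apply]
            congr 1; ext <;> simp
        · have := shift (fun s => f (u • sg (s : Circ))) 4
          norm_num at this
          rw [this]
          apply setLIntegral_congr_fun measurableSet_Ioc
          intro s hs
          have h3 := @sg3 (s + 4) (by linarith [hs.1]) (by linarith [hs.2])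
          simp only [AddCircle.coe_add] at h3
          simp only [h3, qt_apply]
          congr 1; ext <;> simp
      · have := shift (fun s => f (u • sg (s : Circ))) 6
        norm_num at this
        rw [this]
        apply setLIntegral_congr_fun measurableSet_Ioc
        intro s hs
        have h3 := @sg4 (s + 6) (by linarith [hs.1]) (by linarith [hs.2])
        simp only [AddCircle.coe_add] at h3
        simp only [h3, qt_apply]
        congr 1; ext <;> simp
    · rw [Set.disjoint_left]; rintro s hs ⟨h, h'⟩
      linarith [hs.2]
    · rw [Set.disjoint_left]; rintro s (hs | hs) ⟨h, h'⟩ <;> linarith [hs.2]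
    · rw [Set.disjoint_left]; rintro s ((hs | hs) | hs) ⟨h, h'⟩ <;> linarith [hs.2]
  have hq : ∀ g : V → ℝ≥0∞, Measurable g → ∀ c : Set V, MeasurableSet c →
      ∫⁻ p in c, g (qt p) = ∫⁻ p in qt.symm ⁻¹' c, g p := by
    intro g hg c hc
    have := (qt_mp.restrict_preimage (qt.symm.measurable hc))
    rw [← this.lintegral_comp hg]
    congr 2
    ext p; simp
  have m1 : Measurable (fun p => f (qt p)) := hf.comp qt.measurable
  have m2 : Measurable (fun p => f (qt (qt p))) := m1.comp qt.measurable
  have m3 : Measurable (fun p => f (qt (qt (qt p)))) := m2.comp qt.measurable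
  have ms : ∀ g : V → ℝ≥0∞, Measurable g → Measurable
      (fun u : ℝ => ENNReal.ofReal u * ∫⁻ s in Ioc (-1:ℝ) 1, g (u • ((1:ℝ), s))) := by
    intro g hg
    apply ENNReal.measurable_ofReal.mul
    apply Measurable.lintegral_prod_right'
      (f := fun q : ℝ × ℝ => g (q.1 • ((1:ℝ), q.2)))
    exact hg.comp (by fun_prop)
  simp_rw [split, mul_add]
  rw [lintegral_add_right _ (ms _ m3), lintegral_add_right _ (ms _ m2),
    lintegral_add_right _ (ms _ m1)]
  rw [lint_cone hf, lint_cone m1, lint_cone m2, lint_cone m3]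
  have c1 := qt.symm.measurable cone_meas
  have c2 := qt.symm.measurable c1
  have c3 := qt.symm.measurable c2
  rw [hq _ hf _ cone_meas, hq _ m1 _ cone_meas, hq _ hf _ c1, hq _ m2 _ cone_meas, hq _ m1 _ c1,
    hq _ hf _ c2]
  have s1 : ∀ p : V, qt.symm p = (p.2, -p.1) := fun p => rfl
  rw [← lintegral_union c1, ← lintegral_union c2, ← lintegral_union c3, ← setLIntegral_univ (f := f) (μ := volume)]
  · apply setLIntegral_congr
    refine ae_eq_set.2 ⟨?_, ?_⟩
    · rw [Set.diff_eq_empty.2 (subset_univ _)]; simp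
    · apply measure_mono_null (t := {(0:V)})
      · rintro ⟨x, y⟩ ⟨_, h⟩
        simp only [mem_union, mem_preimage, s1, cone, mem_ofPred_eq, neg_neg, not_or, not_and,
          not_lt, not_le] at h
        obtain ⟨⟨⟨h1, h2⟩, h3⟩, h4⟩ := h
        simp only [mem_singleton_iff, Prod.mk_eq_zero]
        have hx : x = 0 := by
          by_contra hx
          rcases lt_or_gt_of_ne hx with hx | hx <;> grind
        have hy : y = 0 := by
          by_contra hy
          rcases lt_or_gt_of_ne hy with hx | hx <;> grind
        exact ⟨hx, hy⟩
      · simp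
  all_goals
    rw [Set.disjoint_left]
    rintro ⟨x, y⟩ h
    simp only [mem_union, mem_preimage, s1, cone, mem_ofPred_eq, neg_neg] at h ⊢
    grind

lemma tw_mp {α : ℝ → ℝ} (hα : Continuous α) :
    MeasurePreserving (tw α) (volume : Measure V) volume := by
  refine ⟨(tw_cont hα).measurable, ?_⟩
  ext B hB
  rw [Measure.map_apply (tw_cont hα).measurable hB, ← lintegral_indicator_one hB,
    ← lintegral_indicator_one ((tw_cont hα).measurable hB)]
  have mB : Measurable (B.indicator (1 : V → ℝ≥0∞)) := measurable_one.indicator hB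
  have mB' : Measurable ((tw α ⁻¹' B).indicator (1 : V → ℝ≥0∞)) :=
    measurable_one.indicator ((tw_cont hα).measurable hB)
  rw [← lint_V mB, ← lint_V mB']
  apply setLIntegral_congr_fun measurableSet_Ioi
  intro u hu
  simp only
  congr 1
  symm
  rw [← lintegral_add_right_eq_self _ ((α u : ℝ) : Circ)]
  congr 1; ext θ
  rw [← tw_smul_sg α (le_of_lt hu)]
  rfl

end GS

namespace GS

/-- centers of cells -/
def zc (n : ℕ) (a : ℤ × ℤ) : V := ((a.1 + 1/2) / n, (a.2 + 1/2) / n)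
/-- half side -/
def hs (n : ℕ) : ℝ := 1 / (2 * n)
/-- cell index -/
def ci (n : ℕ) (x : V) : ℤ × ℤ := (⌊n * x.1⌋, ⌊n * x.2⌋)

lemma hs_pos {n : ℕ} (hn : 0 < n) : 0 < hs n := by unfold hs; positivity

lemma ci_dist {n : ℕ} (hn : 0 < n) (x : V) : dist x (zc n (ci n x)) ≤ hs n := by
  have hn' : (0:ℝ) < n := by exact_mod_cast hn
  have key : ∀ t : ℝ, |t - (⌊n * t⌋ + 1/2) / n| ≤ hs n := by
    intro t
    have h1 := Int.floor_le (n * t)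
    have h2 := Int.lt_floor_add_one (n * t)
    have e : t - (⌊n * t⌋ + 1/2) / n = (n * t - ⌊n * t⌋ - 1/2) / n := by field_simp; ring
    rw [e, abs_div, abs_of_pos hn', hs, div_le_div_iff₀ hn' (by positivity)]
    have : |n * t - ⌊n * t⌋ - 1/2| ≤ 1/2 := abs_le.2 ⟨by linarith, by linarith⟩
    nlinarith
  rw [Prod.dist_eq]
  simp only [Real.dist_eq, zc, ci]
  exact max_le (key _) (key _)

lemma ci_eq {n : ℕ} (hn : 0 < n) {x : V} {a : ℤ × ℤ} (h : dist x (zc n a) < hs n) :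
    ci n x = a := by
  have hn' : (0:ℝ) < n := by exact_mod_cast hn
  have key : ∀ (t : ℝ) (m : ℤ), |t - (m + 1/2) / n| < hs n → ⌊n * t⌋ = m := by
    intro t m h
    have e : t - (m + 1/2) / n = (n * t - m - 1/2) / n := by field_simp; ring
    rw [e, abs_div, abs_of_pos hn', hs, div_lt_div_iff₀ hn' (by positivity)] at h
    have : |n * t - m - 1/2| < 1/2 := by nlinarith
    rw [abs_lt] at this
    rw [Int.floor_eq_iff]
    constructor <;> linarith
  rw [Prod.dist_eq] at h
  simp only [Real.dist_eq, zc] at h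
  exact Prod.ext (key _ _ ((le_max_left _ _).trans_lt h)) (key _ _ ((le_max_right _ _).trans_lt h))

lemma zc_dist {n : ℕ} (hn : 0 < n) {a b : ℤ × ℤ} (h : a ≠ b) : 2 * hs n ≤ dist (zc n a) (zc n b) := by
  by_contra hlt
  push Not at hlt
  -- midpoint
  set m : V := (1/2 : ℝ) • (zc n a + zc n b) with hm
  have h1 : dist m (zc n a) < hs n := by
    rw [dist_eq_norm] at *
    have : m - zc n a = (-(1/2:ℝ)) • (zc n a - zc n b) := by rw [hm]; module
    rw [this, norm_smul]; norm_num; linarith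
  have h2 : dist m (zc n b) < hs n := by
    rw [dist_eq_norm] at *
    have : m - zc n b = ((1/2:ℝ)) • (zc n a - zc n b) := by rw [hm]; module
    rw [this, norm_smul]; norm_num; linarith
  exact h ((ci_eq hn h1).symm.trans (ci_eq hn h2))

/-- twist in all cells -/
def ph (n : ℕ) (α : ℝ → ℝ) (x : V) : V := zc n (ci n x) + tw α (x - zc n (ci n x))

/-- admissible twist functions -/
structure Adm (n : ℕ) (r : ℝ) (α : ℝ → ℝ) : Prop where
  npos : 0 < n
  rlt : r < hs n
  cont : Continuous α
  per : ∀ u, r ≤ u → ((α u : ℝ) : Circ) = 0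

lemma Adm.neg {n : ℕ} {r : ℝ} {α : ℝ → ℝ} (H : Adm n r α) : Adm n r (fun u => - α u) :=
  ⟨H.npos, H.rlt, H.cont.neg, fun u hu => by rw [AddCircle.coe_neg, H.per u hu, neg_zero]⟩

section
variable {n : ℕ} {r : ℝ} {α : ℝ → ℝ}

lemma Adm.self (H : Adm n r α) (a : ℤ × ℤ) {x : V} (h : r ≤ dist x (zc n a)) :
    zc n a + tw α (x - zc n a) = x := by
  rw [tw_eq_self]
  · abel
  · apply H.per; rwa [← dist_eq_norm]

lemma Adm.loc (H : Adm n r α) {a : ℤ × ℤ} {x y : V} (hx : dist x (zc n a) ≤ hs n)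
    (hy : dist y x < hs n - r) : ph n α y = zc n a + tw α (y - zc n a) := by
  by_cases hb : ci n y = a
  · rw [ph, hb]
  have h1 : hs n ≤ dist y (zc n a) := by
    by_contra h; exact hb (ci_eq H.npos (not_le.1 h))
  rw [H.self a (H.rlt.le.trans h1), ph, H.self]
  have h2 := zc_dist H.npos hb
  have h3 := dist_triangle (zc n (ci n y)) x (zc n a)
  have h4 := dist_triangle (zc n (ci n y)) y x
  rw [dist_comm y (zc n _)]
  linarith

lemma Adm.cell (H : Adm n r α) {a : ℤ × ℤ} {x : V} (hx : dist x (zc n a) ≤ hs n) :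
    ph n α x = zc n a + tw α (x - zc n a) :=
  H.loc hx (by rw [dist_self]; linarith [H.rlt])

lemma dist_tw (n : ℕ) (α : ℝ → ℝ) (a : ℤ × ℤ) (x : V) :
    dist (zc n a + tw α (x - zc n a)) (zc n a) = dist x (zc n a) := by
  rw [dist_eq_norm, add_sub_cancel_left, tw_norm, dist_eq_norm]

lemma Adm.dist_center (H : Adm n r α) {a : ℤ × ℤ} {x : V} (hx : dist x (zc n a) ≤ hs n) :
    dist (ph n α x) (zc n a) = dist x (zc n a) := by
  rw [H.cell hx, dist_tw]

lemma Adm.ci_ph (H : Adm n r α) (x : V) : ci n (ph n α x) = ci n x := by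
  rcases (ci_dist H.npos x).lt_or_eq with h | h
  · apply ci_eq H.npos; rwa [H.dist_center h.le]
  · rw [ph, H.self]; rw [h]; exact H.rlt.le

lemma Adm.cont_ph (H : Adm n r α) : Continuous (ph n α) := by
  rw [continuous_iff_continuousAt]
  intro x
  have h1 : ContinuousAt (fun y => zc n (ci n x) + tw α (y - zc n (ci n x))) x := by
    have := (tw_cont H.cont)
    fun_prop
  refine h1.congr ?_
  filter_upwards [ball_mem_nhds x (sub_pos.2 H.rlt)] with y hy
  exact (H.loc (ci_dist H.npos x) hy).symm

lemma Adm.inv_ph (H : Adm n r α) (x : V) : ph n (fun u => - α u) (ph n α x) = x := by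
  have : ph n (fun u => - α u) (ph n α x) =
    zc n (ci n x) + tw (fun u => - α u) (ph n α x - zc n (ci n x)) := by
    rw [ph, H.ci_ph]
  rw [this, ph, add_sub_cancel_left, tw_inv]; abel

/-- homeomorphism of the plane -/
def Adm.homeo (H : Adm n r α) : V ≃ₜ V where
  toFun := ph n α
  invFun := ph n (fun u => - α u)
  left_inv := H.inv_ph
  right_inv x := by
    have := H.neg.inv_ph x
    simpa using this
  continuous_toFun := H.cont_ph
  continuous_invFun := H.neg.cont_ph

lemma Adm.dist_ph (H : Adm n r α) (x : V) : dist (ph n α x) x ≤ 2 * hs n := by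
  have h1 := ci_dist H.npos x
  have h2 := H.dist_center h1
  have := dist_triangle_right (ph n α x) x (zc n (ci n x))
  linarith

/-- integer vector -/
def iv (w : ℤ × ℤ) : V := ((w.1 : ℝ), (w.2 : ℝ))

lemma ci_iv (n : ℕ) (x : V) (w : ℤ × ℤ) : ci n (x + iv w) = ci n x + n • w := by
  unfold ci iv
  ext
  · simp only [Prod.fst_add, mul_add, Prod.smul_fst]
    have : (n * w.1 : ℝ) = ((n * w.1 : ℤ) : ℝ) := by push_cast; ring
    rw [this, Int.floor_add_intCast]; simp
  · simp only [Prod.snd_add, mul_add, Prod.smul_snd]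
    have : (n * w.2 : ℝ) = ((n * w.2 : ℤ) : ℝ) := by push_cast; ring
    rw [this, Int.floor_add_intCast]; simp

lemma zc_iv {n : ℕ} (hn : 0 < n) (a w : ℤ × ℤ) : zc n (a + n • w) = zc n a + iv w := by
  have hn' : (n:ℝ) ≠ 0 := by exact_mod_cast hn.ne'
  unfold zc iv
  ext
  · simp; field_simp; ring
  · simp; field_simp; ring

lemma ph_iv {n : ℕ} (hn : 0 < n) (α : ℝ → ℝ) (x : V) (w : ℤ × ℤ) :
    ph n α (x + iv w) = ph n α x + iv w := by
  rw [ph, ph, ci_iv, zc_iv hn]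
  rw [add_sub_add_right_eq_sub]; abel

lemma ci_meas (n : ℕ) : Measurable (ci n) := by
  unfold ci; fun_prop

lemma Adm.mp (H : Adm n r α) : MeasurePreserving (ph n α) (volume : Measure V) volume := by
  refine ⟨H.cont_ph.measurable, ?_⟩
  have piece : ∀ (a : ℤ × ℤ) (B : Set V), MeasurableSet B →
      volume (ph n α ⁻¹' B ∩ ci n ⁻¹' {a}) = volume (B ∩ ci n ⁻¹' {a}) := by
    intro a B hB
    have hmp : MeasurePreserving (fun x : V => zc n a + tw α (x - zc n a)) volume volume :=
      (measurePreserving_add_left volume (zc n a)).comp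
        ((tw_mp H.cont).comp (measurePreserving_sub_right volume (zc n a)))
    have hm := hB.inter ((ci_meas n) (measurableSet_singleton a))
    rw [← hmp.measure_preimage hm.nullMeasurableSet]
    congr 1
    ext x
    simp only [mem_inter_iff, mem_preimage, mem_singleton_iff]
    constructor
    · rintro ⟨h1, h2⟩
      have e : ph n α x = zc n a + tw α (x - zc n a) := by rw [ph, h2]
      rw [← e, H.ci_ph]; exact ⟨h1, h2⟩
    · rintro ⟨h1, h2⟩
      have hd : dist x (zc n a) ≤ hs n := by
        rw [← dist_tw n α, ← h2]; rw [h2]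
        have := ci_dist H.npos (zc n a + tw α (x - zc n a))
        rwa [h2] at this
      refine ⟨by rw [H.cell hd]; exact h1, ?_⟩
      rw [← H.ci_ph, H.cell hd, h2]
  have sumf : ∀ B : Set V, MeasurableSet B → volume B = ∑' a, volume (B ∩ ci n ⁻¹' {a}) := by
    intro B hB
    rw [← measure_iUnion]
    · congr 1
      ext x; simp
    · intro a b hab
      rw [Function.onFun, Set.disjoint_left]
      rintro x ⟨_, h1⟩ ⟨_, h2⟩
      exact hab (h1.symm.trans h2)
    · intro a; exact hB.inter ((ci_meas n) (measurableSet_singleton a))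
  ext B hB
  rw [Measure.map_apply H.cont_ph.measurable hB, sumf _ (H.cont_ph.measurable hB), sumf _ hB]
  congr 1; ext a
  exact piece a B hB

end

end GS

namespace GS

lemma band_le {f : ℝ → ℝ} (hf : Continuous f) {x y A B : ℝ} (hxy : x ≤ y) (hAB : A ≤ B)
    (hx : f x ≤ A) (hy : B ≤ f y) :
    ∃ p q, x ≤ p ∧ p ≤ q ∧ q ≤ y ∧ (∀ t ∈ Icc p q, f t ∈ Icc A B) ∧ f p = A ∧ f q = B := by
  have c1 : IsCompact (Icc x y ∩ f ⁻¹' (Ici B)) :=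
    isCompact_Icc.inter_right (isClosed_Ici.preimage hf)
  obtain ⟨q, ⟨⟨hq1, hq2⟩, hq3⟩, hq4⟩ := c1.exists_isLeast ⟨y, ⟨hxy, le_rfl⟩, hy⟩
  have c2 : IsCompact (Icc x q ∩ f ⁻¹' (Iic A)) :=
    isCompact_Icc.inter_right (isClosed_Iic.preimage hf)
  obtain ⟨p, ⟨⟨hp1, hp2⟩, hp3⟩, hp4⟩ := c2.exists_isGreatest ⟨x, ⟨le_rfl, hq1⟩, hx⟩
  have hq3 : B ≤ f q := hq3
  have hp3 : f p ≤ A := hp3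
  have e1 : ∀ t ∈ Icc p q, f t ≤ B := by
    intro t ht
    by_contra hlt
    push Not at hlt
    obtain ⟨c, hc, hc'⟩ := intermediate_value_Icc ht.1 hf.continuousOn (show B ∈ Icc (f p) (f t) from ⟨by linarith, hlt.le⟩)
    have : q ≤ c := hq4 ⟨⟨by linarith [hc.1], by linarith [hc.2, ht.2]⟩, hc'.ge⟩
    have : c = t := le_antisymm hc.2 (ht.2.trans this)
    subst this; linarith
  have e2 : ∀ t ∈ Icc p q, A ≤ f t := by
    intro t ht
    by_contra hlt
    push Not at hlt
    have : t ≤ p := hp4 ⟨⟨by linarith [ht.1], ht.2⟩, hlt.le⟩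
    have e : t = p := le_antisymm this ht.1
    obtain ⟨c, hc, hc'⟩ := intermediate_value_Icc hp2 hf.continuousOn (show A ∈ Icc (f p) (f q) from ⟨by linarith, by linarith⟩)
    have : c ≤ p := hp4 ⟨⟨by linarith [hc.1], hc.2⟩, hc'.le⟩
    have : c = p := le_antisymm this hc.1
    subst this; subst e; linarith
  exact ⟨p, q, hp1, hp2, hq2, fun t ht => ⟨e2 t ht, e1 t ht⟩,
    le_antisymm hp3 (e2 p ⟨le_rfl, hp2⟩), le_antisymm (e1 q ⟨hp2, le_rfl⟩) hq3⟩

lemma band {f : ℝ → ℝ} (hf : Continuous f) {t0 t1 x y A B : ℝ} (hx0 : x ∈ Icc t0 t1)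
    (hy0 : y ∈ Icc t0 t1) (hAB : A ≤ B) (hx : f x ≤ A) (hy : B ≤ f y) :
    ∃ p q, t0 ≤ p ∧ p ≤ q ∧ q ≤ t1 ∧ (∀ t ∈ Icc p q, f t ∈ Icc A B) ∧
      ((f p = A ∧ f q = B) ∨ (f p = B ∧ f q = A)) := by
  rcases le_total x y with h | h
  · obtain ⟨p, q, h1, h2, h3, h4, h5⟩ := band_le hf h hAB hx hy
    exact ⟨p, q, hx0.1.trans h1, h2, h3.trans hy0.2, h4, Or.inl h5⟩
  · have hn : Continuous fun t => - f t := hf.neg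
    obtain ⟨p, q, h1, h2, h3, h4, h5, h6⟩ := band_le hn h (neg_le_neg hAB) (neg_le_neg hy) (neg_le_neg hx)
    refine ⟨p, q, hy0.1.trans h1, h2, h3.trans hx0.2, fun t ht => ?_, Or.inr ⟨by linarith, by linarith⟩⟩
    have := h4 t ht
    exact ⟨by linarith [this.2], by linarith [this.1]⟩

lemma lift_circ {X : Type*} [TopologicalSpace X] [SimplyConnectedSpace X] [LocallyPathConnectedSpace X]
    {g : X → Circ} (hg : Continuous g) : ∃ s : X → ℝ, Continuous s ∧ ∀ x, ((s x : ℝ) : Circ) = g x := by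
  obtain ⟨x0⟩ : Nonempty X := inferInstance
  obtain ⟨e0, he⟩ := QuotientAddGroup.mk_surjective (g x0)
  obtain ⟨F, hF, -⟩ := (AddCircle.isCoveringMap_coe (8:ℝ)).existsUnique_continuousMap_lifts ⟨g, hg⟩ x0 e0 he
  exact ⟨F, F.continuous, fun x => congrFun hF.2 x⟩

lemma circ8 (k : ℤ) (x : ℝ) : ((x + 8 * k : ℝ) : Circ) = (x : Circ) := by
  rw [AddCircle.coe_add]
  have : ((8 * k : ℝ) : Circ) = 0 := by
    rw [AddCircle.coe_eq_zero_iff]; exact ⟨k, by simp [mul_comm]⟩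
  rw [this, add_zero]

lemma near_int {x : ℝ} (h : ‖(x : Circ)‖ < 1) : ∃ k : ℤ, |x - 8 * k| < 1 := by
  rw [AddCircle.norm_eq] at h
  exact ⟨_, by rwa [mul_comm] at h⟩

lemma stay {D : ℝ → ℝ} {p q : ℝ} (hpq : p ≤ q) (hD : Continuous D)
    (h : ∀ t ∈ Icc p q, ‖((D t : ℝ) : Circ)‖ < 1) : |D q - D p| < 2 := by
  obtain ⟨k, hk⟩ := near_int (h p ⟨le_rfl, hpq⟩)
  obtain ⟨m, hm⟩ := near_int (h q ⟨hpq, le_rfl⟩)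
  have n4 : ∀ j : ℤ, ‖((4 + 8 * j : ℝ) : Circ)‖ = 4 := by
    intro j; rw [circ8, norm_circ] <;> norm_num
  rw [abs_lt] at hk hm
  have key : ∀ c : ℝ, c ∈ uIcc (D p) (D q) → ‖(c:Circ)‖ < 1 := by
    intro c hc
    obtain ⟨t, ht, rfl⟩ := intermediate_value_uIcc (hD.continuousOn (s := uIcc p q)) hc
    rw [uIcc_of_le hpq] at ht
    exact h t ht
  rcases lt_trichotomy k m with hkm | hkm | hkm
  · have hkm' : (k:ℝ) + 1 ≤ m := by exact_mod_cast hkm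
    have := key (4 + 8 * k) (mem_uIcc_of_le (by linarith) (by linarith))
    rw [n4] at this; linarith
  · subst hkm; rw [abs_lt]; constructor <;> linarith
  · have hkm' : (m:ℝ) + 1 ≤ k := by exact_mod_cast hkm
    have := key (4 + 8 * m) (mem_uIcc_of_ge (by linarith) (by linarith))
    rw [n4] at this; linarith

lemma path_lift {γ : ℝ → V} (hγ : Continuous γ) {p q : ℝ} (hpq : p ≤ q)
    (h : ∀ t ∈ Icc p q, γ t ≠ 0) :
    ∃ s : ℝ → ℝ, Continuous s ∧ ∀ t ∈ Icc p q, ((s t : ℝ) : Circ) = ang (γ t) := by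
  have hc : Continuous fun t => ang (γ (projIcc p q hpq t)) :=
    ang_contOn.comp_continuous (by fun_prop) (fun t => h _ (projIcc p q hpq t).2)
  obtain ⟨s, hs, hs'⟩ := lift_circ hc
  refine ⟨s, hs, fun t ht => ?_⟩
  rw [hs', projIcc_of_mem hpq ht]

/-- periodic maps -/
def Per (F : V → V) : Prop := ∀ x w, F (x + iv w) = F x + iv w

lemma iv_floor (x : V) : ∃ w : ℤ × ℤ, ∃ y : V, x = y + iv w ∧ ‖y‖ ≤ 1 := by
  refine ⟨(⌊x.1⌋, ⌊x.2⌋), (Int.fract x.1, Int.fract x.2), ?_, ?_⟩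
  · ext <;> simp [iv]
  · rw [Prod.norm_def]
    simp only [Real.norm_eq_abs, Int.abs_fract]
    exact max_le (Int.fract_lt_one _).le (Int.fract_lt_one _).le

lemma Per.uc {F : V → V} (hp : Per F) (hF : Continuous F) {ε : ℝ} (hε : 0 < ε) :
    ∃ δ > 0, ∀ x y, dist x y < δ → dist (F x) (F y) < ε := by
  have := (isCompact_closedBall (0:V) 2).uniformContinuousOn_of_continuous hF.continuousOn
  rw [Metric.uniformContinuousOn_iff] at this
  obtain ⟨δ, hδ, h⟩ := this ε hε
  refine ⟨min δ 1, by positivity, fun x y hxy => ?_⟩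
  obtain ⟨w, x', rfl, hx'⟩ := iv_floor x
  obtain ⟨y', rfl⟩ : ∃ y', y = y' + iv w := ⟨y - iv w, by abel⟩
  rw [hp, hp, dist_add_right]
  rw [dist_add_right] at hxy
  apply h
  · simp; linarith
  · have h3 := hxy.trans_le (min_le_right _ _)
    simp only [mem_closedBall]
    have := dist_triangle_left y' 0 x'
    rw [dist_zero_right x'] at this
    linarith
  · exact hxy.trans_le (min_le_left _ _)

lemma Per.bdd {F : V → V} (hp : Per F) (hF : Continuous F) : ∃ B, ∀ x, dist (F x) x ≤ B := by
  obtain ⟨B, hB⟩ := (isCompact_closedBall (0:V) 1).bddAbove_image (f := fun x => dist (F x) x) (by fun_prop)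
  refine ⟨B, fun x => ?_⟩
  obtain ⟨w, x', rfl, hx'⟩ := iv_floor x
  rw [hp, dist_add_right]
  exact hB ⟨x', by simpa using hx', rfl⟩

lemma unif {n : ℕ} (hn : 0 < n) (P : ℤ × ℤ → ℤ × ℤ → ℝ → Prop)
    (mono : ∀ a b ε ε', 0 < ε' → ε' ≤ ε → P a b ε → P a b ε')
    (inv : ∀ a b w ε, P a b ε → P (a + n • w) (b + n • w) ε)
    (ex : ∀ a b, ∃ ε > 0, P a b ε)
    (R : ℝ) (far : ∀ a b, R < dist (zc n a) (zc n b) → P a b 1) : ∃ ε > 0, ∀ a b, P a b ε := by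
  have hn' : (0:ℝ) < n := by exact_mod_cast hn
  obtain ⟨K, hK⟩ := exists_nat_gt (n * (|R| + 1) + 2 * n + 2)
  have hfin : (Icc ((-K:ℤ), (-K:ℤ)) ((K:ℤ), (K:ℤ))).Finite := Set.finite_Icc _ _
  have key : ∀ᶠ ε in 𝓝[>] (0:ℝ), ∀ a ∈ Icc ((-K:ℤ), (-K:ℤ)) ((K:ℤ), (K:ℤ)),
      ∀ b ∈ Icc ((-K:ℤ), (-K:ℤ)) ((K:ℤ), (K:ℤ)), P a b ε := by
    rw [eventually_all_finite hfin]; intro a _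
    rw [eventually_all_finite hfin]; intro b _
    obtain ⟨ε, hε, h⟩ := ex a b
    filter_upwards [Ioc_mem_nhdsGT hε] with e he
    exact mono a b ε e he.1 he.2 h
  obtain ⟨ε, hε, h0, h1⟩ := (key.and (Ioc_mem_nhdsGT (zero_lt_one))).exists
  refine ⟨ε, h0, fun a b => ?_⟩
  obtain ⟨a', w, rfl, ha1, ha2⟩ : ∃ a' w : ℤ × ℤ, a = a' + n • w ∧ (0 ≤ a'.1 ∧ 0 ≤ a'.2) ∧ (a'.1 < n ∧ a'.2 < n) := by
    refine ⟨(a.1 % n, a.2 % n), (a.1 / n, a.2 / n), ?_, ⟨?_, ?_⟩, ?_, ?_⟩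
    · ext
      · simp [Int.emod_add_mul_ediv]
      · simp [Int.emod_add_mul_ediv]
    · exact Int.emod_nonneg _ (by omega)
    · exact Int.emod_nonneg _ (by omega)
    · exact Int.emod_lt_of_pos _ (by omega)
    · exact Int.emod_lt_of_pos _ (by omega)
  obtain ⟨b', rfl⟩ : ∃ b', b = b' + n • w := ⟨b - n • w, by abel⟩
  apply inv
  by_cases hfar : R < dist (zc n a') (zc n b')
  · exact mono _ _ 1 _ h0 h1 (far _ _ hfar)
  push Not at hfar
  have hK2 : (n:ℝ) < K := by
    have : (0:ℝ) ≤ n * (|R| + 1) := by positivity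
    linarith
  have hK3 : n < K := by exact_mod_cast hK2
  apply hε
  · constructor <;> constructor <;> simp <;> omega
  · have e1 : ∀ p q : ℤ, 0 ≤ p → p < n → |((p:ℝ) + 1/2)/n - (q+1/2)/n| ≤ R → -(K:ℤ) ≤ q ∧ q ≤ K := by
      intro p q hp hp' h
      have e : ((p:ℝ) + 1/2)/n - (q+1/2)/n = (p - q)/n := by field_simp; ring
      rw [e, abs_div, abs_of_pos hn', div_le_iff₀ hn'] at h
      have hp0 : (0:ℝ) ≤ p := by exact_mod_cast hp
      have hp1 : (p:ℝ) < n := by exact_mod_cast hp'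
      rw [abs_le] at h
      have : R * n ≤ |R| * n := by gcongr; exact le_abs_self R
      constructor
      · have : -(K:ℝ) ≤ q := by nlinarith
        exact_mod_cast this
      · have : (q:ℝ) ≤ K := by nlinarith
        exact_mod_cast this
    rw [Prod.dist_eq] at hfar
    simp only [Real.dist_eq, zc] at hfar
    have f1 := e1 _ _ ha1.1 ha2.1 ((le_max_left _ _).trans hfar)
    have f2 := e1 _ _ ha1.2 ha2.2 ((le_max_right _ _).trans hfar)
    exact ⟨⟨f1.1, f2.1⟩, ⟨f1.2, f2.2⟩⟩

end GS

namespace GS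

/-- a piece of curve winding twice in the annulus of cell `a` -/
def Good (n : ℕ) (r1 r2 : ℝ) (a : ℤ × ℤ) (c : ℝ → V) (p q : ℝ) : Prop :=
  p ≤ q ∧ ∃ s : ℝ → ℝ, Continuous s ∧
    (∀ t ∈ Icc p q, ‖c t - zc n a‖ ∈ Icc r1 r2 ∧ ((s t : ℝ) : Circ) = ang (c t - zc n a)) ∧
    16 ≤ |s q - s p|

lemma Good.shift {n : ℕ} {r1 r2 : ℝ} {a : ℤ × ℤ} {c : ℝ → V} {p q : ℝ} (h : Good n r1 r2 a c p q) :
    ∃ s : ℝ → ℝ, Continuous s ∧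
    (∀ t ∈ Icc p q, ‖c t - zc n a‖ ∈ Icc r1 r2 ∧ ((s t : ℝ) : Circ) = ang (c t - zc n a)) ∧
    ∃ x ∈ Icc p q, ∃ y ∈ Icc p q, s x ≤ 0 ∧ 8 ≤ s y := by
  obtain ⟨hpq, s, hs, h1, h2⟩ := h
  set m := min (s p) (s q)
  set k : ℤ := ⌈m / 8⌉
  have hk1 : m / 8 ≤ k := Int.le_ceil _
  have hk2 : (k:ℝ) < m / 8 + 1 := Int.ceil_lt_add_one _
  refine ⟨fun t => s t - 8 * k, by fun_prop, fun t ht => ⟨(h1 t ht).1, ?_⟩, ?_⟩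
  · rw [← (h1 t ht).2]
    have := circ8 (-k) (s t)
    rw [← this]; congr 1; push_cast; ring
  · have hp : p ∈ Icc p q := ⟨le_rfl, hpq⟩
    have hq : q ∈ Icc p q := ⟨hpq, le_rfl⟩
    rcases le_total (s p) (s q) with h | h
    · have hm : m = s p := min_eq_left h
      rw [abs_of_nonneg (by linarith)] at h2
      exact ⟨p, hp, q, hq, by simp only; linarith, by simp only; linarith⟩
    · have hm : m = s q := min_eq_right h
      rw [abs_of_nonpos (by linarith)] at h2
      exact ⟨q, hq, p, hp, by simp only; linarith, by simp only; linarith⟩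

lemma step {n : ℕ} {r1 r2 κ η M N : ℝ} {α : ℝ → ℝ} {a b : ℤ × ℤ} {F Gh : V → V}
    (hr1 : 0 < r1) (hr12 : r1 ≤ r2) (hr2 : r2 ≤ hs n) (HA : Adm n r2 α)
    (hα1 : α r1 = 0) (hα2 : α r2 = N) (hN : M + M + 18 ≤ N)
    (hκη : η ≤ κ)
    (hη : ∀ x y : V, κ ≤ ‖x‖ → y ≠ 0 → dist x y < η → ‖ang x - ang y‖ < 1)
    (hGc : Continuous Gh) (hG : ∀ x, dist (Gh x) (F x) < η)
    (K1 : ∀ u ∈ Icc r1 r2, ∀ s : ℝ, κ ≤ ‖F (zc n a + u • sg s) - zc n b‖)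
    {su sv : ℝ} (hsu : su ∈ Icc (0:ℝ) 8) (hsv : sv ∈ Icc (0:ℝ) 8)
    (K2 : ∀ u ∈ Icc r1 r2, ‖F (zc n a + u • sg su) - zc n b‖ ≤ r1 - η)
    (K3 : ∀ u ∈ Icc r1 r2, r2 + η ≤ ‖F (zc n a + u • sg sv) - zc n b‖)
    {S : ℝ × ℝ → ℝ} (hS : Continuous S)
    (hS1 : ∀ u ∈ Icc r1 r2, ∀ s : ℝ, ((S (u, s) : ℝ) : Circ) = ang (F (zc n a + u • sg s) - zc n b))
    (hSM : ∀ u ∈ Icc r1 r2, ∀ s ∈ Icc (0:ℝ) 8, |S (u, s)| ≤ M)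
    {c : ℝ → V} (hc : Continuous c) {p q : ℝ} (hgood : Good n r1 r2 a c p q) :
    ∃ p' q', p ≤ p' ∧ q' ≤ q ∧ Good n r1 r2 b (fun t => ph n α (Gh (c t))) p' q' := by
  obtain ⟨s, hs, h1, x, hx, y, hy, hsx, hsy⟩ := hgood.shift
  -- representation of the curve
  have hrep : ∀ t ∈ Icc p q, c t = zc n a + ‖c t - zc n a‖ • sg (s t) := by
    intro t ht
    rw [(h1 t ht).2, smul_sg_ang]; abel
  -- first restriction
  obtain ⟨p1, q1, hp1, hpq1, hq1, hb, hpts⟩ : ∃ p1 q1, p ≤ p1 ∧ p1 ≤ q1 ∧ q1 ≤ q ∧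
      (∀ t ∈ Icc p1 q1, s t ∈ Icc (0:ℝ) 8) ∧
      ∃ x ∈ Icc p1 q1, ∃ y ∈ Icc p1 q1, s x = su ∧ s y = sv := by
    rcases le_total su sv with h | h
    · obtain ⟨p1, q1, e1, e2, e3, e4, e5⟩ := band hs hx hy h (hsx.trans hsu.1) (hsv.2.trans hsy)
      refine ⟨p1, q1, e1, e2, e3, fun t ht => ⟨hsu.1.trans (e4 t ht).1, (e4 t ht).2.trans hsv.2⟩, ?_⟩
      rcases e5 with e5 | e5
      · exact ⟨p1, ⟨le_rfl, e2⟩, q1, ⟨e2, le_rfl⟩, e5⟩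
      · exact ⟨q1, ⟨e2, le_rfl⟩, p1, ⟨le_rfl, e2⟩, e5.2, e5.1⟩
    · obtain ⟨p1, q1, e1, e2, e3, e4, e5⟩ := band hs hx hy h (hsx.trans hsv.1) (hsu.2.trans hsy)
      refine ⟨p1, q1, e1, e2, e3, fun t ht => ⟨hsv.1.trans (e4 t ht).1, (e4 t ht).2.trans hsu.2⟩, ?_⟩
      rcases e5 with e5 | e5
      · exact ⟨q1, ⟨e2, le_rfl⟩, p1, ⟨le_rfl, e2⟩, e5.2, e5.1⟩
      · exact ⟨p1, ⟨le_rfl, e2⟩, q1, ⟨e2, le_rfl⟩, e5⟩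
  obtain ⟨x', hx', y', hy', hsx', hsy'⟩ := hpts
  have sub1 : ∀ t ∈ Icc p1 q1, t ∈ Icc p q := fun t ht => ⟨hp1.trans ht.1, ht.2.trans hq1⟩
  -- second restriction
  have hd : Continuous fun t => ‖Gh (c t) - zc n b‖ := by fun_prop
  have dG : ∀ z, ‖Gh z - zc n b‖ ≤ ‖F z - zc n b‖ + η ∧ ‖F z - zc n b‖ ≤ ‖Gh z - zc n b‖ + η := by
    intro z
    have := (hG z).le
    rw [dist_eq_norm] at this
    have e := abs_le.1 ((abs_norm_sub_norm_le (Gh z - zc n b) (F z - zc n b)).trans (by simpa using this))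
    constructor <;> linarith [e.1, e.2]
  have v1 : ‖Gh (c x') - zc n b‖ ≤ r1 := by
    have e := hrep x' (sub1 _ hx')
    have := K2 _ (h1 x' (sub1 _ hx')).1
    rw [← hsx', ← e] at this
    linarith [(dG (c x')).1]
  have v2 : r2 ≤ ‖Gh (c y') - zc n b‖ := by
    have e := hrep y' (sub1 _ hy')
    have := K3 _ (h1 y' (sub1 _ hy')).1
    rw [← hsy', ← e] at this
    linarith [(dG (c y')).2]
  obtain ⟨p2, q2, hp2, hpq2, hq2, hb2, hends⟩ := band hd hx' hy' hr12 v1 v2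
  have sub2 : ∀ t ∈ Icc p2 q2, t ∈ Icc p1 q1 := fun t ht => ⟨hp2.trans ht.1, ht.2.trans hq2⟩
  have nz : ∀ t ∈ Icc p2 q2, Gh (c t) - zc n b ≠ 0 := by
    intro t ht h0
    have := (hb2 t ht).1
    simp only [h0, norm_zero] at this; linarith
  obtain ⟨s2, hs2, hs2'⟩ := path_lift (γ := fun t => Gh (c t) - zc n b) (by fun_prop) hpq2 nz
  have hst := stay (D := fun t => S (‖c t - zc n a‖, s t) - s2 t) hpq2 (by fun_prop) (by
    intro t ht
    have ht' := sub1 _ (sub2 _ ht)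
    have e := hrep t ht'
    have hu := (h1 t ht').1
    simp only [AddCircle.coe_sub]
    rw [hs2' t ht, hS1 _ hu, ← e]
    apply hη _ _ _ (nz t ht)
    · rw [dist_sub_right, dist_comm]; exact hG _
    · have := K1 _ hu (s t)
      rwa [← e] at this)
  have hp2m : p2 ∈ Icc p2 q2 := ⟨le_rfl, hpq2⟩
  have hq2m : q2 ∈ Icc p2 q2 := ⟨hpq2, le_rfl⟩
  have S1 := abs_le.1 (hSM _ (h1 p2 (sub1 _ (sub2 _ hp2m))).1 _ (hb _ (sub2 _ hp2m)))
  have S2 := abs_le.1 (hSM _ (h1 q2 (sub1 _ (sub2 _ hq2m))).1 _ (hb _ (sub2 _ hq2m)))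
  have hst := abs_lt.1 hst
  have hαc := HA.cont
  refine ⟨p2, q2, hp1.trans hp2, hq2.trans hq1, hpq2, fun t => s2 t + α ‖Gh (c t) - zc n b‖, by fun_prop, ?_, ?_⟩
  · intro t ht
    have hdt := hb2 t ht
    have e : ph n α (Gh (c t)) = zc n b + tw α (Gh (c t) - zc n b) :=
      HA.cell (by rw [dist_eq_norm]; exact hdt.2.trans hr2)
    beta_reduce
    rw [e, add_sub_cancel_left, tw_norm]
    refine ⟨hdt, ?_⟩
    rw [AddCircle.coe_add, hs2' t ht, tw, ang_smul_sg]
    exact hr1.trans_le hdt.1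
  · simp only
    rcases hends with ⟨e1, e2⟩ | ⟨e1, e2⟩
    · rw [e1, e2, hα1, hα2]
      refine le_trans ?_ (le_abs_self _)
      linarith [S1.1, S1.2, S2.1, S2.2, hst.1, hst.2]
    · rw [e1, e2, hα1, hα2]
      refine le_trans ?_ (neg_le_abs _)
      linarith [S1.1, S1.2, S2.1, S2.2, hst.1, hst.2]

lemma nested {n : ℕ} {r1 r2 : ℝ} (hr1 : 0 < r1) (hr12 : r1 ≤ r2) {G : V → V} (hG : Continuous G)
    (a : ℕ → ℤ × ℤ)
    (hstep : ∀ i (c : ℝ → V), Continuous c → ∀ p q, Good n r1 r2 (a i) c p q →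
      ∃ p' q', p ≤ p' ∧ q' ≤ q ∧ Good n r1 r2 (a (i+1)) (fun t => G (c t)) p' q') :
    ∃ z : V, ∀ i, dist (G^[i] z) (zc n (a i)) ≤ r2 := by
  set c0 : ℝ → V := fun t => zc n (a 0) + r1 • sg ((16 * t : ℝ) : Circ) with hc0
  have hc0c : Continuous c0 := by
    have := sg_cont
    have h2 : Continuous fun t : ℝ => ((16 * t : ℝ) : Circ) :=
      (AddCircle.continuous_mk' (8:ℝ)).comp (by fun_prop)
    fun_prop
  have g0 : Good n r1 r2 (a 0) c0 0 1 := by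
    refine ⟨zero_le_one, fun t => 16 * t, by fun_prop, fun t _ => ?_, by norm_num⟩
    simp only [hc0, add_sub_cancel_left]
    rw [norm_smul_sg hr1.le, ang_smul_sg hr1]
    exact ⟨⟨le_rfl, hr12⟩, rfl⟩
  have cc : ∀ i, Continuous fun t => G^[i] (c0 t) := fun i => (hG.iterate i).comp hc0c
  choose! P Q h1 h2 h3 using hstep
  let seq : (i : ℕ) → {x : ℝ × ℝ // Good n r1 r2 (a i) (fun t => G^[i] (c0 t)) x.1 x.2} := fun i =>
    Nat.rec (motive := fun i => {x : ℝ × ℝ // Good n r1 r2 (a i) (fun t => G^[i] (c0 t)) x.1 x.2})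
      ⟨(0, 1), g0⟩ (fun i x => ⟨(P i (fun t => G^[i] (c0 t)) x.1.1 x.1.2, Q i (fun t => G^[i] (c0 t)) x.1.1 x.1.2), by
        have := h3 i _ (cc i) _ _ x.2
        simpa only [Function.iterate_succ_apply'] using this⟩) i
  have hsub : ∀ i, Icc (seq (i+1)).1.1 (seq (i+1)).1.2 ⊆ Icc (seq i).1.1 (seq i).1.2 := fun i =>
    Icc_subset_Icc (h1 i _ (cc i) _ _ (seq i).2) (h2 i _ (cc i) _ _ (seq i).2)
  obtain ⟨t, ht⟩ := IsCompact.nonempty_iInter_of_sequence_nonempty_isCompact_isClosed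
    (fun i => Icc (seq i).1.1 (seq i).1.2) hsub (fun i => nonempty_Icc.2 (seq i).2.1)
    isCompact_Icc (fun i => isClosed_Icc)
  rw [mem_iInter] at ht
  refine ⟨c0 t, fun i => ?_⟩
  obtain ⟨-, s, -, h, -⟩ := (seq i).2
  rw [dist_eq_norm]
  exact (h t (ht i)).1.2

/-- linked cells -/
def Linked (n : ℕ) (F : V → V) (a b : ℤ × ℤ) : Prop :=
  ∃ x, dist x (zc n a) ≤ hs n ∧ dist (F x) (zc n b) ≤ hs n

/-- genericity -/
structure Gen (n : ℕ) (F : V → V) : Prop where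
  lt : ∀ a b, Linked n F a b → ∃ x, dist x (zc n a) = hs n ∧ dist (F x) (zc n b) < hs n
  gt : ∀ a b, Linked n F a b → ∃ x, dist x (zc n a) = hs n ∧ hs n < dist (F x) (zc n b)
  ne : ∀ a b x, dist x (zc n a) = hs n → F x ≠ zc n b

lemma sphere_rep {n : ℕ} {a : ℤ × ℤ} {x : V} (hx : dist x (zc n a) = hs n) :
    ∃ s : ℝ, s ∈ Icc (0:ℝ) 8 ∧ x = zc n a + hs n • sg s := by
  have h := smul_sg_ang (x - zc n a)
  rw [← dist_eq_norm, hx] at h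
  obtain ⟨s, h1, h2, h3⟩ := circ_rep (ang (x - zc n a))
  by_cases hs0 : 0 ≤ s
  · exact ⟨s, ⟨hs0, by linarith⟩, by rw [h3, h]; abel⟩
  · refine ⟨s + 8 * (1:ℤ), ⟨by push_cast; linarith, by push_cast; linarith⟩, ?_⟩
    rw [circ8, h3, h]; abel

lemma Linked.iv_add {n : ℕ} (hn : 0 < n) {F : V → V} (hp : Per F) {a b : ℤ × ℤ} (w : ℤ × ℤ) (h : Linked n F a b) :
    Linked n F (a + n • w) (b + n • w) := by
  obtain ⟨x, h1, h2⟩ := h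
  refine ⟨x + iv w, ?_, ?_⟩
  · rwa [zc_iv hn, dist_add_right]
  · rwa [hp, zc_iv hn, dist_add_right]

lemma Linked.iv_iff {n : ℕ} (hn : 0 < n) {F : V → V} (hp : Per F) {a b : ℤ × ℤ} (w : ℤ × ℤ) :
    Linked n F (a + n • w) (b + n • w) ↔ Linked n F a b := by
  refine ⟨fun h => ?_, fun h => h.iv_add hn hp w⟩
  have := h.iv_add hn hp (-w)
  simpa [add_assoc] using this

lemma F_iv {n : ℕ} (hn : 0 < n) {F : V → V} (hp : Per F) (a b w : ℤ × ℤ) (v : V) :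
    F (zc n (a + n • w) + v) - zc n (b + n • w) = F (zc n a + v) - zc n b := by
  rw [zc_iv hn, zc_iv hn, add_right_comm, hp]; abel

end GS

namespace GS

/-- quantitative genericity for a pair -/
def QP (n : ℕ) (F : V → V) (a b : ℤ × ℤ) (ε : ℝ) : Prop :=
  (∀ x y, dist x (zc n a) ≤ hs n → dist y (zc n b) ≤ hs n → dist (F x) y < ε → Linked n F a b) ∧
  (Linked n F a b →
    (∃ s ∈ Icc (0:ℝ) 8, ‖F (zc n a + hs n • sg (s:ℝ)) - zc n b‖ ≤ hs n - ε) ∧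
    (∃ s ∈ Icc (0:ℝ) 8, hs n + ε ≤ ‖F (zc n a + hs n • sg (s:ℝ)) - zc n b‖) ∧
    (∀ s : ℝ, ε ≤ ‖F (zc n a + hs n • sg (s:ℝ)) - zc n b‖))

lemma QP_ex {n : ℕ} (hn : 0 < n) {F : V → V} (hF : Continuous F) (hg : Gen n F) (a b : ℤ × ℤ) :
    ∃ ε > 0, QP n F a b ε := by
  by_cases hl : Linked n F a b
  · obtain ⟨x, hx, hx'⟩ := hg.lt a b hl
    obtain ⟨y, hy, hy'⟩ := hg.gt a b hl
    obtain ⟨s, hsm, rfl⟩ := sphere_rep hx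
    obtain ⟨s', hs', rfl⟩ := sphere_rep hy
    have hc : Continuous fun θ : Circ => ‖F (zc n a + hs n • sg θ) - zc n b‖ := by
      have := sg_cont; fun_prop
    obtain ⟨θ, -, hθ⟩ := isCompact_univ.exists_isMinOn (univ_nonempty) hc.continuousOn
    have hpos : 0 < ‖F (zc n a + hs n • sg θ) - zc n b‖ := by
      rw [norm_pos_iff, sub_ne_zero]
      apply hg.ne a
      rw [dist_eq_norm, add_sub_cancel_left, norm_smul_sg (hs_pos hn).le]
    rw [dist_eq_norm] at hx' hy'
    set A := ‖F (zc n a + hs n • sg θ) - zc n b‖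
    set B := ‖F (zc n a + hs n • sg (s:ℝ)) - zc n b‖ with hB
    set C := ‖F (zc n a + hs n • sg (s':ℝ)) - zc n b‖ with hC
    refine ⟨min A (min (hs n - B) (C - hs n)), by
      refine lt_min hpos (lt_min (by linarith) (by linarith)), fun _ _ _ _ _ => hl, fun _ => ⟨⟨s, hsm, ?_⟩, ⟨s', hs', ?_⟩, fun t => ?_⟩⟩
    · rw [← hB]
      have : min A (min (hs n - B) (C - hs n)) ≤ hs n - B := (min_le_right _ _).trans (min_le_left _ _)
      linarith
    · rw [← hC]
      have : min A (min (hs n - B) (C - hs n)) ≤ C - hs n := (min_le_right _ _).trans (min_le_right _ _)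
      linarith
    · exact (min_le_left _ _).trans (hθ (mem_univ (t:Circ)))
  · have hc : Continuous fun z : V × V => dist (F z.1) z.2 := by fun_prop
    have hne : ∀ a, (closedBall (zc n a) (hs n)).Nonempty := fun a =>
      ⟨zc n a, mem_closedBall_self (hs_pos hn).le⟩
    obtain ⟨z, hz, hm⟩ := ((isCompact_closedBall (zc n a) (hs n)).prod
      (isCompact_closedBall (zc n b) (hs n))).exists_isMinOn ((hne a).prod (hne b)) hc.continuousOn
    refine ⟨dist (F z.1) z.2, ?_, fun x y hx hy h => ?_, fun h => (hl h).elim⟩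
    · rw [gt_iff_lt, dist_pos]
      intro h
      exact hl ⟨z.1, hz.1, by rw [h]; exact hz.2⟩
    · exact absurd (hm (show (x, y) ∈ _ from ⟨hx, hy⟩)) (not_le.2 h)

lemma QP_unif {n : ℕ} (hn : 0 < n) {F : V → V} (hF : Continuous F) (hp : Per F) (hg : Gen n F) :
    ∃ ε > 0, ∀ a b, QP n F a b ε := by
  obtain ⟨B, hB⟩ := hp.bdd hF
  refine unif hn (QP n F) ?_ ?_ (QP_ex hn hF hg) (2 * hs n + B + 1) ?_
  · rintro a b ε ε' h0 h1 ⟨q1, q2⟩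
    refine ⟨fun x y hx hy h => q1 x y hx hy (h.trans_le h1), fun h => ?_⟩
    obtain ⟨⟨s, e1, e2⟩, ⟨s', e3, e4⟩, e5⟩ := q2 h
    exact ⟨⟨s, e1, by linarith⟩, ⟨s', e3, by linarith⟩, fun s => h1.trans (e5 s)⟩
  · rintro a b w ε ⟨q1, q2⟩
    refine ⟨fun x y hx hy h => ?_, fun h => ?_⟩
    · rw [Linked.iv_iff hn hp]
      obtain ⟨x, rfl⟩ : ∃ x', x = x' + iv w := ⟨x - iv w, by abel⟩
      obtain ⟨y, rfl⟩ : ∃ x', y = x' + iv w := ⟨y - iv w, by abel⟩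
      rw [zc_iv hn, dist_add_right] at hx hy
      rw [hp, dist_add_right] at h
      exact q1 x y hx hy h
    · rw [Linked.iv_iff hn hp] at h
      simpa only [F_iv hn hp] using q2 h
  · intro a b h
    have far : ∀ x y, dist x (zc n a) ≤ hs n → dist y (zc n b) ≤ hs n → 1 < dist (F x) y := by
      intro x y hx hy
      have h1 := dist_triangle4 (zc n a) x y (zc n b)
      have h2 := dist_triangle x (F x) y
      have h3 := hB x
      rw [dist_comm] at h3 hx
      linarith
    refine ⟨fun x y hx hy h => absurd h (not_lt.2 (far x y hx hy).le), ?_⟩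
    rintro ⟨x, hx, hy⟩
    have := far x (F x) hx hy
    rw [dist_self] at this; linarith

/-- box lifts -/
def QL (n : ℕ) (F : V → V) (r1 r2 : ℝ) (a b : ℤ × ℤ) (ε : ℝ) : Prop :=
  Linked n F a b → ∃ S : ℝ × ℝ → ℝ, Continuous S ∧
    (∀ u ∈ Icc r1 r2, ∀ s : ℝ, ((S (u, s) : ℝ) : Circ) = ang (F (zc n a + u • sg s) - zc n b)) ∧
    (∀ u ∈ Icc r1 r2, ∀ s ∈ Icc (0:ℝ) 8, |S (u, s)| ≤ 1 / ε)

lemma QL_unif {n : ℕ} (hn : 0 < n) {F : V → V} (hF : Continuous F) (hp : Per F) {r1 r2 κ : ℝ}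
    (hr12 : r1 ≤ r2) (hκ : 0 < κ)
    (K1 : ∀ a b, Linked n F a b → ∀ u ∈ Icc r1 r2, ∀ s : ℝ, κ ≤ ‖F (zc n a + u • sg s) - zc n b‖) :
    ∃ ε > 0, ∀ a b, QL n F r1 r2 a b ε := by
  obtain ⟨B, hB⟩ := hp.bdd hF
  refine unif hn (QL n F r1 r2) ?_ ?_ ?_ (2 * hs n + B) ?_
  · intro a b ε ε' h0 h1 h hl
    obtain ⟨S, e1, e2, e3⟩ := h hl
    exact ⟨S, e1, e2, fun u hu s hs => (e3 u hu s hs).trans (one_div_le_one_div_of_le h0 h1)⟩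
  · intro a b w ε h hl
    rw [Linked.iv_iff hn hp] at hl
    simpa only [F_iv hn hp] using h hl
  · intro a b
    by_cases hl : Linked n F a b
    · have hc : Continuous fun z : ℝ × ℝ => ang (F (zc n a + (projIcc r1 r2 hr12 z.1 : ℝ) • sg ((z.2 : ℝ) : Circ)) - zc n b) := by
        refine ang_contOn.comp_continuous ?_ ?_
        · have h1 := sg_cont
          have h2 : Continuous fun z : ℝ × ℝ => ((z.2 : ℝ) : Circ) :=
            (AddCircle.continuous_mk' (8:ℝ)).comp (by fun_prop)
          fun_prop
        · intro z
          have := K1 a b hl _ (projIcc r1 r2 hr12 z.1).2 z.2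
          exact norm_pos_iff.1 (hκ.trans_le this)
      obtain ⟨S, hS, hS'⟩ := lift_circ hc
      obtain ⟨M, hM⟩ := ((isCompact_Icc (a := r1) (b := r2)).prod (isCompact_Icc (a := (0:ℝ)) (b := 8))).bddAbove_image
        (f := fun z => |S z|) (by fun_prop)
      refine ⟨1 / (|M| + 1), by positivity, fun _ => ⟨S, hS, fun u hu s => ?_, fun u hu s hs => ?_⟩⟩
      · rw [hS']; simp only; rw [projIcc_of_mem hr12 hu]
      · have := hM ⟨(u, s), ⟨hu, hs⟩, rfl⟩
        simp only at this
        rw [one_div_one_div]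
        linarith [le_abs_self M]
    · exact ⟨1, one_pos, fun h => (hl h).elim⟩
  · rintro a b h ⟨x, hx, hy⟩
    have h1 := dist_triangle4 (zc n a) x (F x) (zc n b)
    have h3 := hB x
    rw [dist_comm] at h3 hx
    linarith

theorem plane {n : ℕ} (hn : 0 < n) {F : V → V} (hF : Continuous F) (hp : Per F) (hg : Gen n F) :
    ∃ r α, Adm n r α ∧ ∃ δ > 0, ∀ G : V → V, Continuous G →
      (∀ x, dist (G x) (ph n α (F x)) < δ) → ∀ x : ℕ → V, (∀ i, dist (G (x i)) (x (i + 1)) < δ) →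
      ∃ z, ∀ i, dist (G^[i] z) (x i) ≤ 2 * hs n := by
  have hh := hs_pos hn
  obtain ⟨ε, hε, hQ⟩ := QP_unif hn hF hp hg
  obtain ⟨ρ, hρ, hρ'⟩ := hp.uc hF (show 0 < ε / 4 by positivity)
  obtain ⟨r1, hr1, hr1h, hr1ρ, hr1ε⟩ : ∃ r1, 0 < r1 ∧ r1 < hs n ∧ hs n - ρ < r1 ∧ hs n - ε / 4 < r1 := by
    have : max 0 (max (hs n - ρ) (hs n - ε / 4)) < hs n := by
      refine max_lt hh (max_lt (by linarith) (by linarith))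
    obtain ⟨r, h1, h2⟩ := exists_between this
    exact ⟨r, (le_max_left _ _).trans_lt h1, h2,
      ((le_max_left _ _).trans (le_max_right _ _)).trans_lt h1, ((le_max_right _ _).trans (le_max_right _ _)).trans_lt h1⟩
  obtain ⟨r2, hr12, hr2h⟩ := exists_between hr1h
  have near : ∀ a b, ∀ u ∈ Icc r1 r2, ∀ s : ℝ,
      |‖F (zc n a + u • sg s) - zc n b‖ - ‖F (zc n a + hs n • sg s) - zc n b‖| ≤ ε / 4 := by
    intro a b u hu s
    have e : dist (zc n a + u • sg s) (zc n a + hs n • sg s) < ρ := by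
      rw [dist_add_left, dist_eq_norm, ← sub_smul, norm_smul, sg_norm, mul_one, Real.norm_eq_abs, abs_lt]
      constructor <;> linarith [hu.1, hu.2]
    have e2 := (hρ' _ _ e).le
    rw [dist_eq_norm] at e2
    refine (abs_norm_sub_norm_le _ _).trans ?_
    simpa using e2
  have K1 : ∀ a b, Linked n F a b → ∀ u ∈ Icc r1 r2, ∀ s : ℝ, ε / 2 ≤ ‖F (zc n a + u • sg s) - zc n b‖ := by
    intro a b hl u hu s
    have h1 := abs_le.1 (near a b u hu s)
    have h2 := ((hQ a b).2 hl).2.2 s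
    linarith [h1.1]
  obtain ⟨m, hm, hL⟩ := QL_unif hn hF hp hr12.le (half_pos hε) K1
  obtain ⟨η0, hη0, hang⟩ := ang_close (half_pos hε)
  set η := min η0 (ε / 4) with hη
  have hηpos : 0 < η := lt_min hη0 (by positivity)
  have hηε : η ≤ ε / 4 := min_le_right _ _
  obtain ⟨N, hN⟩ := exists_nat_gt (1 / m + 1 / m + 18)
  have hr : 0 < r2 - r1 := by linarith
  set α : ℝ → ℝ := fun u => 8 * N * (max 0 (min 1 ((u - r1) / (r2 - r1)))) with hα
  have hα1 : α r1 = 0 := by simp [hα]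
  have hα2' : ∀ u, r2 ≤ u → α u = 8 * N := by
    intro u hu
    have : 1 ≤ (u - r1) / (r2 - r1) := by rw [one_le_div hr]; linarith
    simp only [hα]
    rw [min_eq_left this]; simp
  have HA : Adm n r2 α := ⟨hn, hr2h, by simp only [hα]; fun_prop, fun u hu => by
    rw [hα2' u hu]
    have := circ8 N 0
    simpa using this⟩
  have hψp : Per (ph n fun u => - α u) := fun x w => ph_iv hn _ x w
  obtain ⟨δ, hδ, hδ'⟩ := hψp.uc HA.neg.cont_ph hηpos
  refine ⟨r2, α, HA, δ / 2, by positivity, fun G hG hGF x hx => ?_⟩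
  set ψ := ph n fun u => - α u with hψ
  have hψ1 : ∀ y, ψ (ph n α y) = y := HA.inv_ph
  have hψ2 : ∀ y, ph n α (ψ y) = y := HA.homeo.apply_symm_apply
  have hGh : ∀ y, dist (ψ (G y)) (F y) < η := by
    intro y
    rw [← hψ1 (F y)]
    exact hδ' _ _ ((hGF y).trans (by linarith))
  have hlink : ∀ i, Linked n F (ci n (x i)) (ci n (x (i+1))) := by
    intro i
    refine (hQ _ _).1 (x i) (ψ (x (i+1))) (ci_dist hn _) ?_ ?_
    · have := ci_dist hn (ψ (x (i+1)))
      rwa [HA.neg.ci_ph] at this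
    · rw [← hψ1 (F (x i))]
      refine (hδ' _ _ ?_).trans_le (by linarith)
      have := dist_triangle_left (ph n α (F (x i))) (x (i+1)) (G (x i))
      linarith [hGF (x i), hx i]
  have hGeq : ∀ y, ph n α (ψ (G y)) = G y := fun y => hψ2 _
  obtain ⟨z, hz⟩ := nested (n := n) hr1 hr12.le hG (fun i => ci n (x i)) (by
    intro i c hc p q hgood
    obtain ⟨⟨su, hsu, hsu'⟩, ⟨sv, hsv, hsv'⟩, -⟩ := (hQ _ _).2 (hlink i)
    obtain ⟨S, hS, hS1, hS2⟩ := hL _ _ (hlink i)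
    have := step (η := η) (κ := ε / 2) (M := 1 / m) (N := 8 * N) (Gh := fun y => ψ (G y)) hr1 hr12.le hr2h.le HA hα1 (hα2' _ le_rfl)
      (by have : (0:ℝ) ≤ N := by positivity
          linarith) (by linarith)
      (fun x y h1 h2 h3 => hang x y h1 h2 (h3.trans_le (min_le_left _ _))) (HA.neg.cont_ph.comp hG) hGh
      (K1 _ _ (hlink i)) hsu hsv
      (fun u hu => by
        have h1 := abs_le.1 (near (ci n (x i)) (ci n (x (i+1))) u hu su)
        linarith [h1.1, h1.2])
      (fun u hu => by
        have h1 := abs_le.1 (near (ci n (x i)) (ci n (x (i+1))) u hu sv)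
        linarith [h1.1, h1.2])
      hS hS1 hS2 hc hgood
    simpa only [hGeq] using this)
  refine ⟨z, fun i => ?_⟩
  have h1 := hz i
  have h2 := ci_dist hn (x i)
  have := dist_triangle_right (G^[i] z) (x i) (zc n (ci n (x i)))
  linarith

end GS

namespace GS

lemma cross_lt (H : V ≃ₜ V) {z w : V} {h : ℝ} (hh : 0 < h)
    (hv : volume (H '' closedBall z h) = volume (closedBall w h))
    (hne : H '' closedBall z h ≠ closedBall w h)
    (hx : ∃ x ∈ ball z h, H x ∈ ball w h) : ∃ x, dist x z = h ∧ dist (H x) w < h := by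
  by_contra hcon
  push Not at hcon
  apply hne
  have hopen : IsOpen (H '' ball z h) := H.isOpenMap _ isOpen_ball
  have hcl : IsClosed (H '' closedBall z h) := H.isClosedMap _ isClosed_closedBall
  have hsub : ball w h ⊆ H '' ball z h := by
    have hconn : IsPreconnected (ball w h) := (convex_ball w h).isPreconnected
    refine hconn.subset_left_of_subset_union (v := (H '' closedBall z h)ᶜ) hopen hcl.isOpen_compl ?_ ?_ ?_
    · rw [Set.disjoint_left]
      rintro _ ⟨x, hx, rfl⟩ h2
      exact h2 ⟨x, ball_subset_closedBall hx, rfl⟩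
    · intro y hy
      by_cases h2 : y ∈ H '' closedBall z h
      · obtain ⟨x, hx, rfl⟩ := h2
        left
        refine ⟨x, ?_, rfl⟩
        rcases (mem_closedBall.1 hx).lt_or_eq with h3 | h3
        · exact h3
        · exact absurd hy (not_lt.2 (hcon x h3))
      · right; exact h2
    · obtain ⟨x, h1, h2⟩ := hx
      exact ⟨H x, h2, x, h1, rfl⟩
  have hsub2 : closedBall w h ⊆ H '' closedBall z h := by
    rw [← closure_ball w hh.ne']
    exact hcl.closure_subset_iff.2 (hsub.trans (image_mono ball_subset_closedBall))
  have h0 : volume (H '' ball z h \ closedBall w h) = 0 := by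
    have h1 : volume (H '' closedBall z h \ closedBall w h) = 0 := by
      rw [measure_sdiff hsub2 isClosed_closedBall.measurableSet.nullMeasurableSet
        (isCompact_closedBall w h).measure_lt_top.ne, hv, tsub_self]
    exact measure_mono_null (sdiff_subset_sdiff_left (image_mono ball_subset_closedBall)) h1
  have h1 : H '' ball z h ⊆ closedBall w h := by
    rw [← sdiff_eq_empty]
    exact (hopen.sdiff isClosed_closedBall).measure_eq_zero_iff volume |>.1 h0
  apply Subset.antisymm _ hsub2
  rw [← closure_ball z hh.ne', H.image_closure]
  exact isClosed_closedBall.closure_subset_iff.2 h1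

lemma cross_gt (H : V ≃ₜ V) {z w : V} {h : ℝ} (hh : 0 < h)
    (hv : volume (H '' closedBall z h) = volume (closedBall w h))
    (hne : H '' closedBall z h ≠ closedBall w h) : ∃ x, dist x z = h ∧ h < dist (H x) w := by
  by_contra hcon
  push Not at hcon
  apply hne
  have hcl : IsClosed (H '' closedBall z h) := H.isClosedMap _ isClosed_closedBall
  have hsub : H '' closedBall z h ⊆ closedBall w h := by
    obtain ⟨x, hx, hm⟩ := (isCompact_closedBall z h).exists_isMaxOn
      (f := fun x => dist (H x) w) ⟨z, mem_closedBall_self hh.le⟩ (by fun_prop)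
    rintro _ ⟨y, hy, rfl⟩
    refine (show dist (H y) w ≤ dist (H x) w from hm hy).trans ?_
    rcases (mem_closedBall.1 hx).lt_or_eq with h3 | h3
    · by_cases h4 : dist (H x) w = 0
      · rw [h4]; exact hh.le
      exfalso
      have hopen : IsOpen (H '' ball z h) := H.isOpenMap _ isOpen_ball
      have hc : Continuous fun t : ℝ => H x + t • (H x - w) := by fun_prop
      have hmem : (fun t : ℝ => H x + t • (H x - w)) ⁻¹' (H '' ball z h) ∈ 𝓝 (0:ℝ) :=
        (hopen.preimage hc).mem_nhds ⟨x, h3, by simp⟩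
      have hmem2 : ∀ᶠ t in 𝓝[>] (0:ℝ), H x + t • (H x - w) ∈ H '' ball z h := nhdsWithin_le_nhds hmem
      obtain ⟨t, ht, ht0⟩ := (hmem2.and (self_mem_nhdsWithin (s := Ioi (0:ℝ)))).exists
      obtain ⟨y, hy, hy'⟩ := ht
      have h5 : dist (H y) w ≤ dist (H x) w := hm (ball_subset_closedBall hy)
      have e : H x + t • (H x - w) - w = (1 + t) • (H x - w) := by module
      have ht0 : 0 < t := ht0
      rw [hy', dist_eq_norm, dist_eq_norm, e, norm_smul, Real.norm_eq_abs, abs_of_pos (by linarith)] at h5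
      have h6 : 0 < ‖H x - w‖ := by rw [← dist_eq_norm]; exact dist_nonneg.lt_of_ne' h4
      nlinarith
    · exact hcon x h3
  apply Subset.antisymm hsub
  have h0 : volume (ball w h \ H '' closedBall z h) = 0 := by
    have h1 : volume (closedBall w h \ H '' closedBall z h) = 0 := by
      rw [measure_sdiff hsub hcl.measurableSet.nullMeasurableSet
        ((isCompact_closedBall z h).image H.continuous).measure_lt_top.ne, hv, tsub_self]
    exact measure_mono_null (sdiff_subset_sdiff_left ball_subset_closedBall) h1
  have h1 : ball w h ⊆ H '' closedBall z h := by
    rw [← sdiff_eq_empty]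
    exact (isOpen_ball.sdiff hcl).measure_eq_zero_iff volume |>.1 h0
  rw [← closure_ball w hh.ne']
  exact hcl.closure_subset_iff.2 h1

/-- translated homeo -/
def trh (F : V ≃ₜ V) (v : V) : V ≃ₜ V := F.trans (Homeomorph.addRight v)

lemma trh_apply (F : V ≃ₜ V) (v x : V) : trh F v x = F x + v := rfl

lemma generic_tr {n : ℕ} (hn : 0 < n) (F : V ≃ₜ V)
    (hvol : ∀ a, volume (F '' closedBall (zc n a) (hs n)) = volume (closedBall (zc n a) (hs n)))
    {ε : ℝ} (hε : 0 < ε) : ∃ v : V, ‖v‖ < ε ∧ Gen n (trh F v) := by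
  have hh := hs_pos hn
  let C : ℤ × ℤ → Set V := fun a => closedBall (zc n a) (hs n)
  let U : ℤ × ℤ → ℤ × ℤ → Set V := fun a b => ⋃ x ∈ ball (zc n a) (hs n), {v | F x + v ∈ ball (zc n b) (hs n)}
  let L : ℤ × ℤ → ℤ × ℤ → Set V := fun a b => (fun z : V × V => z.2 - F z.1) '' (C a ×ˢ C b)
  let E : ℤ × ℤ → ℤ × ℤ → Set V := fun a b => {v | trh F v '' C a = C b}
  let T : ℤ × ℤ → ℤ × ℤ → Set V := fun a b => (F.trans (Homeomorph.subLeft (zc n b))) '' sphere (zc n a) (hs n)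
  have hU : ∀ a b, IsOpen (U a b) := fun a b => isOpen_biUnion fun x _ =>
    isOpen_ball.preimage (by fun_prop : Continuous fun v => F x + v)
  have hL : ∀ a b, IsClosed (L a b) := fun a b =>
    (((isCompact_closedBall _ _).prod (isCompact_closedBall _ _)).image (by fun_prop)).isClosed
  have hE : ∀ a b, (E a b).Subsingleton := by
    intro a b v hv v' hv'
    have hv : trh F v '' C a = C b := hv
    have hv' : trh F v' '' C a = C b := hv'
    -- iterate translation : C b invariant under d
    set d := v' - v with hd
    have inv : ∀ y ∈ C b, y + d ∈ C b := by
      intro y hy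
      rw [← hv] at hy
      obtain ⟨x, hx, rfl⟩ := hy
      rw [← hv']
      refine ⟨x, hx, ?_⟩
      rw [trh_apply, trh_apply, hd]; abel
    have inv2 : ∀ k : ℕ, zc n b + (k:ℝ) • d ∈ C b := by
      intro k
      induction k with
      | zero =>
        have : zc n b ∈ C b := mem_closedBall_self hh.le
        simpa using this
      | succ k ih =>
        have := inv _ ih
        convert this using 1
        push_cast; module
    have : ‖d‖ = 0 := by
      by_contra h0
      have h0 : 0 < ‖d‖ := (norm_nonneg d).lt_of_ne' h0
      obtain ⟨k, hk⟩ := exists_nat_gt (hs n / ‖d‖)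
      have := inv2 k
      simp only [C, mem_closedBall, dist_eq_norm, add_sub_cancel_left, norm_smul] at this
      rw [div_lt_iff₀ h0] at hk
      simp at this
      linarith
    rw [norm_eq_zero, hd, sub_eq_zero] at this
    exact this.symm
  have hTc : ∀ a b, IsClosed (T a b) := fun a b => Homeomorph.isClosedMap _ _ isClosed_sphere
  have hTd : ∀ a b, Dense (T a b)ᶜ := by
    intro a b
    rw [← interior_eq_empty_iff_dense_compl]
    simp only [T]
    rw [← Homeomorph.image_interior, interior_sphere _ hh.ne', image_empty]
  have hD : ∀ a b, Dense (U a b ∪ (L a b)ᶜ) := by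
    intro a b
    rw [Metric.dense_iff]
    intro v r hr
    by_cases hvL : v ∈ L a b
    · obtain ⟨⟨x, y⟩, ⟨hx, hy⟩, hxy⟩ := hvL
      simp only at hx hy hxy
      have hx2 : x ∈ closure (ball (zc n a) (hs n)) := by rw [closure_ball _ hh.ne']; exact hx
      have hy2 : y ∈ closure (ball (zc n b) (hs n)) := by rw [closure_ball _ hh.ne']; exact hy
      obtain ⟨ρ, hρ, hρ'⟩ := Metric.continuous_iff.1 F.continuous x (r/2) (by positivity)
      obtain ⟨x', hx', hxx⟩ := Metric.mem_closure_iff.1 hx2 ρ hρ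
      obtain ⟨y', hy', hyy⟩ := Metric.mem_closure_iff.1 hy2 (r/2) (by positivity)
      have h1 := hρ' x' (by rwa [dist_comm])
      refine ⟨y' - F x', ?_, Or.inl ?_⟩
      · rw [mem_ball, ← hxy]
        have h2 := dist_sub_sub_le y' (F x') y (F x)
        rw [dist_comm y'] at h2
        linarith
      · simp only [U, mem_iUnion]
        exact ⟨x', hx', by simpa using hy'⟩
    · exact ⟨v, mem_ball_self hr, Or.inr hvL⟩
  let W : (ℤ × ℤ) × (ℤ × ℤ) → Set V := fun ab =>
    ((U ab.1 ab.2 ∪ (L ab.1 ab.2)ᶜ) \ E ab.1 ab.2) ∩ (T ab.1 ab.2)ᶜ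
  have hWo : ∀ ab, IsOpen (W ab) := fun ab =>
    (((hU _ _).union (hL _ _).isOpen_compl).sdiff (hE _ _).finite.isClosed).inter (hTc _ _).isOpen_compl
  have hWd : ∀ ab, Dense (W ab) := fun ab =>
    ((hD _ _).sdiff_finite (hE _ _).finite).inter_of_isOpen_right (hTd _ _) (hTc _ _).isOpen_compl
  obtain ⟨v, hv, hvW⟩ := Metric.dense_iff.1 (dense_iInter_of_isOpen hWo hWd) 0 ε hε
  rw [mem_iInter] at hvW
  have hvv : ∀ a b, volume (trh F v '' closedBall (zc n a) (hs n)) = volume (closedBall (zc n b) (hs n)) := by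
    intro a b
    have e : trh F v '' closedBall (zc n a) (hs n) = (fun x => x + v) '' (F '' closedBall (zc n a) (hs n)) := by
      rw [image_image]; rfl
    rw [e, image_add_right, measure_preimage_add_right, hvol, Measure.addHaar_closedBall_center,
      Measure.addHaar_closedBall_center volume (zc n b)]
  have hkey : ∀ a b, Linked n (trh F v) a b → (∃ x ∈ ball (zc n a) (hs n), trh F v x ∈ ball (zc n b) (hs n)) ∧
      trh F v '' closedBall (zc n a) (hs n) ≠ closedBall (zc n b) (hs n) := by
    rintro a b ⟨x, hx, hy⟩
    have hw := (hvW (a, b)).1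
    refine ⟨?_, hw.2⟩
    rcases hw.1 with h | h
    · simp only [U, mem_iUnion] at h
      obtain ⟨x, hx, h⟩ := h
      exact ⟨x, hx, h⟩
    · exact absurd ⟨(x, trh F v x), ⟨hx, hy⟩, by rw [trh_apply]; simp⟩ h
  refine ⟨v, by simpa using hv, fun a b hl => ?_, fun a b hl => ?_, fun a b x hx h => ?_⟩
  · exact cross_lt _ hh (hvv a b) (hkey a b hl).2 (hkey a b hl).1
  · exact cross_gt _ hh (hvv a b) (hkey a b hl).2
  · apply (hvW (a, b)).2
    refine ⟨x, hx, ?_⟩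
    show zc n b - F x = v
    rw [← h, trh_apply]; abel

end GS

namespace GS

/-- coordinates -/
def eV : R2 ≃ₜ V where
  toFun x := (x 0, x 1)
  invFun y := !₂[y.1, y.2]
  left_inv x := by ext i; fin_cases i <;> rfl
  right_inv y := rfl
  continuous_toFun := by fun_prop
  continuous_invFun := by
    refine (PiLp.continuous_toLp 2 _).comp (continuous_pi fun i => ?_)
    fin_cases i
    · exact continuous_fst
    · exact continuous_snd

lemma eV_apply (x : R2) : eV x = (x 0, x 1) := rfl

lemma eV_add (x y : R2) : eV (x + y) = eV x + eV y := rfl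
lemma eV_sub (x y : R2) : eV (x - y) = eV x - eV y := rfl

lemma eV_symm_add (x y : V) : eV.symm (x + y) = eV.symm x + eV.symm y := by
  apply eV.injective; rw [eV_add]; simp

lemma eV_mp : MeasurePreserving eV volume volume :=
  (volume_preserving_finTwoArrow ℝ).comp (EuclideanSpace.volume_preserving_symm_measurableEquiv_toLp (Fin 2))

lemma norm_eV_le (x : R2) : ‖eV x‖ ≤ ‖x‖ := by
  rw [eV_apply, Prod.norm_def]
  exact max_le (PiLp.norm_apply_le x 0) (PiLp.norm_apply_le x 1)

lemma norm_le_eV (x : R2) : ‖x‖ ≤ 2 * ‖eV x‖ := by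
  have h1 : ‖x 0‖ ≤ ‖eV x‖ := le_max_left _ _
  have h2 : ‖x 1‖ ≤ ‖eV x‖ := le_max_right _ _
  rw [EuclideanSpace.norm_eq]
  apply Real.sqrt_le_iff.2 ⟨by positivity, ?_⟩
  rw [Fin.sum_univ_two]
  nlinarith [norm_nonneg (x 0), norm_nonneg (x 1)]

lemma dist_eV_le (x y : R2) : dist (eV x) (eV y) ≤ dist x y := by
  rw [dist_eq_norm, dist_eq_norm, ← eV_sub]; exact norm_eV_le _

lemma dist_le_eV (x y : R2) : dist x y ≤ 2 * dist (eV x) (eV y) := by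
  rw [dist_eq_norm, dist_eq_norm, ← eV_sub]; exact norm_le_eV _

lemma mem_lat {w : R2} : w ∈ intLattice ↔ ∃ k : ℤ × ℤ, eV w = iv k := by
  constructor
  · intro h
    obtain ⟨a, ha⟩ := h 0
    obtain ⟨b, hb⟩ := h 1
    exact ⟨(a, b), by rw [eV_apply, ha, hb]; rfl⟩
  · rintro ⟨k, hk⟩ i
    rw [eV_apply, iv, Prod.mk.injEq] at hk
    fin_cases i
    · exact ⟨k.1, hk.1⟩
    · exact ⟨k.2, hk.2⟩

lemma iv_mem (k : ℤ × ℤ) : eV.symm (iv k) ∈ intLattice := mem_lat.2 ⟨k, by simp⟩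

lemma lat_norm {w : R2} (hw : w ∈ intLattice) (h0 : w ≠ 0) : 1 ≤ ‖w‖ := by
  by_contra h
  push Not at h
  apply h0
  ext i
  obtain ⟨n, hn⟩ := hw i
  have := (PiLp.norm_apply_le w i).trans_lt h
  rw [hn, Real.norm_eq_abs, ← Int.cast_abs] at this
  have h2 : |n| < 1 := by exact_mod_cast this
  rw [Int.abs_lt_one_iff] at h2
  rw [hn, h2]; simp

instance lat_countable : Countable intLattice := by
  have : Function.Injective fun w : intLattice => (mem_lat.1 w.2).choose := by
    intro w w' h
    apply Subtype.ext
    apply eV.injective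
    rw [(mem_lat.1 w.2).choose_spec, (mem_lat.1 w'.2).choose_spec]
    exact congrArg iv h
  exact this.countable

instance lat_closed : IsClosed (intLattice : Set R2) := by
  have : (intLattice : Set R2) = ⋂ i, (fun x : R2 => x i) ⁻¹' (range ((↑) : ℤ → ℝ)) := by
    ext x
    simp only [mem_iInter, mem_preimage, mem_range]
    exact forall_congr' fun i => ⟨fun ⟨n, hn⟩ => ⟨n, hn.symm⟩, fun ⟨n, hn⟩ => ⟨n, hn.symm⟩⟩
  rw [this]
  exact isClosed_iInter fun i => Int.isClosedEmbedding_coe_real.isClosed_range.preimage (by fun_prop)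

lemma pr_surj (x : T2) : ∃ y, pr y = x := QuotientAddGroup.mk_surjective x
lemma pr_cont : Continuous pr := continuous_quot_mk
lemma pr_eq {x y : R2} : pr x = pr y ↔ ∃ w ∈ intLattice, x = y + w := by
  unfold pr
  rw [QuotientAddGroup.eq]
  constructor
  · intro h; exact ⟨_, intLattice.neg_mem h, by abel⟩
  · rintro ⟨w, hw, rfl⟩; simpa using intLattice.neg_mem hw

lemma pr_add (x : R2) {w : R2} (hw : w ∈ intLattice) : pr (x + w) = pr x := pr_eq.2 ⟨w, hw, rfl⟩

lemma dist_pr_le (x y : R2) : dist (pr x) (pr y) ≤ dist x y := by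
  rw [dist_eq_norm, dist_eq_norm]
  exact QuotientAddGroup.norm_mk_le_norm (S := intLattice) (m := x - y)

lemma dist_pr_lt {x y : R2} {δ : ℝ} (h : dist (pr x) (pr y) < δ) :
    ∃ w ∈ intLattice, dist x (y + w) < δ := by
  rw [dist_eq_norm] at h
  obtain ⟨m, hm, hm'⟩ := QuotientAddGroup.norm_lt_iff.1 h
  have : pr m = pr (x - y) := hm
  obtain ⟨w, hw, rfl⟩ := pr_eq.1 this
  refine ⟨-w, intLattice.neg_mem hw, ?_⟩
  rw [dist_eq_norm]
  convert hm' using 2; abel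

lemma T2_bdd (a b : T2) : dist a b ≤ 4 := by
  have : ∀ a : T2, ∃ x : R2, pr x = a ∧ ‖x‖ ≤ 2 := by
    intro a
    obtain ⟨x, rfl⟩ := pr_surj a
    obtain ⟨w, y, hy, hy'⟩ := iv_floor (eV x)
    refine ⟨eV.symm y, pr_eq.2 ⟨- eV.symm (iv w), intLattice.neg_mem (iv_mem w), ?_⟩, ?_⟩
    · rw [eq_add_neg_iff_add_eq, ← eV_symm_add, ← hy]; simp
    · have := norm_le_eV (eV.symm y)
      rw [eV.apply_symm_apply] at this; linarith
  obtain ⟨x, rfl, hx⟩ := this a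
  obtain ⟨y, rfl, hy⟩ := this b
  refine (dist_pr_le x y).trans ?_
  rw [dist_eq_norm]
  linarith [norm_sub_le x y]

lemma le_dC0 (f g : T2 ≃ₜ T2) (x : T2) : dist (f x) (g x) ≤ dC0 f g :=
  le_ciSup (f := fun x => dist (f x) (g x)) ⟨4, by rintro _ ⟨x, rfl⟩; exact T2_bdd _ _⟩ x

lemma dC0_le {f g : T2 ≃ₜ T2} {C : ℝ} (h : ∀ x, dist (f x) (g x) ≤ C) : dC0 f g ≤ C := ciSup_le h

lemma dC0_tri (f g k : T2 ≃ₜ T2) : dC0 f k ≤ dC0 f g + dC0 g k :=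
  dC0_le fun x => (dist_triangle _ (g x) _).trans (add_le_add (le_dC0 _ _ _) (le_dC0 _ _ _))

/-- equivariant homeos -/
def Eqv (G : R2 ≃ₜ R2) : Prop := ∀ x : R2, ∀ w ∈ intLattice, G (x + w) = G x + w

lemma Eqv.symm {G : R2 ≃ₜ R2} (h : Eqv G) : Eqv G.symm := by
  intro x w hw
  apply G.injective
  rw [h _ _ hw]; simp

lemma Eqv.trans {G H : R2 ≃ₜ R2} (h : Eqv G) (h' : Eqv H) : Eqv (G.trans H) := by
  intro x w hw
  simp only [Homeomorph.trans_apply]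
  rw [h _ _ hw, h' _ _ hw]

lemma Eqv.desc {G : R2 ≃ₜ R2} (h : Eqv G) : ∃ g : T2 → T2, Continuous g ∧ ∀ x, g (pr x) = pr (G x) := by
  refine ⟨Quotient.lift (fun x => pr (G x)) ?_, ?_, fun x => rfl⟩
  · intro a b hab
    have : pr a = pr b := Quotient.sound hab
    obtain ⟨w, hw, rfl⟩ := pr_eq.1 this
    rw [h _ _ hw, pr_add _ hw]
  · exact (pr_cont.comp G.continuous).quotient_lift _

lemma Eqv.exists {G : R2 ≃ₜ R2} (h : Eqv G) : ∃ g : T2 ≃ₜ T2, IsLift g G := by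
  obtain ⟨g, hg, hg'⟩ := h.desc
  obtain ⟨k, hk, hk'⟩ := h.symm.desc
  refine ⟨⟨⟨g, k, ?_, ?_⟩, hg, hk⟩, ?_, h⟩
  · intro x; obtain ⟨y, rfl⟩ := pr_surj x; rw [hg', hk']; simp
  · intro x; obtain ⟨y, rfl⟩ := pr_surj x; rw [hk', hg']; simp
  · intro x; exact (hg' x).symm

lemma fd_meas : MeasurableSet fundDomain := by
  have : fundDomain = ⋂ i, (fun x : R2 => x i) ⁻¹' Ico 0 1 := by
    ext x; simp only [mem_iInter, mem_preimage]; rfl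
  rw [this]
  exact MeasurableSet.iInter fun i => measurableSet_Ico.preimage (by fun_prop)

lemma fd_unique (x : R2) : ∃! w : intLattice, w +ᵥ x ∈ fundDomain := by
  refine ⟨⟨!₂[(-⌊x 0⌋ : ℝ), (-⌊x 1⌋ : ℝ)], ?_⟩, ?_, ?_⟩
  · intro i
    fin_cases i
    · exact ⟨-⌊x 0⌋, by simp⟩
    · exact ⟨-⌊x 1⌋, by simp⟩
  · intro i
    have hf := fun t : ℝ => And.intro (Int.fract_nonneg t) (Int.fract_lt_one t)
    fin_cases i
    · have := hf (x 0)
      simp only [Int.fract] at this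
      exact ⟨by
        simp [AddSubgroup.vadd_def]; exact Int.floor_le _, by
        simp [AddSubgroup.vadd_def]⟩
    · have := hf (x 1)
      simp only [Int.fract] at this
      exact ⟨by
        simp [AddSubgroup.vadd_def]; exact Int.floor_le _, by
        simp [AddSubgroup.vadd_def]⟩
  · rintro ⟨w, hw⟩ h
    apply Subtype.ext
    have key : ∀ i, w i = -(⌊x i⌋ : ℝ) := by
      intro i
      obtain ⟨n, hn⟩ := hw i
      have h1 := h i
      have h2 : 0 ≤ w i + x i ∧ w i + x i < 1 := h1
      have : ⌊x i⌋ = -n := by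
        rw [Int.floor_eq_iff]; push_cast; constructor <;> linarith [h2.1, h2.2]
      rw [hn, this]; push_cast; ring
    ext i
    fin_cases i
    · exact key 0
    · exact key 1

lemma fd : IsAddFundamentalDomain intLattice fundDomain (volume : Measure R2) :=
  .mk' fd_meas.nullMeasurableSet fd_unique

lemma leb_apply {B : Set T2} (hB : MeasurableSet B) : lebT2 B = volume (pr ⁻¹' B ∩ fundDomain) := by
  rw [lebT2, Measure.map_apply pr_cont.measurable hB, Measure.restrict_apply (pr_cont.measurable hB)]

lemma lift_mp {g : T2 ≃ₜ T2} {G : R2 ≃ₜ R2} (h : IsLift g G) (hG : MeasurePreserving G volume volume) :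
    MeasurePreserving g lebT2 lebT2 := by
  refine ⟨g.continuous.measurable, ?_⟩
  ext B hB
  rw [Measure.map_apply g.continuous.measurable hB, leb_apply (g.continuous.measurable hB), leb_apply hB]
  have e1 : pr ⁻¹' (g ⁻¹' B) ∩ fundDomain = G ⁻¹' (pr ⁻¹' B ∩ G '' fundDomain) := by
    ext x
    simp only [mem_inter_iff, mem_preimage, h.proj, G.injective.mem_set_image]
  have hm : MeasurableSet (G '' fundDomain) := G.measurableEmbedding.measurableSet_image.2 fd_meas
  rw [e1, hG.measure_preimage ((pr_cont.measurable hB).inter hm).nullMeasurableSet]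
  refine IsAddFundamentalDomain.measure_set_eq (G := intLattice) ?_ fd (pr_cont.measurable hB) ?_
  · refine .mk' hm.nullMeasurableSet fun x => ?_
    have : ∀ w : intLattice, w +ᵥ x ∈ G '' fundDomain ↔ w +ᵥ (G.symm x) ∈ fundDomain := by
      intro w
      have e : w +ᵥ x = G (w +ᵥ (G.symm x)) := by
        simp only [AddSubgroup.vadd_def, vadd_eq_add]
        rw [add_comm _ (G.symm x), h.equivariant _ _ w.2, G.apply_symm_apply, add_comm]
      rw [e, G.injective.mem_set_image]
    simp only [this]
    exact fd_unique _
  · intro w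
    ext x
    simp only [mem_preimage, AddSubgroup.vadd_def, vadd_eq_add]
    rw [add_comm, pr_add _ w.2]

lemma leb_pr {A : Set R2} (hA : IsCompact A) (hi : InjOn pr A) : lebT2 (pr '' A) = volume A := by
  have hm : MeasurableSet (pr '' A) := (hA.image pr_cont).isClosed.measurableSet
  rw [leb_apply hm, fd.measure_eq_tsum A, ← measure_iUnion]
  · congr 1
    ext x
    simp only [mem_inter_iff, mem_preimage, mem_iUnion]
    constructor
    · rintro ⟨⟨y, hy, hyx⟩, hx⟩
      obtain ⟨w, hw, rfl⟩ := pr_eq.1 hyx.symm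
      exact ⟨⟨w, hw⟩, ⟨y, hy, by simp [AddSubgroup.vadd_def, add_comm]⟩, hx⟩
    · rintro ⟨w, ⟨y, hy, rfl⟩, hx⟩
      refine ⟨⟨y, hy, ?_⟩, hx⟩
      simp only [AddSubgroup.vadd_def, vadd_eq_add]
      rw [add_comm, pr_add _ w.2]
  · intro w w' hw
    rw [Function.onFun, Set.disjoint_left]
    rintro _ ⟨⟨y, hy, rfl⟩, -⟩ ⟨⟨y', hy', e⟩, -⟩
    simp only [AddSubgroup.vadd_def, vadd_eq_add] at e
    have : pr y = pr y' := by
      rw [← pr_add y w.2, add_comm, ← e, add_comm, pr_add _ w'.2]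
    have := hi hy hy' this
    subst this
    exact hw (Subtype.ext (add_right_cancel e).symm)
  · intro w
    exact ((hA.image (continuous_const_vadd w)).isClosed.measurableSet).inter fd_meas

end GS

namespace GS

lemma lift_trans {f k : T2 ≃ₜ T2} {F K : R2 ≃ₜ R2} (h : IsLift f F) (h' : IsLift k K) :
    IsLift (f.trans k) (F.trans K) :=
  ⟨fun x => by simp [h'.proj, h.proj], Eqv.trans h.equivariant h'.equivariant⟩

/-- conjugate to coordinates -/
def cj (F : R2 ≃ₜ R2) : V ≃ₜ V := eV.symm.trans (F.trans eV)

lemma cj_apply (F : R2 ≃ₜ R2) (x : V) : cj F x = eV (F (eV.symm x)) := rfl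

lemma cj_per {F : R2 ≃ₜ R2} (h : Eqv F) : Per (cj F) := by
  intro x w
  rw [cj_apply, eV_symm_add, h _ _ (iv_mem w), eV_add, cj_apply]; simp

lemma inj_ball {n : ℕ} (hn : 2 ≤ n) (c : V) : InjOn pr (eV ⁻¹' closedBall c (hs n)) := by
  intro x hx y hy hxy
  obtain ⟨w, hw, rfl⟩ := pr_eq.1 hxy
  have hd : dist (eV (y + w)) (eV y) ≤ 2 * hs n := by
    have := dist_triangle_right (eV (y + w)) (eV y) c
    have h1 : dist (eV (y + w)) c ≤ hs n := hx
    have h2 : dist (eV y) c ≤ hs n := hy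
    linarith
  rw [eV_add, dist_self_add_left] at hd
  have h2 : 2 * hs n < 1 := by
    rw [hs]
    have : (2 : ℝ) ≤ n := by exact_mod_cast hn
    rw [mul_one_div, div_lt_one (by positivity)]
    linarith
  obtain ⟨k, hk⟩ := mem_lat.1 hw
  rw [hk] at hd
  have a1 : ‖(k.1 : ℝ)‖ < 1 := (le_max_left _ _).trans_lt (hd.trans_lt h2)
  have a2 : ‖(k.2 : ℝ)‖ < 1 := (le_max_right _ _).trans_lt (hd.trans_lt h2)
  rw [Real.norm_eq_abs, ← Int.cast_abs] at a1 a2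
  have b1 : |k.1| < 1 := by exact_mod_cast a1
  have b2 : |k.2| < 1 := by exact_mod_cast a2
  rw [Int.abs_lt_one_iff] at b1 b2
  have : w = 0 := by
    apply eV.injective
    rw [hk, iv, b1, b2]
    simp [eV_apply]
  simp [this]

lemma hvol {n : ℕ} (hn : 2 ≤ n) {f : T2 ≃ₜ T2} {F : R2 ≃ₜ R2} (h : IsLift f F)
    (hf : MeasurePreserving f lebT2 lebT2) (c : V) :
    volume (cj F '' closedBall c (hs n)) = volume (closedBall c (hs n)) := by
  set A : Set R2 := eV ⁻¹' closedBall c (hs n) with hA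
  have hAc : IsCompact A := by
    rw [hA, ← eV.image_symm]
    exact (isCompact_closedBall c (hs n)).image eV.symm.continuous
  have hi : InjOn pr A := inj_ball hn c
  have hi' : InjOn pr (F '' A) := by
    rintro _ ⟨x, hx, rfl⟩ _ ⟨y, hy, rfl⟩ e
    rw [h.proj, h.proj] at e
    rw [hi hx hy (f.injective e)]
  have e1 : pr '' (F '' A) = f '' (pr '' A) := by
    rw [image_image, image_image]
    exact image_congr fun x _ => h.proj x
  have e2 : volume (F '' A) = volume A := by
    rw [← leb_pr (hAc.image F.continuous) hi', ← leb_pr hAc hi, e1]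
    have hm : MeasurableSet (f '' (pr '' A)) :=
      ((hAc.image pr_cont).image f.continuous).isClosed.measurableSet
    rw [← hf.measure_preimage hm.nullMeasurableSet, preimage_image_eq _ f.injective]
  have e3 : ∀ B : Set V, IsCompact B → volume (eV ⁻¹' B) = volume B := fun B hB =>
    eV_mp.measure_preimage hB.isClosed.measurableSet.nullMeasurableSet
  rw [← e3 _ (isCompact_closedBall c (hs n)), ← hA, ← e2,
    ← e3 _ ((isCompact_closedBall c (hs n)).image (cj F).continuous)]
  congr 1
  ext x
  constructor
  · rintro ⟨y, hy, e⟩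
    refine ⟨eV.symm y, by simpa [hA] using hy, ?_⟩
    exact eV.injective e
  · rintro ⟨y, hy, rfl⟩
    exact ⟨eV y, hy, by simp [cj_apply]⟩

lemma close_lift {f g : T2 ≃ₜ T2} {F : R2 ≃ₜ R2} (h : IsLift f F) (hg : g ∈ Homeo0) {δ : ℝ}
    (hδ : δ ≤ 1 / 4) (hd : dC0 f g < δ) : ∃ G : R2 ≃ₜ R2, IsLift g G ∧ ∀ x, dist (F x) (G x) < δ := by
  obtain ⟨G0, h0⟩ := hg
  have hk : ∀ x, ∃ w ∈ intLattice, dist (F x) (G0 x + w) < δ := fun x => by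
    apply dist_pr_lt
    rw [h.proj, h0.proj]
    exact (le_dC0 _ _ _).trans_lt hd
  obtain ⟨w0, hw0, hd0⟩ := hk 0
  have hcl : ∀ x, dist (F x) (G0 x + w0) < δ ∨ 1 / 2 < dist (F x) (G0 x + w0) := by
    intro x
    obtain ⟨w, hw, hdw⟩ := hk x
    by_cases e : w = w0
    · left; rw [← e]; exact hdw
    · right
      have := lat_norm (intLattice.sub_mem hw hw0) (sub_ne_zero.2 e)
      have h2 := dist_triangle_left (G0 x + w) (G0 x + w0) (F x)
      rw [dist_add_left, dist_eq_norm w w0] at h2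
      linarith
  have hc : Continuous fun x => dist (F x) (G0 x + w0) := by fun_prop
  have hclopen : IsClopen {x | dist (F x) (G0 x + w0) < δ} := by
    refine ⟨?_, isOpen_lt hc continuous_const⟩
    have : {x | dist (F x) (G0 x + w0) < δ} = {x | dist (F x) (G0 x + w0) ≤ 1 / 2} := by
      ext x
      constructor
      · intro hx
        have hx : dist (F x) (G0 x + w0) < δ := hx
        change dist (F x) (G0 x + w0) ≤ 1 / 2
        linarith
      · intro hx
        exact (hcl x).resolve_right (not_lt.2 hx)
    rw [this]
    exact isClosed_le hc continuous_const
  have hu := hclopen.eq_univ ⟨0, hd0⟩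
  refine ⟨G0.trans (Homeomorph.addRight w0), ⟨fun x => ?_, fun x w hw => ?_⟩, fun x => ?_⟩
  · simp only [Homeomorph.trans_apply, Homeomorph.coe_addRight]
    rw [pr_add _ hw0, h0.proj]
  · simp only [Homeomorph.trans_apply, Homeomorph.coe_addRight]
    rw [h0.equivariant _ _ hw]; abel
  · have : x ∈ {x | dist (F x) (G0 x + w0) < δ} := hu ▸ mem_univ x
    exact this

lemma lift_orbit {g : T2 ≃ₜ T2} {G : R2 ≃ₜ R2} (h : IsLift g G) {δ : ℝ} (x : ℕ → T2)
    (hx : ∀ i, dist (g (x i)) (x (i + 1)) < δ) :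
    ∃ X : ℕ → R2, (∀ i, pr (X i) = x i) ∧ ∀ i, dist (G (X i)) (X (i + 1)) < δ := by
  have step : ∀ i, ∀ y : {y : R2 // pr y = x i}, ∃ y' : {y : R2 // pr y = x (i + 1)},
      dist (G y.1) y'.1 < δ := by
    rintro i ⟨y, hy⟩
    obtain ⟨u, hu⟩ := pr_surj (x (i + 1))
    have := hx i
    rw [← hy, ← hu, ← h.proj] at this
    obtain ⟨w, hw, hd⟩ := dist_pr_lt this
    exact ⟨⟨u + w, by rw [pr_add _ hw, hu]⟩, hd⟩
  choose s hs using step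
  obtain ⟨y0, hy0⟩ := pr_surj (x 0)
  let X : ∀ i, {y : R2 // pr y = x i} := fun i => Nat.rec ⟨y0, hy0⟩ (fun i y => s i y) i
  exact ⟨fun i => (X i).1, fun i => (X i).2, fun i => hs i (X i)⟩

lemma iter_pr {g : T2 ≃ₜ T2} {G : R2 ≃ₜ R2} (h : IsLift g G) (i : ℕ) (z : R2) :
    (⇑g)^[i] (pr z) = pr ((⇑G)^[i] z) := by
  induction i with
  | zero => rfl
  | succ i ih => rw [Function.iterate_succ_apply', Function.iterate_succ_apply', ih, h.proj]

lemma iter_cj (G : R2 ≃ₜ R2) (i : ℕ) (z : V) :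
    (⇑(cj G))^[i] z = eV ((⇑G)^[i] (eV.symm z)) := by
  induction i with
  | zero => simp
  | succ i ih =>
    rw [Function.iterate_succ_apply', Function.iterate_succ_apply', ih, cj_apply]; simp

/-- the generic sets -/
def SS (k : ℕ) : Set (T2 ≃ₜ T2) :=
  {f | ∃ δ > 0, ∀ g ∈ Homeo0Leb, dC0 f g < δ → ∀ x : ℕ → T2,
    (∀ i, dist (g (x i)) (x (i + 1)) < δ) → ∃ z, ∀ i, dist ((⇑g)^[i] z) (x i) < 1 / ((k : ℝ) + 1)}

lemma SS_open (k : ℕ) : OpenIn Homeo0Leb (SS k) := by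
  rintro f ⟨⟨δ, hδ, H⟩, -⟩
  refine ⟨δ / 2, by positivity, fun g _ hfg => ⟨δ / 2, by positivity, fun g' hg' hd x hx => ?_⟩⟩
  refine H g' hg' ?_ x fun i => (hx i).trans (by linarith)
  linarith [dC0_tri f g g']

lemma SS_shadow (f : T2 ≃ₜ T2) (hf : f ∈ Homeo0Leb) (h : ∀ n, f ∈ SS n) : Shadowing f := by
  intro ε hε
  obtain ⟨k, hk⟩ := exists_nat_one_div_lt hε
  obtain ⟨δ, hδ, H⟩ := h k
  refine ⟨δ, hδ, fun x hx => ?_⟩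
  have h0 : dC0 f f ≤ 0 := dC0_le fun x => by simp
  obtain ⟨z, hz⟩ := H f hf (by linarith) x hx
  exact ⟨z, fun i => (hz i).trans hk⟩

lemma SS_dense (k : ℕ) : DenseIn Homeo0Leb (SS k) := by
  rintro f ⟨⟨F, hF⟩, hfm⟩ ε hε
  obtain ⟨n, hn2, hn⟩ : ∃ n : ℕ, 2 ≤ n ∧ hs n < min (ε / 16) (1 / ((k : ℝ) + 1) / 4) := by
    obtain ⟨m, hm⟩ := exists_nat_one_div_lt (show 0 < min (ε / 16) (1 / ((k : ℝ) + 1) / 4) by positivity)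
    refine ⟨m + 2, by omega, lt_of_le_of_lt ?_ hm⟩
    rw [hs]
    apply one_div_le_one_div_of_le (by positivity)
    push_cast; linarith [(Nat.cast_nonneg m : (0 : ℝ) ≤ m)]
  have hn1 := lt_min_iff.1 hn
  have hn0 : 0 < n := by omega
  obtain ⟨v, hv, hgen⟩ := generic_tr hn0 (cj F) (fun a => hvol hn2 hF hfm _)
    (show 0 < ε / 16 by positivity)
  have hper : Per (trh (cj F) v) := by
    intro x w
    rw [trh_apply, trh_apply, cj_per hF.equivariant]; abel
  obtain ⟨r, α, HA, δ, hδ, hpl⟩ := plane hn0 (trh (cj F) v).continuous hper hgen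
  let KV : V ≃ₜ V := (Homeomorph.addRight v).trans HA.homeo
  let K : R2 ≃ₜ R2 := (eV.trans KV).trans eV.symm
  have hKa : ∀ x, K x = eV.symm (ph n α (eV x + v)) := fun x => rfl
  have hKe : Eqv K := by
    intro x w hw
    obtain ⟨j, hj⟩ := mem_lat.1 hw
    rw [hKa, hKa, eV_add, hj, add_right_comm, ph_iv hn0, eV_symm_add, ← hj]; simp
  have hKm : MeasurePreserving K volume volume := by
    have e1 : MeasurePreserving eV.symm volume volume := by
      have := MeasurePreserving.symm eV.toMeasurableEquiv eV_mp
      exact this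
    have e2 : MeasurePreserving (fun y : V => y + v) volume volume := measurePreserving_add_right _ v
    exact e1.comp ((HA.mp.comp e2).comp eV_mp)
  obtain ⟨κ, hκ⟩ := hKe.exists
  have hFK := lift_trans hF hκ
  have hdK : ∀ x, dist x (K x) ≤ 2 * (‖v‖ + 2 * hs n) := by
    intro x
    refine (dist_le_eV _ _).trans ?_
    rw [hKa, eV.apply_symm_apply]
    have h1 := HA.dist_ph (eV x + v)
    have h2 := dist_triangle_right (eV x) (ph n α (eV x + v)) (eV x + v)
    rw [dist_self_add_right] at h2
    linarith
  refine ⟨f.trans κ, ⟨⟨min δ (1 / 4), by positivity, ?_⟩, ⟨_, hFK⟩, ?_⟩, ?_⟩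
  · intro g hg hd x hx
    obtain ⟨G, hG, hGd⟩ := close_lift hFK hg.1 (min_le_right _ _) hd
    obtain ⟨X, hX, hXd⟩ := lift_orbit hG x hx
    obtain ⟨z, hz⟩ := hpl (cj G) (cj G).continuous (fun y => by
      have := hGd (eV.symm y)
      have h2 := dist_eV_le (G (eV.symm y)) ((F.trans K) (eV.symm y))
      rw [dist_comm (G _)] at h2
      have h3 : eV ((F.trans K) (eV.symm y)) = ph n α (trh (cj F) v y) := by
        simp only [Homeomorph.trans_apply]
        rw [hKa, eV.apply_symm_apply]; rfl
      rw [h3] at h2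
      exact (h2.trans_lt this).trans_le (min_le_left _ _)) (fun i => eV (X i)) (fun i => by
      rw [cj_apply, eV.symm_apply_apply]
      exact ((dist_eV_le _ _).trans_lt (hXd i)).trans_le (min_le_left _ _))
    refine ⟨pr (eV.symm z), fun i => ?_⟩
    have h1 := hz i
    rw [iter_cj] at h1
    rw [iter_pr hG, ← hX i]
    have h2 := dist_pr_le ((⇑G)^[i] (eV.symm z)) (X i)
    have h3 := dist_le_eV ((⇑G)^[i] (eV.symm z)) (X i)
    linarith [hn1.2]
  · exact (lift_mp hκ hKm).comp hfm
  · refine lt_of_le_of_lt (dC0_le (C := 2 * (‖v‖ + 2 * hs n)) fun x => ?_) (by linarith [hn1.1])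
    obtain ⟨y, hy⟩ := pr_surj (f x)
    rw [Homeomorph.trans_apply, ← hy, ← hκ.proj]
    exact (dist_pr_le _ _).trans (hdK y)

end GS

/-- There is a residual subset of `Homeo_{0,λ}(T²)` (a countable
intersection of open dense subsets, for the uniform `C⁰` topology) every element of
which has the shadowing property. -/
theorem generic_shadowing_in_Homeo0Leb :
    ∃ S : ℕ → Set (T2 ≃ₜ T2),
      (∀ n, OpenIn Homeo0Leb (S n) ∧ DenseIn Homeo0Leb (S n)) ∧
      ∀ f ∈ Homeo0Leb, (∀ n, f ∈ S n) → Shadowing f := by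
  exact ⟨GS.SS, fun n => ⟨GS.SS_open n, GS.SS_dense n⟩, GS.SS_shadow⟩
end
end
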